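/- There exist absolute constants C, c', c'' > 0 with the following property. Let 1 ≤ r < min{n,p}, θ ∈ (0,1], σ > 0 with n ≥ C·r/θ². Let A ∈ ℝ^{p×r} have rank r with spectral norm 1, and write a singular value decomposition A = U_A D_A V_Aᵀ with U_A ∈ ℝ^{p×r}, U_AᵀU_A = I_r, V_A ∈ ℝ^{r×r} orthogonal, D_A diagonal with positive entries; set Ā = U_A V_Aᵀ. Let X be a random r×n matrix with i.i.d. BG(θ,σ²) entries, Y = AX, and let D be the unique symmetric positive semidefinite p×p matrix whose range is contained in the column space of Y and which satisfies D²(YYᵀ)v = v for every v in the column space of Y (i.e. D = ((YYᵀ)⁺)^{1/2}). Then with probability at least 1 − 2e^{−c'r}: DY = ĀX̄ + ĀΔX̄, where X̄ = X/√(θnσ²) and Δ ∈ ℝ^{r×r} is a matrix with spectral norm ‖Δ‖_op ≤ c''·(1/θ)·√(r/n). -/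

import Mathlib

open Matrix MeasureTheory ProbabilityTheory Real
open scoped BigOperators ENNReal

noncomputable section

/-- squared Euclidean norm -/
def l2sq {m : ℕ} (v : Fin m → ℝ) : ℝ := ∑ i, v i ^ 2

/-- fourth power of the ℓ₄ norm -/
def l4p4 {m : ℕ} (v : Fin m → ℝ) : ℝ := ∑ i, v i ^ 4

/-- Euclidean norm -/
def l2norm {m : ℕ} (v : Fin m → ℝ) : ℝ := Real.sqrt (l2sq v)

/-- squared sup-norm -/
def linfSq {m : ℕ} (v : Fin m → ℝ) : ℝ := ⨆ i, (v i) ^ 2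

/-- projection onto the orthogonal complement of q -/
def proj {p : ℕ} (q : Fin p → ℝ) : Matrix (Fin p) (Fin p) ℝ := 1 - Matrix.vecMulVec q q

def zeta {p r : ℕ} (A : Matrix (Fin p) (Fin r) ℝ) (q : Fin p → ℝ) : Fin r → ℝ := Aᵀ *ᵥ q

/-- population objective -/
def fpop {p r : ℕ} (θ : ℝ) (A : Matrix (Fin p) (Fin r) ℝ) (q : Fin p → ℝ) : ℝ :=
  -(1/4) * ((1 - θ) * l4p4 (zeta A q) + θ * (l2sq (zeta A q)) ^ 2)

/-- Riemannian gradient of the population objective -/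
def gradf {p r : ℕ} (θ : ℝ) (A : Matrix (Fin p) (Fin r) ℝ) (q : Fin p → ℝ) : Fin p → ℝ :=
  -((proj q) *ᵥ ((1 - θ) • (A *ᵥ fun j => (zeta A q j) ^ 3)
      + (θ * l2sq (zeta A q)) • (A *ᵥ zeta A q)))

/-- Riemannian Hessian of the population objective -/
def hessf {p r : ℕ} (θ : ℝ) (A : Matrix (Fin p) (Fin r) ℝ) (q : Fin p → ℝ) :
    Matrix (Fin p) (Fin p) ℝ :=
  -((1 - θ) • (proj q *
      ((3 : ℝ) • (A * Matrix.diagonal (fun j => (zeta A q j) ^ 2) * Aᵀ)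
        - l4p4 (zeta A q) • (1 : Matrix (Fin p) (Fin p) ℝ)) * proj q))
  - θ • (proj q *
      (l2sq (zeta A q) • (A * Aᵀ)
        + (2 : ℝ) • (A * Aᵀ * Matrix.vecMulVec q q * (A * Aᵀ))
        - (l2sq (zeta A q)) ^ 2 • (1 : Matrix (Fin p) (Fin p) ℝ)) * proj q)

/-- quadratic form -/
def qform {p : ℕ} (M : Matrix (Fin p) (Fin p) ℝ) (v : Fin p → ℝ) : ℝ := v ⬝ᵥ (M *ᵥ v)

/-- α(q) -/
def alphaf {p r : ℕ} (θ : ℝ) (A : Matrix (Fin p) (Fin r) ℝ) (q : Fin p → ℝ) : ℝ :=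
  l4p4 (zeta A q) + (θ / (1 - θ)) * ((l2sq (zeta A q)) ^ 2 - l2sq (zeta A q))

/-- columns of X -/
def colX {r n : ℕ} (X : Matrix (Fin r) (Fin n) ℝ) (k : Fin n) : Fin r → ℝ := fun i => X i k

/-- finite-sample objective -/
def Ffun {p r n : ℕ} (θ σ : ℝ) (A : Matrix (Fin p) (Fin r) ℝ) (X : Matrix (Fin r) (Fin n) ℝ)
    (q : Fin p → ℝ) : ℝ :=
  -(1 / (12 * θ * σ ^ 4 * n)) * ∑ k : Fin n, (q ⬝ᵥ (A *ᵥ colX X k)) ^ 4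

/-- Riemannian gradient of the finite-sample objective -/
def gradF {p r n : ℕ} (θ σ : ℝ) (A : Matrix (Fin p) (Fin r) ℝ) (X : Matrix (Fin r) (Fin n) ℝ)
    (q : Fin p → ℝ) : Fin p → ℝ :=
  (-(1 / (3 * θ * σ ^ 4 * n))) •
    ((proj q) *ᵥ ∑ k : Fin n, ((q ⬝ᵥ (A *ᵥ colX X k)) ^ 3) • (A *ᵥ colX X k))

/-- Riemannian Hessian of the finite-sample objective -/
def hessF {p r n : ℕ} (θ σ : ℝ) (A : Matrix (Fin p) (Fin r) ℝ) (X : Matrix (Fin r) (Fin n) ℝ)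
    (q : Fin p → ℝ) : Matrix (Fin p) (Fin p) ℝ :=
  (-(1 / (3 * θ * σ ^ 4 * n))) •
    ∑ k : Fin n, proj q *
      ((3 * (q ⬝ᵥ (A *ᵥ colX X k)) ^ 2) • Matrix.vecMulVec (A *ᵥ colX X k) (A *ᵥ colX X k)
        - ((q ⬝ᵥ (A *ᵥ colX X k)) ^ 4) • (1 : Matrix (Fin p) (Fin p) ℝ)) * proj q

/-- spectral norm of a rectangular matrix -/
def opNorm {m n : ℕ} (M : Matrix (Fin m) (Fin n) ℝ) : ℝ :=
  ‖LinearMap.toContinuousLinearMap (Matrix.toEuclideanLin M)‖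

/-- Bernoulli(θ) law on ℝ -/
def bernoulliReal (θ : ℝ) : Measure ℝ :=
  ENNReal.ofReal θ • Measure.dirac (1 : ℝ) + ENNReal.ofReal (1 - θ) • Measure.dirac (0 : ℝ)

/-- Bernoulli–Gaussian law BG(θ, σ²) on ℝ -/
def bgLaw (θ σ2 : ℝ) : Measure ℝ :=
  ((bernoulliReal θ).prod (gaussianReal 0 σ2.toNNReal)).map fun p => p.1 * p.2

/-- law of a random vector in ℝ^r with i.i.d. BG(θ, σ²) entries -/
def bgVec (r : ℕ) (θ σ2 : ℝ) : Measure (Fin r → ℝ) :=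
  Measure.pi fun _ : Fin r => bgLaw θ σ2

/-- law of a random r×n matrix with i.i.d. BG(θ, σ²) entries -/
def bgMatrix (r n : ℕ) (θ σ2 : ℝ) : Measure (Fin r → Fin n → ℝ) :=
  Measure.pi fun _ : Fin r => Measure.pi fun _ : Fin n => bgLaw θ σ2

set_option linter.unusedSectionVars false

section GaussianConcentration

open scoped NNReal

variable {ι : Type*} [Fintype ι]

lemma pi_gaussianReal_absolutelyContinuous :
    (Measure.pi fun _ : ι ↦ gaussianReal 0 1) ≪ (volume : Measure (ι → ℝ)) := by
  have h : (Measure.pi fun _ : ι ↦ gaussianReal 0 1) =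
      (volume : Measure (ι → ℝ)).withDensity
        (fun x ↦ ENNReal.ofReal (∏ i, gaussianPDFReal 0 1 (x i))) := by
    refine Measure.pi_eq fun s hs ↦ ?_
    rw [withDensity_apply _ (MeasurableSet.univ_pi hs), volume_pi, Measure.restrict_pi_pi,
      ← ofReal_integral_eq_lintegral_ofReal, integral_fintype_prod_eq_prod,
      ENNReal.ofReal_prod_of_nonneg]
    · refine Finset.prod_congr rfl fun i _ ↦ ?_
      rw [gaussianReal_apply_eq_integral _ one_ne_zero]
    · exact fun i _ ↦ integral_nonneg fun x ↦ gaussianPDFReal_nonneg _ _ _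
    · exact Integrable.fintype_prod fun i ↦ (integrable_gaussianPDFReal 0 1).restrict
    · exact ae_of_all _ fun x ↦ Finset.prod_nonneg fun i _ ↦ gaussianPDFReal_nonneg _ _ _
  rw [h]
  exact withDensity_absolutelyContinuous _ _

lemma stdGaussian_absolutelyContinuous :
    stdGaussian (EuclideanSpace ℝ ι) ≪ (volume : Measure (EuclideanSpace ℝ ι)) := by
  rw [← map_pi_eq_stdGaussian, ← (PiLp.volume_preserving_toLp ι).map_eq]
  exact pi_gaussianReal_absolutelyContinuous.map (by fun_prop)

lemma integrable_exp_mul_norm_stdGaussian (a : ℝ) :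
    Integrable (fun x ↦ Real.exp (a * ‖x‖)) (stdGaussian (EuclideanSpace ℝ ι)) := by
  obtain ⟨C, hC, hi⟩ := IsGaussian.exists_integrable_exp_sq (stdGaussian (EuclideanSpace ℝ ι))
  refine (hi.const_mul (Real.exp (a ^ 2 / (4 * C)))).mono' (by fun_prop) (ae_of_all _ fun x ↦ ?_)
  rw [Real.norm_eq_abs, Real.abs_exp, ← Real.exp_add]
  refine Real.exp_le_exp.2 ?_
  have : a ^ 2 / (4 * C) + C * ‖x‖ ^ 2 - a * ‖x‖ = (a - 2 * C * ‖x‖) ^ 2 / (4 * C) := by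
    field_simp; ring
  have h2 : 0 ≤ (a - 2 * C * ‖x‖) ^ 2 / (4 * C) := by positivity
  linarith

lemma integral_exp_dual_stdGaussian (L : StrongDual ℝ (EuclideanSpace ℝ ι)) (s : ℝ) :
    ∫ y, Real.exp (s * L y) ∂(stdGaussian (EuclideanSpace ℝ ι)) =
      Real.exp (s ^ 2 * ‖L‖ ^ 2 / 2) := by
  have h := IsGaussian.map_eq_gaussianReal (μ := stdGaussian (EuclideanSpace ℝ ι)) L
  rw [integral_strongDual_stdGaussian, variance_dual_stdGaussian] at h
  have h2 := mgf_gaussianReal h s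
  rw [mgf] at h2
  rw [h2]
  congr 1
  rw [Real.coe_toNNReal _ (by positivity)]
  ring

variable {f : EuclideanSpace ℝ ι → ℝ} {K : ℝ≥0}

lemma integrable_exp_mul_lipschitz_stdGaussian (hf : LipschitzWith K f) (s : ℝ) :
    Integrable (fun x ↦ Real.exp (s * f x)) (stdGaussian (EuclideanSpace ℝ ι)) := by
  have hc := hf.continuous
  refine ((integrable_exp_mul_norm_stdGaussian (|s| * K)).const_mul
    (Real.exp (|s| * |f 0|))).mono' (by fun_prop) (ae_of_all _ fun x ↦ ?_)
  rw [Real.norm_eq_abs, Real.abs_exp, ← Real.exp_add]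
  refine Real.exp_le_exp.2 ?_
  have h := hf.dist_le_mul x 0
  rw [Real.dist_eq, dist_zero_right] at h
  have h1 : |f x| ≤ |f 0| + K * ‖x‖ := by
    have := abs_sub_abs_le_abs_sub (f x) (f 0); linarith
  calc s * f x ≤ |s| * |f x| := by rw [← abs_mul]; exact le_abs_self _
    _ ≤ |s| * (|f 0| + K * ‖x‖) := by gcongr
    _ = _ := by ring

lemma integrable_lipschitz_stdGaussian (hf : LipschitzWith K f) :
    Integrable f (stdGaussian (EuclideanSpace ℝ ι)) := by
  refine ((integrable_exp_mul_lipschitz_stdGaussian hf 1).add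
    (integrable_exp_mul_lipschitz_stdGaussian hf (-1))).mono'
    hf.continuous.aestronglyMeasurable (ae_of_all _ fun x ↦ ?_)
  simp only [Pi.add_apply, one_mul, neg_mul, Real.norm_eq_abs]
  refine abs_le.2 ⟨?_, ?_⟩
  · have := Real.add_one_le_exp (-f x); have := Real.exp_pos (f x); linarith
  · have := Real.add_one_le_exp (f x); have := Real.exp_pos (-f x); linarith

/-- One step of the rotation path from `x` to `y`. -/
lemma integral_exp_sub_le_rotation_step (hf : LipschitzWith K f) (s : ℝ) {N : ℕ} (hN : 0 < N) :
    ∫ z : EuclideanSpace ℝ ι × EuclideanSpace ℝ ι, Real.exp (s * (f z.1 - f z.2))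
        ∂((stdGaussian (EuclideanSpace ℝ ι)).prod (stdGaussian (EuclideanSpace ℝ ι))) ≤
      ∫ z : EuclideanSpace ℝ ι × EuclideanSpace ℝ ι,
        Real.exp (s * (N * (f z.1 - f (Real.cos (Real.pi / 2 / N) • z.1 +
          Real.sin (Real.pi / 2 / N) • z.2))))
        ∂((stdGaussian (EuclideanSpace ℝ ι)).prod (stdGaussian (EuclideanSpace ℝ ι))) := by
  set τ := Real.pi / 2 / N with hτ
  set μ := (stdGaussian (EuclideanSpace ℝ ι)).prod (stdGaussian (EuclideanSpace ℝ ι)) with hμ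
  have hc := hf.continuous
  have hN0 : (N : ℝ) ≠ 0 := by positivity
  set g : EuclideanSpace ℝ ι × EuclideanSpace ℝ ι → ℝ := fun z ↦
    Real.exp (s * (N * (f z.1 - f (Real.cos τ • z.1 +
        Real.sin τ • z.2)))) with hg
  have hgc : Continuous g := by fun_prop
  have hinv (t : ℝ) : μ.map (ContinuousLinearMap.rotation t) = μ :=
    IsGaussian.map_rotation_eq_self (by simp) t
  have hnorm (z : EuclideanSpace ℝ ι × EuclideanSpace ℝ ι) :
      |f z.1 - f (Real.cos τ • z.1 + Real.sin τ • z.2)| ≤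
      K * (2 * ‖z.1‖ + ‖z.2‖) := by
    have h := hf.dist_le_mul z.1 (Real.cos τ • z.1 + Real.sin τ • z.2)
    rw [Real.dist_eq] at h
    refine h.trans ?_
    gcongr
    rw [dist_eq_norm]
    calc ‖z.1 - (Real.cos τ • z.1 + Real.sin τ • z.2)‖
        ≤ ‖z.1‖ + (‖Real.cos τ • z.1‖ + ‖Real.sin τ • z.2‖) :=
          (norm_sub_le _ _).trans (by gcongr; exact norm_add_le _ _)
      _ ≤ ‖z.1‖ + (1 * ‖z.1‖ + 1 * ‖z.2‖) := by
          rw [norm_smul, norm_smul]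
          gcongr
          · exact Real.abs_cos_le_one _
          · exact Real.abs_sin_le_one _
      _ = _ := by ring
  have hgi : Integrable g μ := by
    refine ((integrable_exp_mul_norm_stdGaussian (|s| * N * K * 2)).mul_prod
      (integrable_exp_mul_norm_stdGaussian (|s| * N * K))).mono' hgc.aestronglyMeasurable
      (ae_of_all _ fun z ↦ ?_)
    rw [Real.norm_eq_abs, hg, Real.abs_exp, ← Real.exp_add]
    refine Real.exp_le_exp.2 ?_
    calc _ ≤ |s * (N * (f z.1 - f (Real.cos τ • z.1 + Real.sin τ • z.2)))| := le_abs_self _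
      _ = |s| * N * |f z.1 - f (Real.cos τ • z.1 + Real.sin τ • z.2)| := by
        rw [abs_mul, abs_mul, Nat.abs_cast, mul_assoc]
      _ ≤ |s| * N * (K * (2 * ‖z.1‖ + ‖z.2‖)) := by gcongr; exact hnorm z
      _ = _ := by ring
  have hgr (t : ℝ) : Integrable (fun z ↦ g (ContinuousLinearMap.rotation t z)) μ := by
    have : Integrable g (μ.map (ContinuousLinearMap.rotation t)) := by rwa [hinv]
    exact (integrable_map_measure hgc.aestronglyMeasurable (by fun_prop)).1 this
  have hgr' (t : ℝ) : ∫ z, g (ContinuousLinearMap.rotation t z) ∂μ = ∫ z, g z ∂μ := by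
    conv_rhs => rw [← hinv t]
    rw [integral_map (by fun_prop) hgc.aestronglyMeasurable]
  have hpt (z : EuclideanSpace ℝ ι × EuclideanSpace ℝ ι) : Real.exp (s * (f z.1 - f z.2)) ≤
      ∑ k ∈ Finset.range N, (N : ℝ)⁻¹ * g (ContinuousLinearMap.rotation (k * τ) z) := by
    set F : ℕ → ℝ := fun k ↦ f (Real.cos (k * τ) • z.1 + Real.sin (k * τ) • z.2) with hF
    have hFk (k : ℕ) : g (ContinuousLinearMap.rotation (k * τ) z) =
        Real.exp (s * (N * (F k - F (k + 1)))) := by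
      simp only [hg, hF, ContinuousLinearMap.rotation_apply]
      congr 5
      push_cast
      rw [add_mul, one_mul, Real.cos_add, Real.sin_add]
      module
    have hsum : f z.1 - f z.2 = ∑ k ∈ Finset.range N, (F k - F (k + 1)) := by
      rw [Finset.sum_range_sub']
      simp only [hF, hτ]
      rw [show (N : ℝ) * (Real.pi / 2 / N) = Real.pi / 2 by field_simp]
      simp
    simp_rw [hFk]
    have := convexOn_exp.map_sum_le (t := Finset.range N) (w := fun _ ↦ (N : ℝ)⁻¹)
      (p := fun k ↦ s * (N * (F k - F (k + 1)))) (by intros; positivity)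
      (by simp [hN0]) (by simp)
    simp only [smul_eq_mul] at this
    refine le_trans (le_of_eq ?_) this
    rw [hsum, Finset.mul_sum]
    congr 1
    refine Finset.sum_congr rfl fun k _ ↦ ?_
    field_simp
  calc _ ≤ ∫ z, ∑ k ∈ Finset.range N,
        (N : ℝ)⁻¹ * g (ContinuousLinearMap.rotation (k * τ) z) ∂μ := by
        refine integral_mono_of_nonneg (ae_of_all _ fun z ↦ (Real.exp_pos _).le) ?_
          (ae_of_all _ hpt)
        exact integrable_finsetSum _ fun k _ ↦ (hgr _).const_mul _
    _ = ∫ z, g z ∂μ := by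
        rw [integral_finsetSum _ fun k _ ↦ (hgr _).const_mul _]
        simp_rw [integral_const_mul, hgr']
        simp [hN0]

lemma integral_exp_sub_lipschitz_stdGaussian_le (hf : LipschitzWith K f) (s : ℝ) :
    ∫ z : EuclideanSpace ℝ ι × EuclideanSpace ℝ ι, Real.exp (s * (f z.1 - f z.2))
        ∂((stdGaussian (EuclideanSpace ℝ ι)).prod (stdGaussian (EuclideanSpace ℝ ι))) ≤
      Real.exp (s ^ 2 * Real.pi ^ 2 * K ^ 2 / 8) := by
  set μ := (stdGaussian (EuclideanSpace ℝ ι)).prod (stdGaussian (EuclideanSpace ℝ ι)) with hμ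
  have hc := hf.continuous
  set bound : EuclideanSpace ℝ ι × EuclideanSpace ℝ ι → ℝ := fun z ↦
    Real.exp (|s| * (K * (Real.pi / 2)) * ‖z.1‖) *
    Real.exp (|s| * (K * (Real.pi / 2)) * ‖z.2‖) with hbound
  have hbi : Integrable bound μ := (integrable_exp_mul_norm_stdGaussian _).mul_prod
      (integrable_exp_mul_norm_stdGaussian _)
  have hdiff : ∀ᵐ z ∂μ, DifferentiableAt ℝ f z.1 := by
    have h1 : ∀ᵐ x ∂(stdGaussian (EuclideanSpace ℝ ι)), DifferentiableAt ℝ f x :=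
      stdGaussian_absolutelyContinuous.ae_le (hf.ae_differentiableAt (μ := volume))
    exact Measure.quasiMeasurePreserving_fst.ae h1
  have htend : Filter.Tendsto (fun N : ℕ ↦ ∫ z : EuclideanSpace ℝ ι × EuclideanSpace ℝ ι,
      Real.exp (s * (N * (f z.1 -
        f (Real.cos (Real.pi / 2 / N) • z.1 + Real.sin (Real.pi / 2 / N) • z.2)))) ∂μ)
      Filter.atTop (nhds (∫ z : EuclideanSpace ℝ ι × EuclideanSpace ℝ ι,
        Real.exp (-(s * (Real.pi / 2)) * fderiv ℝ f z.1 z.2) ∂μ)) := by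
    refine tendsto_integral_of_dominated_convergence bound
      (fun N ↦ Continuous.aestronglyMeasurable (by fun_prop)) hbi
      (fun N ↦ ae_of_all _ fun z ↦ ?_) ?_
    · rw [Real.norm_eq_abs, Real.abs_exp, hbound]
      simp only [← Real.exp_add]
      refine Real.exp_le_exp.2 ?_
      rcases Nat.eq_zero_or_pos N with rfl | hN
      · simp; positivity
      set τ := Real.pi / 2 / N with hτ
      have hτ0 : 0 ≤ τ := by positivity
      have hcos : |1 - Real.cos τ| ≤ τ := by
        have h := Real.abs_cos_sub_cos_le 0 τ
        rw [Real.cos_zero] at h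
        simpa [abs_of_nonneg hτ0] using h
      have hsin : |Real.sin τ| ≤ τ := by
        simpa [abs_of_nonneg hτ0] using Real.abs_sin_le_abs (x := τ)
      have h := hf.dist_le_mul z.1 (Real.cos τ • z.1 + Real.sin τ • z.2)
      rw [Real.dist_eq, dist_eq_norm] at h
      have h2 : ‖z.1 - (Real.cos τ • z.1 + Real.sin τ • z.2)‖ ≤ τ * ‖z.1‖ + τ * ‖z.2‖ := by
        rw [show z.1 - (Real.cos τ • z.1 + Real.sin τ • z.2) =
          (1 - Real.cos τ) • z.1 - Real.sin τ • z.2 by module]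
        refine (norm_sub_le _ _).trans ?_
        rw [norm_smul, norm_smul, Real.norm_eq_abs, Real.norm_eq_abs]
        gcongr
      calc _ ≤ |s * (N * (f z.1 - f (Real.cos τ • z.1 + Real.sin τ • z.2)))| := le_abs_self _
        _ = |s| * (N * |f z.1 - f (Real.cos τ • z.1 + Real.sin τ • z.2)|) := by
          rw [abs_mul, abs_mul, Nat.abs_cast]
        _ ≤ |s| * (N * (K * (τ * ‖z.1‖ + τ * ‖z.2‖))) := by
          gcongr; exact h.trans (by gcongr)
        _ = _ := by rw [hτ]; field_simp
    · filter_upwards [hdiff] with z hz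
      refine (Real.continuous_exp.tendsto _).comp ?_
      have hcurve : HasDerivAt (fun t : ℝ ↦ Real.cos t • z.1 + Real.sin t • z.2) z.2 0 := by
        have h1 := ((Real.hasDerivAt_cos 0).smul_const z.1).add
          ((Real.hasDerivAt_sin 0).smul_const z.2)
        simp only [Real.sin_zero, neg_zero, zero_smul, Real.cos_zero, one_smul, zero_add] at h1
        exact h1
      have hg : HasDerivAt (fun t : ℝ ↦ f (Real.cos t • z.1 + Real.sin t • z.2))
          (fderiv ℝ f z.1 z.2) 0 := by
        have hz' : HasFDerivAt f (fderiv ℝ f z.1) (Real.cos 0 • z.1 + Real.sin 0 • z.2) := by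
          simpa using hz.hasFDerivAt
        exact hz'.comp_hasDerivAt 0 hcurve
      have hsl := hg.tendsto_slope_zero
      have hτ : Filter.Tendsto (fun N : ℕ ↦ Real.pi / 2 / (N : ℝ)) Filter.atTop
          (nhdsWithin 0 {0}ᶜ) := by
        refine tendsto_nhdsWithin_iff.2 ⟨tendsto_const_div_atTop_nhds_zero_nat _, ?_⟩
        filter_upwards [Filter.eventually_gt_atTop 0] with N hN
        have : Real.pi / 2 / (N : ℝ) ≠ 0 := by positivity
        simpa using this
      have h3 := ((hsl.comp hτ).const_mul (-(s * (Real.pi / 2))))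
      refine h3.congr' ?_
      filter_upwards [Filter.eventually_gt_atTop 0] with N hN
      have hpi := Real.pi_pos.ne'
      simp only [Function.comp_apply, zero_add, Real.cos_zero, Real.sin_zero, one_smul, zero_smul,
        add_zero, smul_eq_mul]
      field_simp
      ring
  have hle := ge_of_tendsto htend (b := ∫ z : EuclideanSpace ℝ ι × EuclideanSpace ℝ ι,
      Real.exp (s * (f z.1 - f z.2)) ∂μ) (by
    filter_upwards [Filter.eventually_gt_atTop 0] with N hN
    exact integral_exp_sub_le_rotation_step hf s hN)
  refine hle.trans ?_
  have hmeas : Measurable fun z : EuclideanSpace ℝ ι × EuclideanSpace ℝ ι ↦ fderiv ℝ f z.1 z.2 := by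
    have h1 : Measurable fun z : EuclideanSpace ℝ ι × EuclideanSpace ℝ ι ↦ fderiv ℝ f z.1 :=
      (measurable_fderiv ℝ f).comp measurable_fst
    exact isBoundedBilinearMap_apply.continuous.measurable.comp (h1.prodMk measurable_snd)
  have hi : Integrable (fun z : EuclideanSpace ℝ ι × EuclideanSpace ℝ ι ↦
      Real.exp (-(s * (Real.pi / 2)) * fderiv ℝ f z.1 z.2)) μ := by
    refine hbi.mono' (by fun_prop) (ae_of_all _ fun z ↦ ?_)
    rw [Real.norm_eq_abs, Real.abs_exp, hbound]
    simp only [← Real.exp_add]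
    refine Real.exp_le_exp.2 ?_
    have h1 : |fderiv ℝ f z.1 z.2| ≤ K * ‖z.2‖ := by
      refine (ContinuousLinearMap.le_opNorm (fderiv ℝ f z.1) z.2).trans ?_
      exact mul_le_mul_of_nonneg_right (norm_fderiv_le_of_lipschitz ℝ hf) (norm_nonneg _)
    calc _ ≤ |-(s * (Real.pi / 2)) * fderiv ℝ f z.1 z.2| := le_abs_self _
      _ = |s| * (Real.pi / 2) * |fderiv ℝ f z.1 z.2| := by
        rw [abs_mul, abs_neg, abs_mul, abs_of_pos (by positivity : 0 < Real.pi / 2)]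
      _ ≤ |s| * (Real.pi / 2) * (K * ‖z.2‖) := by gcongr
      _ = 0 + |s| * (K * (Real.pi / 2)) * ‖z.2‖ := by ring
      _ ≤ _ := by gcongr; positivity
  rw [hμ, integral_prod _ hi]
  simp_rw [integral_exp_dual_stdGaussian]
  calc _ ≤ ∫ x : EuclideanSpace ℝ ι, Real.exp (s ^ 2 * Real.pi ^ 2 * K ^ 2 / 8)
        ∂(stdGaussian (EuclideanSpace ℝ ι)) := by
        refine integral_mono_of_nonneg (ae_of_all _ fun z ↦ (Real.exp_pos _).le)
          (integrable_const _) (ae_of_all _ fun x ↦ Real.exp_le_exp.2 ?_)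
        have : ‖fderiv ℝ f x‖ ≤ K := norm_fderiv_le_of_lipschitz ℝ hf
        calc (-(s * (Real.pi / 2))) ^ 2 * ‖fderiv ℝ f x‖ ^ 2 / 2
            ≤ (-(s * (Real.pi / 2))) ^ 2 * K ^ 2 / 2 := by gcongr
          _ = _ := by ring
    _ = _ := by simp

/-- Gaussian concentration for Lipschitz functions, in moment generating form. -/
theorem integral_exp_lipschitz_stdGaussian_le (hf : LipschitzWith K f) (s : ℝ) :
    ∫ x, Real.exp (s * (f x - ∫ y, f y ∂(stdGaussian (EuclideanSpace ℝ ι))))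
        ∂(stdGaussian (EuclideanSpace ℝ ι)) ≤
      Real.exp (s ^ 2 * Real.pi ^ 2 * K ^ 2 / 8) := by
  refine le_trans ?_ (integral_exp_sub_lipschitz_stdGaussian_le hf s)
  have hc := hf.continuous
  have hi : Integrable (fun z : EuclideanSpace ℝ ι × EuclideanSpace ℝ ι ↦
      Real.exp (s * (f z.1 - f z.2)))
      ((stdGaussian (EuclideanSpace ℝ ι)).prod (stdGaussian (EuclideanSpace ℝ ι))) := by
    have := (integrable_exp_mul_lipschitz_stdGaussian hf s).mul_prod
      (integrable_exp_mul_lipschitz_stdGaussian hf (-s))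
    refine this.congr (ae_of_all _ fun z ↦ ?_)
    simp only [← Real.exp_add]
    congr 1; ring
  rw [integral_prod _ hi]
  refine integral_mono_of_nonneg (ae_of_all _ fun z ↦ (Real.exp_pos _).le) hi.integral_prod_left
    (ae_of_all _ fun x ↦ ?_)
  have hfi := integrable_lipschitz_stdGaussian hf
  have h1 : s * (f x - ∫ y, f y ∂(stdGaussian (EuclideanSpace ℝ ι))) =
      ∫ y, s * (f x - f y) ∂(stdGaussian (EuclideanSpace ℝ ι)) := by
    rw [integral_const_mul, integral_sub (integrable_const _) hfi]
    simp
  simp only [h1]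
  refine convexOn_exp.map_integral_le (μ := stdGaussian (EuclideanSpace ℝ ι))
    Real.continuous_exp.continuousOn
    isClosed_univ (ae_of_all _ fun _ ↦ Set.mem_univ _)
    (((integrable_const _).sub hfi).const_mul s) ?_
  have := (integrable_exp_mul_lipschitz_stdGaussian hf (-s)).const_mul (Real.exp (s * f x))
  refine this.congr (ae_of_all _ fun y ↦ ?_)
  simp only [Function.comp_apply, ← Real.exp_add]
  congr 1; ring

end GaussianConcentration

section GaussianQuantile

/-- Upper tail of the standard Gaussian. -/
def gaussTail (x : ℝ) : ℝ := ∫ t in Set.Ioi x, gaussianPDFReal 0 1 t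

lemma gaussTail_eq_measure (x : ℝ) :
    gaussianReal 0 1 (Set.Ioi x) = ENNReal.ofReal (gaussTail x) :=
  gaussianReal_apply_eq_integral _ one_ne_zero _

lemma continuous_gaussianPDFReal_std : Continuous (gaussianPDFReal 0 1) := by
  unfold gaussianPDFReal; fun_prop

lemma gaussTail_eq_sub (x : ℝ) :
    gaussTail x = gaussTail 0 - ∫ t in (0 : ℝ)..x, gaussianPDFReal 0 1 t := by
  have hi := integrable_gaussianPDFReal 0 1
  have := intervalIntegral.integral_interval_add_Ioi (a := 0) (b := x)
    hi.integrableOn hi.integrableOn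
  unfold gaussTail
  linarith

lemma hasStrictDerivAt_gaussTail (x : ℝ) :
    HasStrictDerivAt gaussTail (-gaussianPDFReal 0 1 x) x := by
  have hc := continuous_gaussianPDFReal_std
  have h := (intervalIntegral.integral_hasStrictDerivAt_right
    (hc.intervalIntegrable 0 x) (hc.stronglyMeasurableAtFilter _ _) hc.continuousAt)
  have h2 := h.const_sub (gaussTail 0)
  have : gaussTail = fun x ↦ gaussTail 0 - ∫ t in (0 : ℝ)..x, gaussianPDFReal 0 1 t :=
    funext gaussTail_eq_sub
  rwa [← this] at h2

lemma hasDerivAt_gaussianPDFReal_std (x : ℝ) :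
    HasDerivAt (gaussianPDFReal 0 1) (-x * gaussianPDFReal 0 1 x) x := by
  unfold gaussianPDFReal
  have h : HasDerivAt (fun x : ℝ ↦ -(x - 0) ^ 2 / (2 * ((1 : NNReal) : ℝ))) (-x) x := by
    have := (((hasDerivAt_id x).sub_const 0).pow 2).neg.div_const (2 * ((1 : NNReal) : ℝ))
    refine this.congr_deriv ?_
    simp
    ring
  refine (h.exp.const_mul _).congr_deriv ?_
  ring

lemma strictAnti_gaussTail : StrictAnti gaussTail := by
  refine strictAnti_of_deriv_neg fun x ↦ ?_
  rw [(hasStrictDerivAt_gaussTail x).hasDerivAt.deriv]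
  have := gaussianPDFReal_pos 0 1 x one_ne_zero
  linarith

lemma continuous_gaussTail : Continuous gaussTail :=
  continuous_iff_continuousAt.2 fun x ↦ (hasStrictDerivAt_gaussTail x).hasDerivAt.continuousAt

lemma gaussTail_nonneg (x : ℝ) : 0 ≤ gaussTail x :=
  integral_nonneg fun _ ↦ gaussianPDFReal_nonneg _ _ _

lemma gaussTail_pos (x : ℝ) : 0 < gaussTail x :=
  (gaussTail_nonneg (x + 1)).trans_lt (strictAnti_gaussTail (by linarith))

lemma gaussianReal_Iio_eq_Ioi_neg (x : ℝ) :
    gaussianReal 0 1 (Set.Iio x) = gaussianReal 0 1 (Set.Ioi (-x)) := by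
  have h := gaussianReal_map_neg (μ := 0) (v := 1)
  rw [neg_zero] at h
  conv_lhs => rw [← h]
  rw [Measure.map_apply (by fun_prop) measurableSet_Iio]
  congr 1
  ext t; simp

lemma gaussTail_zero : gaussTail 0 = 1 / 2 := by
  have h1 := gaussianReal_Iio_eq_Ioi_neg 0
  have : NullSingletonClass (gaussianReal 0 1) := nullSingletonClass_gaussianReal one_ne_zero
  rw [neg_zero, gaussTail_eq_measure] at h1
  have h2 := measure_add_measure_compl (μ := gaussianReal 0 1) (measurableSet_Ioi (a := (0 : ℝ)))
  rw [Set.compl_Ioi, ← measure_congr Iio_ae_eq_Iic, h1, gaussTail_eq_measure, measure_univ,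
    ← ENNReal.ofReal_add (gaussTail_nonneg _) (gaussTail_nonneg _), ENNReal.ofReal_eq_one] at h2
  linarith

lemma tendsto_gaussTail : Filter.Tendsto gaussTail Filter.atTop (nhds 0) := by
  have h := tendsto_setIntegral_of_antitone (μ := volume) (f := gaussianPDFReal 0 1)
    (s := fun x : ℝ ↦ Set.Ioi x) (fun x ↦ measurableSet_Ioi)
    (fun a b hab ↦ Set.Ioi_subset_Ioi hab) ⟨0, (integrable_gaussianPDFReal 0 1).integrableOn⟩
  have h0 : ⋂ x : ℝ, Set.Ioi x = ∅ := by
    ext t; simp only [Set.mem_iInter, Set.mem_Ioi, Set.mem_empty_iff_false, iff_false, not_forall]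
    exact ⟨t, lt_irrefl _⟩
  rw [h0, setIntegral_empty] at h
  exact h

lemma exists_gaussTail_eq {y : ℝ} (hy : 0 < y) (hy2 : y ≤ 1 / 2) :
    ∃ x, 0 ≤ x ∧ gaussTail x = y := by
  obtain ⟨b, hb⟩ := ((tendsto_gaussTail.eventually_lt_const hy).and
    (Filter.eventually_ge_atTop 0)).exists
  have := intermediate_value_Icc' hb.2 continuous_gaussTail.continuousOn
  obtain ⟨x, hx, hxy⟩ := this ⟨hb.1.le, by rwa [gaussTail_zero]⟩
  exact ⟨x, hx.1, hxy⟩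

lemma pdf_le_two_mul_gaussTail {x : ℝ} (hx : 1 ≤ x) :
    gaussianPDFReal 0 1 x ≤ 2 * x * gaussTail x := by
  set k : ℝ → ℝ := fun x ↦ gaussTail x - gaussianPDFReal 0 1 x / (2 * x) with hk
  have hd (x : ℝ) (hx : 1 ≤ x) : HasDerivAt k (-gaussianPDFReal 0 1 x -
      ((-x * gaussianPDFReal 0 1 x) * (2 * x) - gaussianPDFReal 0 1 x * (2 * 1)) / (2 * x) ^ 2) x :=
    (hasStrictDerivAt_gaussTail x).hasDerivAt.sub ((hasDerivAt_gaussianPDFReal_std x).div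
      ((hasDerivAt_id x).const_mul 2) (by positivity))
  have hanti : AntitoneOn k (Set.Ici 1) := by
    refine antitoneOn_of_deriv_nonpos (convex_Ici 1)
      (fun y hy ↦ (hd y hy).continuousAt.continuousWithinAt) ?_ ?_
    · rw [interior_Ici]
      exact fun y hy ↦ (hd y (le_of_lt hy)).differentiableAt.differentiableWithinAt
    · rw [interior_Ici]
      intro y hy
      have hy1 : 1 ≤ y := le_of_lt hy
      have hy0 : 0 < y := by linarith
      rw [(hd y hy1).deriv]
      have hg := gaussianPDFReal_nonneg 0 1 y
      have : -gaussianPDFReal 0 1 y - ((-y * gaussianPDFReal 0 1 y) * (2 * y) -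
          gaussianPDFReal 0 1 y * (2 * 1)) / (2 * y) ^ 2 =
          -(gaussianPDFReal 0 1 y * ((y ^ 2 - 1) / (2 * y ^ 2))) := by
        field_simp; ring
      rw [this, neg_nonpos]
      have : 0 ≤ (y ^ 2 - 1) / (2 * y ^ 2) := div_nonneg (by nlinarith) (by positivity)
      positivity
  have hlim : Filter.Tendsto k Filter.atTop (nhds 0) := by
    have h2 : Filter.Tendsto (fun x : ℝ ↦ gaussianPDFReal 0 1 x / (2 * x)) Filter.atTop
        (nhds 0) := by
      have hb : Filter.Tendsto (fun x : ℝ ↦ (√(2 * π * ((1 : NNReal) : ℝ)))⁻¹ / (2 * x))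
          Filter.atTop (nhds 0) :=
        Filter.Tendsto.const_div_atTop (Filter.tendsto_id.const_mul_atTop (by norm_num)) _
      refine tendsto_of_tendsto_of_tendsto_of_le_of_le' tendsto_const_nhds hb ?_ ?_
      · filter_upwards [Filter.eventually_gt_atTop 0] with y hy
        exact div_nonneg (gaussianPDFReal_nonneg _ _ _) (by positivity)
      · filter_upwards [Filter.eventually_gt_atTop 0] with y hy
        gcongr
        unfold gaussianPDFReal
        refine mul_le_of_le_one_right (by positivity) (Real.exp_le_one_iff.2 ?_)
        have : 0 ≤ (y - 0) ^ 2 / (2 * ((1 : NNReal) : ℝ)) := by positivity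
        rw [neg_div]; linarith
    simpa using tendsto_gaussTail.sub h2
  have h0 : 0 ≤ k x := by
    refine le_of_tendsto hlim ?_
    filter_upwards [Filter.eventually_ge_atTop x] with t ht
    exact hanti hx (hx.trans ht) ht
  have hx0 : 0 < x := by linarith
  simp only [hk, sub_nonneg] at h0
  rwa [div_le_iff₀ (by positivity), mul_comm] at h0

lemma antitoneOn_sq_pdf_div_gaussTail :
    AntitoneOn (fun x ↦ gaussianPDFReal 0 1 x ^ 2 / gaussTail x) (Set.Ici 1) := by
  have hd (x : ℝ) := ((hasDerivAt_gaussianPDFReal_std x).pow 2).div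
    (hasStrictDerivAt_gaussTail x).hasDerivAt (gaussTail_pos x).ne'
  refine antitoneOn_of_deriv_nonpos (convex_Ici 1)
      (fun y hy ↦ (hd y).continuousAt.continuousWithinAt) ?_ ?_
  · exact fun y hy ↦ (hd y).differentiableAt.differentiableWithinAt
  · rw [interior_Ici]
    intro y hy
    have hy1 : 1 ≤ y := le_of_lt hy
    change deriv (gaussianPDFReal 0 1 ^ 2 / gaussTail) y ≤ 0
    rw [(hd y).deriv]
    refine div_nonpos_of_nonpos_of_nonneg ?_ (by positivity)
    have h1 := pdf_le_two_mul_gaussTail hy1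
    have hg := gaussianPDFReal_nonneg 0 1 y
    have : gaussianPDFReal 0 1 y ^ 2 * (gaussianPDFReal 0 1 y - 2 * y * gaussTail y) ≤ 0 :=
      mul_nonpos_of_nonneg_of_nonpos (by positivity) (by linarith)
    simp only [Pi.pow_apply]
    push_cast
    nlinarith [this]

lemma gaussianPDFReal_std_anti {x y : ℝ} (hx : 0 ≤ x) (hxy : x ≤ y) :
    gaussianPDFReal 0 1 y ≤ gaussianPDFReal 0 1 x := by
  unfold gaussianPDFReal
  gcongr

lemma exists_sq_pdf_div_gaussTail_le : ∃ K : ℝ, 0 < K ∧ ∀ x z : ℝ, 0 ≤ x → x ≤ z →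
    gaussianPDFReal 0 1 z ^ 2 / gaussTail z ≤
      K ^ 2 * (gaussianPDFReal 0 1 x ^ 2 / gaussTail x) := by
  have hp (x : ℝ) : 0 < gaussianPDFReal 0 1 x := gaussianPDFReal_pos 0 1 x one_ne_zero
  set a := gaussianPDFReal 0 1 0 ^ 2 / gaussTail 1 with ha
  set b := gaussianPDFReal 0 1 1 ^ 2 / gaussTail 0 with hb
  have ha0 : 0 < a := div_pos (pow_pos (hp _) 2) (gaussTail_pos _)
  have hb0 : 0 < b := div_pos (pow_pos (hp _) 2) (gaussTail_pos _)
  refine ⟨1 + a / b, by positivity, fun x z hx hxz ↦ ?_⟩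
  have hK1 : 1 ≤ (1 + a / b) ^ 2 := by
    have : 0 ≤ a / b := by positivity
    nlinarith
  have hK2 : a ≤ (1 + a / b) ^ 2 * b := by
    have h3 : a / b ≤ (1 + a / b) ^ 2 := by
      have : 0 ≤ a / b := by positivity
      nlinarith
    calc a = a / b * b := by field_simp
      _ ≤ _ := by gcongr
  have hx0 : 0 ≤ gaussianPDFReal 0 1 x ^ 2 / gaussTail x :=
    div_nonneg (by positivity) (gaussTail_nonneg _)
  rcases le_total 1 x with h1 | h1
  · calc _ ≤ gaussianPDFReal 0 1 x ^ 2 / gaussTail x :=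
          antitoneOn_sq_pdf_div_gaussTail h1 (h1.trans hxz) hxz
      _ ≤ _ := le_mul_of_one_le_left hx0 hK1
  · have hbx : b ≤ gaussianPDFReal 0 1 x ^ 2 / gaussTail x := by
      have := (hp 1).le
      have := gaussTail_pos x
      rw [hb]
      gcongr
      · exact gaussianPDFReal_std_anti hx h1
      · exact strictAnti_gaussTail.antitone hx
    have haz : gaussianPDFReal 0 1 z ^ 2 / gaussTail z ≤ a := by
      rcases le_total z 1 with hz | hz
      · have := (hp z).le
        have := gaussTail_pos 1
        rw [ha]
        gcongr
        · exact gaussianPDFReal_std_anti le_rfl (hx.trans hxz)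
        · exact strictAnti_gaussTail.antitone hz
      · refine (antitoneOn_sq_pdf_div_gaussTail (Set.mem_Ici.2 le_rfl) hz hz).trans ?_
        have := (hp 1).le
        have := gaussTail_pos 1
        simp only [ha]
        gcongr
        exact gaussianPDFReal_std_anti le_rfl zero_le_one
    calc _ ≤ a := haz
      _ ≤ _ := hK2
      _ ≤ _ := by gcongr

/-- Inverse of the Gaussian tail. -/
def gaussQuantile : ℝ → ℝ := Function.invFun gaussTail

lemma gaussQuantile_gaussTail (x : ℝ) : gaussQuantile (gaussTail x) = x :=
  Function.leftInverse_invFun strictAnti_gaussTail.injective x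

lemma hasDerivAt_gaussQuantile (x : ℝ) :
    HasDerivAt gaussQuantile (-gaussianPDFReal 0 1 x)⁻¹ (gaussTail x) :=
  ((hasStrictDerivAt_gaussTail x).to_local_left_inverse
    (by have := gaussianPDFReal_pos 0 1 x one_ne_zero; exact neg_ne_zero.2 this.ne')
    (Filter.Eventually.of_forall gaussQuantile_gaussTail)).hasDerivAt

/-- The one-sided monotone map carrying the Gaussian tail beyond `gaussQuantile (θ / 2)` to `θ`
times the tail. -/
def bgQuantile (θ z : ℝ) : ℝ := gaussQuantile (gaussTail z / θ)

variable {θ : ℝ}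

lemma bgQuantile_spec (h0 : 0 < θ) {z z₀ : ℝ} (hz₀ : gaussTail z₀ = θ / 2)
    (hz : z₀ ≤ z) : 0 ≤ bgQuantile θ z ∧ gaussTail (bgQuantile θ z) = gaussTail z / θ := by
  have h1 : gaussTail z / θ ≤ 1 / 2 := by
    rw [div_le_iff₀ h0]
    have := strictAnti_gaussTail.antitone hz
    linarith
  obtain ⟨x, hx, hxz⟩ := exists_gaussTail_eq (div_pos (gaussTail_pos z) h0) h1
  rw [bgQuantile, ← hxz, gaussQuantile_gaussTail]
  exact ⟨hx, rfl⟩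

lemma exists_lipschitz_bgQuantile : ∃ K : ℝ, 0 < K ∧ ∀ θ z₀ : ℝ, 0 < θ → θ ≤ 1 →
    gaussTail z₀ = θ / 2 → ∀ z w, z₀ ≤ z → z₀ ≤ w →
      |bgQuantile θ z - bgQuantile θ w| ≤ K / √θ * |z - w| := by
  obtain ⟨K, hK, h⟩ := exists_sq_pdf_div_gaussTail_le
  refine ⟨K, hK, fun θ z₀ h0 h1 hz₀ z w hz hw ↦ ?_⟩
  have hp (x : ℝ) : 0 < gaussianPDFReal 0 1 x := gaussianPDFReal_pos 0 1 x one_ne_zero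
  refine Convex.norm_image_sub_le_of_norm_hasDerivWithin_le (s := Set.Ici z₀)
    (f' := fun z ↦ (-gaussianPDFReal 0 1 (bgQuantile θ z))⁻¹ * (-gaussianPDFReal 0 1 z / θ))
    (fun y hy ↦ ?_) (fun y hy ↦ ?_) (convex_Ici _) hw hz
  · have hs := (bgQuantile_spec h0 hz₀ hy).2
    have hq := hasDerivAt_gaussQuantile (bgQuantile θ y)
    rw [hs] at hq
    have ht := (hasStrictDerivAt_gaussTail y).hasDerivAt.div_const θ
    exact (hq.comp y ht).hasDerivWithinAt
  · obtain ⟨hs0, hs⟩ := bgQuantile_spec h0 hz₀ hy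
    set x := bgQuantile θ y with hx
    have hxy : x ≤ y := by
      refine strictAnti_gaussTail.le_iff_ge.1 ?_
      rw [hs, le_div_iff₀ h0]
      have := gaussTail_nonneg y
      nlinarith
    have hh := h x y hs0 hxy
    rw [hs] at hh
    have hty := gaussTail_pos y
    have h2 : gaussianPDFReal 0 1 y ^ 2 ≤ K ^ 2 * θ * gaussianPDFReal 0 1 x ^ 2 := by
      have := mul_le_mul_of_nonneg_right hh hty.le
      calc _ = gaussianPDFReal 0 1 y ^ 2 / gaussTail y * gaussTail y := by field_simp
        _ ≤ _ := this
        _ = _ := by field_simp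
    have h3 : gaussianPDFReal 0 1 y ≤ K * √θ * gaussianPDFReal 0 1 x := by
      refine le_of_sq_le_sq ?_ (by have := hp x; positivity) |> fun h ↦ h
      rw [mul_pow, mul_pow, Real.sq_sqrt h0.le]
      exact h2
    have h4 : (-gaussianPDFReal 0 1 x)⁻¹ * (-gaussianPDFReal 0 1 y / θ) =
        gaussianPDFReal 0 1 y / (θ * gaussianPDFReal 0 1 x) := by
      have := (hp x).ne'
      field_simp
    rw [h4, Real.norm_eq_abs, abs_of_nonneg (div_nonneg (hp _).le (mul_pos h0 (hp _)).le),
      div_le_div_iff₀ (mul_pos h0 (hp _)) (by positivity)]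
    calc _ ≤ K * √θ * gaussianPDFReal 0 1 x * √θ := by gcongr
      _ = K * (√θ * √θ) * gaussianPDFReal 0 1 x := by ring
      _ = _ := by rw [Real.mul_self_sqrt h0.le]; ring

lemma bgLaw_Iic (x : ℝ) :
    bgLaw θ 1 (Set.Iic x) = ENNReal.ofReal θ * gaussianReal 0 1 (Set.Iic x) +
      ENNReal.ofReal (1 - θ) * (if 0 ≤ x then 1 else 0) := by
  rw [bgLaw, Measure.map_apply (by fun_prop) measurableSet_Iic, Real.toNNReal_one]
  have hm : MeasurableSet ((fun p : ℝ × ℝ ↦ p.1 * p.2) ⁻¹' Set.Iic x) :=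
    (by fun_prop : Measurable fun p : ℝ × ℝ ↦ p.1 * p.2) measurableSet_Iic
  rw [Measure.prod_apply hm, bernoulliReal, lintegral_add_measure, lintegral_smul_measure,
    lintegral_smul_measure, lintegral_dirac, lintegral_dirac, smul_eq_mul, smul_eq_mul]
  congr 2
  · congr 1; ext z; simp
  · split_ifs with hx <;> simp [hx, Set.preimage]

/-- The Bernoulli–Gaussian law is a Lipschitz image of the standard Gaussian. -/
theorem exists_lipschitz_map_eq_bgLaw : ∃ K : ℝ, 0 < K ∧ ∀ θ : ℝ, 0 < θ → θ ≤ 1 →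
    ∃ φ : ℝ → ℝ, (∀ z w, |φ z - φ w| ≤ K / √θ * |z - w|) ∧ (∀ z, φ (-z) = -φ z) ∧
      (gaussianReal 0 1).map φ = bgLaw θ 1 := by
  obtain ⟨K, hK, h⟩ := exists_lipschitz_bgQuantile
  refine ⟨2 * K, by positivity, fun θ h0 h1 ↦ ?_⟩
  obtain ⟨z₀, hz0, hz₀⟩ := exists_gaussTail_eq (by positivity : 0 < θ / 2) (by linarith)
  have hq0 : bgQuantile θ z₀ = 0 := by
    rw [bgQuantile, hz₀, show θ / 2 / θ = gaussTail 0 by rw [gaussTail_zero]; field_simp]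
    exact gaussQuantile_gaussTail 0
  set φ : ℝ → ℝ := fun z ↦ bgQuantile θ (max z z₀) - bgQuantile θ (max (-z) z₀) with hφ
  have hlip (z w : ℝ) : |φ z - φ w| ≤ 2 * K / √θ * |z - w| := by
    have e1 := h θ z₀ h0 h1 hz₀ (max z z₀) (max w z₀) (le_max_right _ _) (le_max_right _ _)
    have e2 := h θ z₀ h0 h1 hz₀ (max (-z) z₀) (max (-w) z₀) (le_max_right _ _) (le_max_right _ _)
    have e3 : |max z z₀ - max w z₀| ≤ |z - w| := abs_max_sub_max_le_abs _ _ _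
    have e4 : |max (-z) z₀ - max (-w) z₀| ≤ |z - w| := by
      refine (abs_max_sub_max_le_abs _ _ _).trans (le_of_eq ?_)
      rw [← abs_neg]; congr 1; ring
    have hKθ : 0 ≤ K / √θ := by positivity
    calc |φ z - φ w| = |(bgQuantile θ (max z z₀) - bgQuantile θ (max w z₀)) -
          (bgQuantile θ (max (-z) z₀) - bgQuantile θ (max (-w) z₀))| := by
          simp only [hφ]; congr 1; ring
      _ ≤ K / √θ * |z - w| + K / √θ * |z - w| :=
          (abs_sub _ _).trans (add_le_add (e1.trans (by gcongr)) (e2.trans (by gcongr)))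
      _ = _ := by ring
  have hodd (z : ℝ) : φ (-z) = -φ z := by simp [hφ]
  have hcont : Continuous φ := by
    have : LipschitzWith (Real.toNNReal (2 * K / √θ)) φ := by
      refine LipschitzWith.of_dist_le_mul fun z w ↦ ?_
      rw [Real.dist_eq, Real.dist_eq, Real.coe_toNNReal _ (by positivity)]
      exact hlip z w
    exact this.continuous
  have hpos (z : ℝ) (hz : z₀ ≤ z) : φ z = bgQuantile θ z := by
    simp only [hφ]
    rw [max_eq_left hz, max_eq_right (by linarith), hq0, sub_zero]
  have hneg (z : ℝ) (hz : z ≤ z₀) : φ z ≤ 0 := by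
    simp only [hφ]
    rw [max_eq_right hz, hq0, zero_sub, neg_nonpos]
    exact (bgQuantile_spec h0 hz₀ (le_max_right _ _)).1
  have hχ (x : ℝ) (hx : 0 ≤ x) : ∃ c, gaussTail c = θ * gaussTail x ∧ z₀ ≤ c ∧
      (∀ z, z₀ ≤ z → (φ z ≤ x ↔ z ≤ c)) ∧ (∀ z, z₀ ≤ z → (x ≤ φ z ↔ c ≤ z)) := by
    have hx2 : gaussTail x ≤ 1 / 2 := by
      rw [← gaussTail_zero]; exact strictAnti_gaussTail.antitone hx
    have := gaussTail_pos x
    obtain ⟨c, hc0, hc⟩ := exists_gaussTail_eq (by positivity : 0 < θ * gaussTail x)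
      (by nlinarith)
    refine ⟨c, hc, strictAnti_gaussTail.le_iff_ge.1 (by rw [hc, hz₀]; nlinarith), ?_, ?_⟩
    · intro z hz
      rw [hpos z hz, ← strictAnti_gaussTail.le_iff_ge, (bgQuantile_spec h0 hz₀ hz).2,
        le_div_iff₀ h0, mul_comm, ← hc, strictAnti_gaussTail.le_iff_ge]
    · intro z hz
      rw [hpos z hz, ← strictAnti_gaussTail.le_iff_ge, (bgQuantile_spec h0 hz₀ hz).2,
        div_le_iff₀ h0, mul_comm, ← hc, strictAnti_gaussTail.le_iff_ge]
  refine ⟨φ, hlip, hodd, ?_⟩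
  have : NullSingletonClass (gaussianReal 0 1) := nullSingletonClass_gaussianReal one_ne_zero
  have hIic (x : ℝ) : gaussianReal 0 1 (Set.Iic x) = ENNReal.ofReal (gaussTail (-x)) := by
    rw [← measure_congr Iio_ae_eq_Iic, gaussianReal_Iio_eq_Ioi_neg, gaussTail_eq_measure]
  have hsymm (x : ℝ) : gaussTail (-x) = 1 - gaussTail x := by
    have h2 := measure_add_measure_compl (μ := gaussianReal 0 1) (measurableSet_Ioi (a := x))
    rw [Set.compl_Ioi, hIic, gaussTail_eq_measure, measure_univ,
      ← ENNReal.ofReal_add (gaussTail_nonneg _) (gaussTail_nonneg _), ENNReal.ofReal_eq_one] at h2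
    linarith
  refine Measure.ext_of_Iic _ _ fun x ↦ ?_
  rw [bgLaw_Iic, Measure.map_apply hcont.measurable measurableSet_Iic, hIic]
  rcases le_or_gt 0 x with hx | hx
  · obtain ⟨c, hc, hzc, h3, -⟩ := hχ x hx
    have : φ ⁻¹' Set.Iic x = Set.Iic c := by
      ext z
      simp only [Set.mem_preimage, Set.mem_Iic]
      rcases le_total z₀ z with hz | hz
      · exact h3 z hz
      · exact ⟨fun _ ↦ hz.trans hzc, fun _ ↦ (hneg z hz).trans hx⟩
    rw [this, hIic, if_pos hx, mul_one, ← ENNReal.ofReal_mul h0.le,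
      ← ENNReal.ofReal_add (mul_nonneg h0.le (gaussTail_nonneg _)) (by linarith), hsymm, hsymm, hc]
    congr 1; ring
  · obtain ⟨c, hc, hzc, -, h3⟩ := hχ (-x) (by linarith)
    have : φ ⁻¹' Set.Iic x = Set.Iic (-c) := by
      ext z
      simp only [Set.mem_preimage, Set.mem_Iic]
      have e1 : φ z ≤ x ↔ -x ≤ φ (-z) := by rw [hodd, neg_le_neg_iff]
      rw [e1, le_neg]
      rcases le_total z₀ (-z) with hz | hz
      · exact h3 _ hz
      · constructor
        · intro h4
          have := hneg _ hz
          linarith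
        · intro h4
          have : -z = c := le_antisymm (hz.trans hzc) h4
          exact (h3 _ (hzc.trans h4)).2 h4
    rw [this, hIic, if_neg (not_le.2 hx), mul_zero, add_zero, ← ENNReal.ofReal_mul h0.le,
      neg_neg, hc]

lemma isProbabilityMeasure_bernoulliReal (h0 : 0 < θ) (h1 : θ ≤ 1) :
    IsProbabilityMeasure (bernoulliReal θ) := by
  refine ⟨?_⟩
  simp only [bernoulliReal, Measure.coe_add, Measure.coe_smul, Pi.add_apply, Pi.smul_apply,
    measure_univ, smul_eq_mul, mul_one]
  rw [← ENNReal.ofReal_add h0.le (by linarith)]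
  simp

lemma bgLaw_sq (h0 : 0 < θ) (h1 : θ ≤ 1) {σ : ℝ} :
    bgLaw θ (σ ^ 2) = (bgLaw θ 1).map (fun x ↦ σ * x) := by
  have := isProbabilityMeasure_bernoulliReal h0 h1
  have hg : gaussianReal 0 (σ ^ 2).toNNReal =
      (gaussianReal 0 (1 : ℝ).toNNReal).map (fun x ↦ σ * x) := by
    rw [gaussianReal_map_const_mul, mul_zero, Real.toNNReal_one, mul_one]
    congr 1
    ext
    rw [Real.coe_toNNReal _ (sq_nonneg _)]
    rfl
  have hm : Measurable fun x : ℝ ↦ σ * x := by fun_prop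
  rw [bgLaw, hg, bgLaw, Measure.map_map (by fun_prop) (by fun_prop)]
  have h3 := Measure.map_prod_map (bernoulliReal θ) (gaussianReal 0 (1 : ℝ).toNNReal)
    measurable_id hm
  rw [Measure.map_id] at h3
  rw [h3, Measure.map_map (by fun_prop) (by fun_prop)]
  congr 1
  ext p
  simp only [Function.comp_apply, Prod.map_fst, Prod.map_snd, id]
  ring

lemma integral_pow_bgLaw (h0 : 0 < θ) (h1 : θ ≤ 1) {k : ℕ} (hk : k ≠ 0) :
    ∫ x, x ^ k ∂(bgLaw θ 1) = θ * ∫ z, z ^ k ∂(gaussianReal 0 1) := by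
  have := isProbabilityMeasure_bernoulliReal h0 h1
  rw [bgLaw, integral_map (by fun_prop) (by fun_prop), Real.toNNReal_one]
  simp_rw [mul_pow]
  rw [integral_prod_mul (fun b : ℝ ↦ b ^ k) (fun z : ℝ ↦ z ^ k)]
  congr 1
  have hi (a : ℝ) : Integrable (fun b : ℝ ↦ b ^ k) (Measure.dirac a) := integrable_dirac (by simp)
  rw [bernoulliReal, integral_add_measure ((hi _).smul_measure (by simp))
    ((hi _).smul_measure (by simp)), integral_smul_measure, integral_smul_measure,
    integral_dirac, integral_dirac, ENNReal.toReal_ofReal h0.le]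
  simp [hk]

/-- Representation of the Bernoulli–Gaussian law, normalised to unit variance, as an odd Lipschitz
image of the standard Gaussian. -/
theorem exists_lipschitz_normalised_bgLaw : ∃ K m : ℝ, 0 < K ∧ 0 ≤ m ∧ ∀ θ : ℝ, 0 < θ → θ ≤ 1 →
    ∃ ψ : ℝ → ℝ, (∀ z w, |ψ z - ψ w| ≤ K / θ * |z - w|) ∧ (∀ z, ψ (-z) = -ψ z) ∧
      ∫ z, ψ z ^ 2 ∂(gaussianReal 0 1) = 1 ∧ ∫ z, ψ z ^ 4 ∂(gaussianReal 0 1) = m / θ ∧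
      ∀ σ : ℝ, bgLaw θ (σ ^ 2) = (gaussianReal 0 1).map (fun z ↦ σ * √θ * ψ z) := by
  obtain ⟨K, hK, h⟩ := exists_lipschitz_map_eq_bgLaw
  refine ⟨K, ∫ z, z ^ 4 ∂(gaussianReal 0 1), hK,
    integral_nonneg fun z ↦ by positivity, fun θ h0 h1 ↦ ?_⟩
  obtain ⟨φ, hlip, hodd, hmap⟩ := h θ h0 h1
  have hs : 0 < √θ := by positivity
  have hcont : Continuous φ := by
    have : LipschitzWith (Real.toNNReal (K / √θ)) φ := by
      refine LipschitzWith.of_dist_le_mul fun z w ↦ ?_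
      rw [Real.dist_eq, Real.dist_eq, Real.coe_toNNReal _ (by positivity)]
      exact hlip z w
    exact this.continuous
  have hpow (k : ℕ) (hk : k ≠ 0) : ∫ z, φ z ^ k ∂(gaussianReal 0 1) =
      θ * ∫ z, z ^ k ∂(gaussianReal 0 1) := by
    rw [← integral_pow_bgLaw h0 h1 hk, ← hmap, integral_map hcont.aemeasurable (by fun_prop)]
  refine ⟨fun z ↦ φ z / √θ, fun z w ↦ ?_, fun z ↦ by simp only [hodd, neg_div], ?_, ?_, fun σ ↦ ?_⟩
  · rw [← sub_div, abs_div, abs_of_pos hs, div_le_iff₀ hs]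
    refine (hlip z w).trans (le_of_eq ?_)
    rw [show K / θ = K / (√θ * √θ) by rw [Real.mul_self_sqrt h0.le]]
    field_simp
  · simp_rw [div_pow]
    rw [integral_div, hpow 2 two_ne_zero, Real.sq_sqrt h0.le]
    have h2 : ∫ z, z ^ 2 ∂(gaussianReal 0 1) = 1 := by
      have := variance_fun_id_gaussianReal (μ := 0) (v := 1)
      rw [variance_eq_integral (by fun_prop)] at this
      simpa using this
    rw [h2]; field_simp
  · simp_rw [div_pow]
    rw [integral_div, hpow 4 four_ne_zero,
      show √θ ^ 4 = (√θ ^ 2) ^ 2 by ring, Real.sq_sqrt h0.le]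
    field_simp
  · rw [bgLaw_sq h0 h1, ← hmap, Measure.map_map (by fun_prop) hcont.measurable]
    congr 1
    ext z
    simp only [Function.comp_apply]
    field_simp

end GaussianQuantile

section ProductConcentration

open scoped NNReal

variable {κ ι : Type*} [Fintype κ] [Fintype ι]

lemma map_entrywise_stdGaussian {ψ : ℝ → ℝ} (hψ : Measurable ψ) :
    (stdGaussian (EuclideanSpace ℝ (κ × ι))).map (fun w k i ↦ ψ (w (k, i))) =
      Measure.pi fun _ : κ ↦ Measure.pi fun _ : ι ↦ (gaussianReal 0 1).map ψ := by
  have hprob : IsProbabilityMeasure ((gaussianReal 0 1).map ψ) :=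
    Measure.isProbabilityMeasure_map hψ.aemeasurable
  rw [← map_pi_eq_stdGaussian, Measure.map_map (by fun_prop) (by fun_prop)]
  have h1 := Measure.pi_map_pi (μ := fun _ : κ × ι ↦ gaussianReal 0 1) (f := fun _ ↦ ψ)
    (fun _ ↦ hψ.aemeasurable)
  have h2 := Measure.infinitePi_map_curry (fun (_ : κ) (_ : ι) ↦ (gaussianReal 0 1).map ψ)
  simp_rw [Measure.infinitePi_eq_pi] at h2
  rw [← h2, ← h1, Measure.map_map (MeasurableEquiv.measurable _) (by fun_prop)]
  rfl

/-- Sub-Gaussian concentration, with scale `M`, of functions that are Lipschitz for the Frobenius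
distance. -/
def FrobeniusConcentration (μ : Measure (κ → ι → ℝ)) (M : ℝ) : Prop :=
  ∀ (f : (κ → ι → ℝ) → ℝ) (L : ℝ), 0 ≤ L →
    (∀ x y, |f x - f y| ≤ L * √(∑ k, ∑ i, (x k i - y k i) ^ 2)) →
    Integrable f μ ∧
    (∀ t, 0 ≤ t → μ {x | t ≤ |f x - ∫ y, f y ∂μ|} ≤
      ENNReal.ofReal (2 * Real.exp (-(t ^ 2 / (8 * (M * L) ^ 2))))) ∧
    Integrable (fun x ↦ (f x - ∫ y, f y ∂μ) ^ 2) μ ∧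
    ∫ x, (f x - ∫ y, f y ∂μ) ^ 2 ∂μ ≤ 8 * (M * L) ^ 2

lemma measure_ge_le_of_mgf_le {Ω : Type*} [MeasurableSpace Ω] {μ : Measure Ω}
    [IsProbabilityMeasure μ] {g : Ω → ℝ} {B : ℝ}
    (hi : ∀ s : ℝ, Integrable (fun x ↦ Real.exp (s * g x)) μ)
    (hg : ∀ s : ℝ, ∫ x, Real.exp (s * g x) ∂μ ≤ Real.exp (2 * s ^ 2 * B ^ 2)) {t : ℝ} (ht : 0 ≤ t) :
    μ {x | t ≤ g x} ≤ ENNReal.ofReal (Real.exp (-(t ^ 2 / (8 * B ^ 2)))) := by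
  have h := measure_ge_le_exp_mul_mgf (μ := μ) (X := g) (t := t / (4 * B ^ 2)) t (by positivity)
    (hi _)
  rw [Measure.real] at h
  rw [← ENNReal.ofReal_toReal (measure_ne_top μ _)]
  refine ENNReal.ofReal_le_ofReal (h.trans ?_)
  calc _ ≤ Real.exp (-(t / (4 * B ^ 2)) * t) * Real.exp (2 * (t / (4 * B ^ 2)) ^ 2 * B ^ 2) := by
        gcongr; exact hg _
    _ = _ := by
        rw [← Real.exp_add]
        congr 1
        rcases eq_or_ne B 0 with rfl | hB
        · simp
        · field_simp; ring

lemma integral_sq_le_of_mgf_le {Ω : Type*} [MeasurableSpace Ω] {μ : Measure Ω}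
    [IsProbabilityMeasure μ] {g : Ω → ℝ} {B : ℝ} (hm : AEStronglyMeasurable g μ)
    (hi : ∀ s : ℝ, Integrable (fun x ↦ Real.exp (s * g x)) μ)
    (hg : ∀ s : ℝ, ∫ x, Real.exp (s * g x) ∂μ ≤ Real.exp (2 * s ^ 2 * B ^ 2)) :
    Integrable (fun x ↦ g x ^ 2) μ ∧ ∫ x, g x ^ 2 ∂μ ≤ 8 * B ^ 2 := by
  have hpt (s x : ℝ) : s ^ 2 * x ^ 2 ≤ Real.exp (s * x) + Real.exp (-s * x) - 2 := by
    have h1 : (s * x / 2) ^ 2 ≤ Real.sinh (s * x / 2) ^ 2 := by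
      rw [sq_le_sq, Real.abs_sinh]
      exact Real.self_le_sinh_iff.2 (abs_nonneg _)
    have h2 := Real.cosh_two_mul (s * x / 2)
    have h3 := Real.cosh_sq (s * x / 2)
    rw [mul_div_cancel₀ _ two_ne_zero, Real.cosh_eq] at h2
    rw [neg_mul]
    nlinarith
  have hInt : Integrable (fun x ↦ g x ^ 2) μ := by
    refine ((hi 1).add (hi (-1))).mono' (hm.pow 2) (Filter.Eventually.of_forall fun x ↦ ?_)
    have := hpt 1 (g x)
    rw [Real.norm_eq_abs, abs_of_nonneg (sq_nonneg _)]
    simp only [Pi.add_apply]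
    linarith
  refine ⟨hInt, ?_⟩
  have hs (s : ℝ) : s ^ 2 * ∫ x, g x ^ 2 ∂μ ≤ 2 * Real.exp (2 * s ^ 2 * B ^ 2) - 2 := by
    rw [← integral_const_mul]
    calc _ ≤ ∫ x, (Real.exp (s * g x) + Real.exp (-s * g x) - 2) ∂μ :=
          integral_mono (hInt.const_mul _) (((hi s).add (hi (-s))).sub (integrable_const _))
            fun x ↦ hpt s (g x)
      _ = (∫ x, Real.exp (s * g x) ∂μ) + (∫ x, Real.exp (-s * g x) ∂μ) - 2 := by
          have hadd : Integrable (fun x ↦ Real.exp (s * g x) + Real.exp (-s * g x)) μ :=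
            (hi s).add (hi (-s))
          rw [integral_sub hadd (integrable_const _), integral_add (hi s) (hi (-s))]
          simp
      _ ≤ _ := by
          have h1 := hg s
          have h2 := hg (-s)
          rw [neg_sq] at h2
          linarith
  rcases eq_or_ne B 0 with rfl | hB
  · have := hs 1; simp at this; simpa using this
  · have h1 := hs (1 / (2 * |B|))
    have e1 : (1 / (2 * |B|)) ^ 2 = 1 / (4 * B ^ 2) := by rw [div_pow, mul_pow, sq_abs]; norm_num
    rw [e1, show 2 * (1 / (4 * B ^ 2)) * B ^ 2 = 1 / 2 by field_simp; norm_num] at h1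
    have e2 : Real.exp (1 / 2) ≤ 2 := by
      have h3 : Real.exp (1 / 2) ^ 2 = Real.exp 1 := by rw [← Real.exp_nat_mul]; norm_num
      have := Real.exp_one_lt_d9
      nlinarith [Real.exp_pos (1 / 2)]
    have hB2 : 0 < B ^ 2 := by positivity
    rw [div_mul_eq_mul_div, one_mul, div_le_iff₀ (by positivity)] at h1
    nlinarith

theorem frobeniusConcentration_of_lipschitz {ψ : ℝ → ℝ} {M : ℝ} (hM : 0 ≤ M)
    (hψ : ∀ z w, |ψ z - ψ w| ≤ M * |z - w|) :
    FrobeniusConcentration (κ := κ) (ι := ι)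
      (Measure.pi fun _ ↦ Measure.pi fun _ ↦ (gaussianReal 0 1).map ψ) M := by
  intro f L hL hf
  have hψc : Continuous ψ := by
    have : LipschitzWith (Real.toNNReal M) ψ := by
      refine LipschitzWith.of_dist_le_mul fun z w ↦ ?_
      rw [Real.dist_eq, Real.dist_eq, Real.coe_toNNReal _ hM]
      exact hψ z w
    exact this.continuous
  set h : EuclideanSpace ℝ (κ × ι) → κ → ι → ℝ := fun w k i ↦ ψ (w (k, i)) with hh
  have hhm : Measurable h := by fun_prop
  have hfc : Continuous f := by
    refine continuous_iff_continuousAt.2 fun x ↦ ?_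
    rw [ContinuousAt, tendsto_iff_dist_tendsto_zero]
    have hc : Continuous fun y : κ → ι → ℝ ↦ L * √(∑ k, ∑ i, (y k i - x k i) ^ 2) := by fun_prop
    have h0 := hc.tendsto x
    simp only [sub_self, ne_eq, OfNat.ofNat_ne_zero, not_false_eq_true, zero_pow,
      Finset.sum_const_zero, Real.sqrt_zero, mul_zero] at h0
    exact squeeze_zero (fun _ ↦ dist_nonneg) (fun y ↦ by rw [Real.dist_eq]; exact hf y x) h0
  have hlip : LipschitzWith (Real.toNNReal (M * L)) (f ∘ h) := by
    refine LipschitzWith.of_dist_le_mul fun z w ↦ ?_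
    rw [Real.dist_eq, EuclideanSpace.dist_eq, Real.coe_toNNReal _ (by positivity)]
    refine (hf _ _).trans ?_
    rw [mul_comm M L, mul_assoc]
    refine mul_le_mul_of_nonneg_left ?_ hL
    refine Real.sqrt_le_iff.2 ⟨by positivity, ?_⟩
    rw [mul_pow, Real.sq_sqrt (by positivity), Fintype.sum_prod_type, Finset.mul_sum]
    refine Finset.sum_le_sum fun k _ ↦ ?_
    rw [Finset.mul_sum]
    refine Finset.sum_le_sum fun i _ ↦ ?_
    rw [Real.dist_eq, ← mul_pow, ← sq_abs]
    exact pow_le_pow_left₀ (abs_nonneg _) (hψ _ _) 2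
  set μ := Measure.pi fun _ : κ ↦ Measure.pi fun _ : ι ↦ (gaussianReal 0 1).map ψ with hμ
  have hmap : (stdGaussian (EuclideanSpace ℝ (κ × ι))).map h = μ :=
    map_entrywise_stdGaussian hψc.measurable
  have : IsProbabilityMeasure μ := by
    rw [← hmap]; exact Measure.isProbabilityMeasure_map hhm.aemeasurable
  have hInt {g : (κ → ι → ℝ) → ℝ} (hg : Continuous g)
      (hgi : Integrable (g ∘ h) (stdGaussian (EuclideanSpace ℝ (κ × ι)))) : Integrable g μ := by
    rw [← hmap]
    exact (integrable_map_measure hg.aestronglyMeasurable hhm.aemeasurable).2 hgi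
  have hval {g : (κ → ι → ℝ) → ℝ} (hg : Continuous g) :
      ∫ x, g x ∂μ = ∫ w, g (h w) ∂(stdGaussian (EuclideanSpace ℝ (κ × ι))) := by
    rw [← hmap, integral_map hhm.aemeasurable hg.aestronglyMeasurable]
  have hfi : Integrable f μ := hInt hfc (integrable_lipschitz_stdGaussian hlip)
  set m := ∫ y, f y ∂μ with hm
  have hexp (s : ℝ) : Integrable (fun x ↦ Real.exp (s * (f x - m))) μ := by
    refine hInt (by fun_prop) ?_
    have := (integrable_exp_mul_lipschitz_stdGaussian hlip s).mul_const (Real.exp (-(s * m)))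
    refine this.congr (Filter.Eventually.of_forall fun x ↦ ?_)
    simp only [Function.comp_apply, ← Real.exp_add]
    congr 1; ring
  have hmgf (s : ℝ) : ∫ x, Real.exp (s * (f x - m)) ∂μ ≤ Real.exp (2 * s ^ 2 * (M * L) ^ 2) := by
    rw [hval (by fun_prop), hm, hval hfc]
    refine (integral_exp_lipschitz_stdGaussian_le hlip s).trans (Real.exp_le_exp.2 ?_)
    rw [Real.coe_toNNReal _ (by positivity)]
    have h4 : Real.pi ^ 2 ≤ 16 := by
      have := Real.pi_le_four; have := Real.pi_pos; nlinarith
    have : s ^ 2 * Real.pi ^ 2 * (M * L) ^ 2 ≤ s ^ 2 * 16 * (M * L) ^ 2 := by gcongr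
    linarith
  refine ⟨hfi, fun t ht ↦ ?_, integral_sq_le_of_mgf_le
    (hfc.sub continuous_const).aestronglyMeasurable hexp hmgf⟩
  have h1 := measure_ge_le_of_mgf_le hexp hmgf ht
  have h2 := measure_ge_le_of_mgf_le (μ := μ) (g := fun x ↦ -(f x - m)) (B := M * L)
    (fun s ↦ by convert hexp (-s) using 3; ring)
    (fun s ↦ by
      have := hmgf (-s)
      rw [neg_sq] at this
      convert this using 4
      ring) ht
  calc μ {x | t ≤ |f x - m|} ≤ μ ({x | t ≤ f x - m} ∪ {x | t ≤ -(f x - m)}) :=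
        measure_mono fun x (hx : t ≤ |f x - m|) ↦ le_abs.1 hx
    _ ≤ _ := (measure_union_le _ _).trans (add_le_add h1 h2)
    _ = _ := by rw [← ENNReal.ofReal_add (Real.exp_pos _).le (Real.exp_pos _).le, two_mul]

end ProductConcentration

section SpectralNorm

open scoped Matrix.Norms.L2Operator

section MatrixNorms

variable {ι κ τ : Type*} [Fintype ι] [Fintype κ] [Fintype τ]
  [DecidableEq ι] [DecidableEq κ] [DecidableEq τ]

/-- Euclidean norm of a plain function. -/
def vecNorm (w : ι → ℝ) : ℝ := √(w ⬝ᵥ w)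

lemma dotProduct_self_nonneg' (w : ι → ℝ) : 0 ≤ w ⬝ᵥ w :=
  Finset.sum_nonneg fun i _ ↦ mul_self_nonneg (w i)

lemma vecNorm_nonneg (w : ι → ℝ) : 0 ≤ vecNorm w := Real.sqrt_nonneg _

lemma vecNorm_sq (w : ι → ℝ) : vecNorm w ^ 2 = w ⬝ᵥ w := Real.sq_sqrt (dotProduct_self_nonneg' w)

lemma vecNorm_eq_norm (w : ι → ℝ) : vecNorm w = ‖(WithLp.toLp 2 w : EuclideanSpace ℝ ι)‖ := by
  rw [EuclideanSpace.norm_eq, vecNorm]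
  congr 1
  exact Finset.sum_congr rfl fun i _ ↦ by simp [sq]

lemma abs_dotProduct_le (u v : ι → ℝ) : |u ⬝ᵥ v| ≤ vecNorm u * vecNorm v := by
  have h := abs_real_inner_le_norm (WithLp.toLp 2 u : EuclideanSpace ℝ ι) (WithLp.toLp 2 v)
  rwa [EuclideanSpace.inner_toLp_toLp, star_trivial, ← vecNorm_eq_norm, ← vecNorm_eq_norm,
    dotProduct_comm] at h

lemma vecNorm_mulVec_le (A : Matrix ι κ ℝ) (w : κ → ℝ) : vecNorm (A *ᵥ w) ≤ ‖A‖ * vecNorm w := by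
  rw [vecNorm_eq_norm, vecNorm_eq_norm]
  exact Matrix.l2_opNorm_mulVec A (WithLp.toLp 2 w)

lemma opNorm_le_of_vecNorm_le {A : Matrix ι κ ℝ} {c : ℝ} (hc : 0 ≤ c)
    (h : ∀ w, vecNorm (A *ᵥ w) ≤ c * vecNorm w) : ‖A‖ ≤ c := by
  rw [Matrix.l2_opNorm_def]
  refine ContinuousLinearMap.opNorm_le_bound _ hc fun x ↦ ?_
  have := h x.ofLp
  rw [vecNorm_eq_norm, vecNorm_eq_norm] at this
  exact this

lemma abs_dotProduct_mulVec_le (A : Matrix ι κ ℝ) (u : ι → ℝ) (w : κ → ℝ) :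
    |u ⬝ᵥ A *ᵥ w| ≤ ‖A‖ * vecNorm u * vecNorm w := by
  refine (abs_dotProduct_le _ _).trans ?_
  have := mul_le_mul_of_nonneg_left (vecNorm_mulVec_le A w) (vecNorm_nonneg u)
  linarith

lemma opNorm_transpose (A : Matrix ι κ ℝ) : ‖Aᵀ‖ = ‖A‖ := by
  rw [← conjTranspose_eq_transpose_of_trivial, Matrix.l2_opNorm_conjTranspose]

lemma opNorm_one_le : ‖(1 : Matrix ι ι ℝ)‖ ≤ 1 :=
  opNorm_le_of_vecNorm_le zero_le_one fun w ↦ by simp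

lemma opNorm_le_one_of_transpose_mul_self {O : Matrix ι κ ℝ} (h : Oᵀ * O = 1) : ‖O‖ ≤ 1 := by
  refine opNorm_le_of_vecNorm_le zero_le_one fun w ↦ ?_
  rw [one_mul, vecNorm, dotProduct_mulVec, vecMul_mulVec, h, vecMul_one]
  rfl

/-- Squared Frobenius norm. -/
def frobSq (A : Matrix ι κ ℝ) : ℝ := ∑ i, ∑ j, A i j ^ 2

lemma frobSq_nonneg (A : Matrix ι κ ℝ) : 0 ≤ frobSq A := by unfold frobSq; positivity

lemma frobSq_transpose (A : Matrix ι κ ℝ) : frobSq Aᵀ = frobSq A := Finset.sum_comm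

lemma frobSq_eq_trace (A : Matrix ι κ ℝ) : frobSq A = trace (Aᵀ * A) := by
  rw [← frobSq_transpose]
  simp [frobSq, trace, Matrix.mul_apply, sq]

lemma frobSq_add_le (A B : Matrix ι κ ℝ) : frobSq (A + B) ≤ 2 * frobSq A + 2 * frobSq B := by
  simp only [frobSq, Finset.mul_sum, ← Finset.sum_add_distrib]
  refine Finset.sum_le_sum fun i _ ↦ Finset.sum_le_sum fun j _ ↦ ?_
  rw [Matrix.add_apply]
  nlinarith [sq_nonneg (A i j - B i j)]

lemma frobSq_mul_le (A : Matrix ι κ ℝ) (B : Matrix κ τ ℝ) :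
    frobSq (A * B) ≤ ‖A‖ ^ 2 * frobSq B := by
  rw [← frobSq_transpose, ← frobSq_transpose B, frobSq, frobSq, Finset.mul_sum]
  refine Finset.sum_le_sum fun j _ ↦ ?_
  have h := vecNorm_mulVec_le A (fun k ↦ B k j)
  have h2 := pow_le_pow_left₀ (vecNorm_nonneg _) h 2
  rw [mul_pow, vecNorm_sq, vecNorm_sq] at h2
  convert h2 using 1
  · exact Finset.sum_congr rfl fun i _ ↦ by rw [sq]; rfl
  · congr 1
    exact Finset.sum_congr rfl fun i _ ↦ by rw [sq]; rfl

lemma frobSq_mul_le' (A : Matrix ι κ ℝ) (B : Matrix κ τ ℝ) :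
    frobSq (A * B) ≤ frobSq A * ‖B‖ ^ 2 := by
  rw [← frobSq_transpose, transpose_mul, ← frobSq_transpose A, mul_comm, ← opNorm_transpose B]
  exact frobSq_mul_le _ _

lemma frobSq_le_card_mul (A : Matrix ι ι ℝ) : frobSq A ≤ Fintype.card ι * ‖A‖ ^ 2 := by
  have h := frobSq_mul_le A (1 : Matrix ι ι ℝ)
  rw [mul_one, frobSq_eq_trace 1, transpose_one, mul_one, trace_one] at h
  linarith

lemma opNorm_sq_le_frobSq (A : Matrix ι κ ℝ) : ‖A‖ ^ 2 ≤ frobSq A := by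
  have h : ‖A‖ ≤ √(frobSq A) := by
    refine opNorm_le_of_vecNorm_le (Real.sqrt_nonneg _) fun w ↦ ?_
    rw [vecNorm, vecNorm, ← Real.sqrt_mul (frobSq_nonneg A)]
    refine Real.sqrt_le_sqrt ?_
    rw [frobSq, Finset.sum_mul]
    refine Finset.sum_le_sum fun i _ ↦ ?_
    have h1 := Finset.sum_mul_sq_le_sq_mul_sq Finset.univ (fun j ↦ A i j) w
    simp only [mulVec, dotProduct, ← sq]
    exact h1
  calc ‖A‖ ^ 2 ≤ √(frobSq A) ^ 2 := pow_le_pow_left₀ (norm_nonneg _) h 2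
    _ = _ := Real.sq_sqrt (frobSq_nonneg A)

/-- If `S` dominates `1/16` and `T S Tᵀ = 1`, then `‖T‖ ≤ 4`. -/
lemma opNorm_le_four_of_congr_eq_one {T S : Matrix ι ι ℝ}
    (hS : ∀ w, w ⬝ᵥ w / 16 ≤ w ⬝ᵥ S *ᵥ w) (h : T * S * Tᵀ = 1) : ‖T‖ ≤ 4 := by
  rw [← opNorm_transpose]
  refine opNorm_le_of_vecNorm_le (by norm_num) fun w ↦ ?_
  have h1 := hS (Tᵀ *ᵥ w)
  have h2 : (Tᵀ *ᵥ w) ⬝ᵥ S *ᵥ (Tᵀ *ᵥ w) = w ⬝ᵥ w := by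
    rw [mulVec_transpose, ← dotProduct_mulVec, ← mulVec_transpose, mulVec_mulVec, mulVec_mulVec,
      h, one_mulVec]
  rw [h2, ← vecNorm_sq, ← vecNorm_sq] at h1
  refine abs_le_of_sq_le_sq' ?_ (by have := vecNorm_nonneg w; positivity) |>.2
  nlinarith

lemma opNorm_mul_le_one_of_congr_eq_one {T Q : Matrix ι ι ℝ} {Y : Matrix ι κ ℝ}
    (hQ : ∀ w, 0 ≤ w ⬝ᵥ Q *ᵥ w) (h : T * (Q + Y * Yᵀ) * Tᵀ = 1) : ‖T * Y‖ ≤ 1 := by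
  rw [← opNorm_transpose]
  refine opNorm_le_of_vecNorm_le zero_le_one fun w ↦ ?_
  have h2 : (Tᵀ *ᵥ w) ⬝ᵥ (Q + Y * Yᵀ) *ᵥ (Tᵀ *ᵥ w) = w ⬝ᵥ w := by
    rw [mulVec_transpose, ← dotProduct_mulVec, ← mulVec_transpose, mulVec_mulVec, mulVec_mulVec,
      h, one_mulVec]
  have h3 : (Tᵀ *ᵥ w) ⬝ᵥ (Y * Yᵀ) *ᵥ (Tᵀ *ᵥ w) = ((T * Y)ᵀ *ᵥ w) ⬝ᵥ ((T * Y)ᵀ *ᵥ w) := by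
    rw [transpose_mul, ← mulVec_mulVec, ← mulVec_mulVec, dotProduct_mulVec, ← mulVec_transpose]
  rw [add_mulVec, dotProduct_add, h3] at h2
  have h1 := hQ (Tᵀ *ᵥ w)
  rw [one_mul]
  exact Real.sqrt_le_sqrt (by linarith)

/-- `T` is the orthogonal polar factor attached to the weights `d` and the positive definite
matrix `S`: `T = (D S D)^{-1/2} D`. -/
def IsPolarFactor (d : ι → ℝ) (S T : Matrix ι ι ℝ) : Prop :=
  ∃ P : Matrix ι ι ℝ, P.PosDef ∧ T = P * diagonal d ∧ T * S * Tᵀ = 1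

open scoped MatrixOrder in
lemma trace_mul_mul_mul_nonneg {P P' K : Matrix ι ι ℝ} (hP : P.PosSemidef) (hP' : P'.PosSemidef)
    (hK : Kᵀ = K) : 0 ≤ trace (P * K * P' * K) := by
  classical
  obtain ⟨B, rfl⟩ := CStarAlgebra.nonneg_iff_eq_star_mul_self.1 (Matrix.nonneg_iff_posSemidef.2 hP)
  obtain ⟨C, rfl⟩ := CStarAlgebra.nonneg_iff_eq_star_mul_self.1 (Matrix.nonneg_iff_posSemidef.2 hP')
  simp only [star_eq_conjTranspose, conjTranspose_eq_transpose_of_trivial]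
  have h : trace (Bᵀ * B * K * (Cᵀ * C) * K) = frobSq (C * K * Bᵀ) := by
    rw [frobSq_eq_trace, transpose_mul, transpose_mul, transpose_transpose, hK]
    simp only [mul_assoc]
    rw [trace_mul_comm]
    simp only [mul_assoc]
  rw [h]
  exact frobSq_nonneg _

theorem frobSq_sub_le_of_isPolarFactor {d : ι → ℝ} {Q T T' : Matrix ι ι ℝ} {Y Y' : Matrix ι κ ℝ}
    (hQ : ∀ w, w ⬝ᵥ w / 16 ≤ w ⬝ᵥ Q *ᵥ w)
    (hT : IsPolarFactor d (Q + Y * Yᵀ) T) (hT' : IsPolarFactor d (Q + Y' * Y'ᵀ) T') :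
    frobSq (T - T') ≤ 32 ^ 2 * frobSq (Y - Y') := by
  have hQ0 (w : ι → ℝ) : 0 ≤ w ⬝ᵥ Q *ᵥ w :=
    (div_nonneg (dotProduct_self_nonneg' w) (by norm_num)).trans (hQ w)
  have hS (Z : Matrix ι κ ℝ) (w : ι → ℝ) : w ⬝ᵥ w / 16 ≤ w ⬝ᵥ (Q + Z * Zᵀ) *ᵥ w := by
    rw [add_mulVec, dotProduct_add, ← mulVec_mulVec, dotProduct_mulVec w Z, ← mulVec_transpose]
    have := dotProduct_self_nonneg' (Zᵀ *ᵥ w)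
    linarith [hQ w]
  obtain ⟨P, hP, hTP, h1⟩ := hT
  obtain ⟨P', hP', hTP', h1'⟩ := hT'
  have n1 : ‖T‖ ≤ 4 := opNorm_le_four_of_congr_eq_one (hS Y) h1
  have n1' : ‖T'‖ ≤ 4 := opNorm_le_four_of_congr_eq_one (hS Y') h1'
  have n2 : ‖T * Y‖ ≤ 1 := opNorm_mul_le_one_of_congr_eq_one hQ0 h1
  have n2' : ‖T' * Y'‖ ≤ 1 := opNorm_mul_le_one_of_congr_eq_one hQ0 h1'
  have sP : Pᵀ = P := by
    rw [← conjTranspose_eq_transpose_of_trivial]; exact hP.isHermitian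
  have sP' : P'ᵀ = P' := by
    rw [← conjTranspose_eq_transpose_of_trivial]; exact hP'.isHermitian
  have iP : P * P⁻¹ = 1 := Matrix.mul_nonsing_inv _ ((Matrix.isUnit_iff_isUnit_det _).1 hP.isUnit)
  have iP' : P' * P'⁻¹ = 1 :=
    Matrix.mul_nonsing_inv _ ((Matrix.isUnit_iff_isUnit_det _).1 hP'.isUnit)
  have jP : P⁻¹ * P = 1 := mul_eq_one_comm.1 iP
  have jP' : P'⁻¹ * P' = 1 := mul_eq_one_comm.1 iP'
  set K := P'⁻¹ - P⁻¹ with hK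
  have sK : Kᵀ = K := by
    rw [hK, transpose_sub, transpose_nonsing_inv, transpose_nonsing_inv, sP, sP']
  have e1 : T - T' = P * K * T' := by
    rw [hK, mul_sub, sub_mul, iP, one_mul, hTP', ← mul_assoc, mul_assoc P, jP', mul_one, ← hTP]
  have tT : Tᵀ = diagonal d * P := by rw [hTP, transpose_mul, diagonal_transpose, sP]
  have e2 : K * P + P' * K = (T' * Y') * (Y' - Y)ᵀ * Tᵀ + T' * (Y' - Y) * (T * Y)ᵀ := by
    have hl : K * P + P' * K = P'⁻¹ * P - P' * P⁻¹ := by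
      rw [hK, sub_mul, mul_sub, jP, iP']; abel
    have g1 : T' * (Q + Y * Yᵀ) * Tᵀ = P' * P⁻¹ := by
      have : T' = P' * P⁻¹ * T := by
        rw [hTP, hTP', mul_assoc, ← mul_assoc P⁻¹, jP, one_mul]
      rw [this, mul_assoc, mul_assoc, ← mul_assoc T, h1, mul_one]
    have g2 : T' * (Q + Y' * Y'ᵀ) * Tᵀ = P'⁻¹ * P := by
      have : Tᵀ = T'ᵀ * (P'⁻¹ * P) := by
        rw [tT, hTP', transpose_mul, diagonal_transpose, sP', mul_assoc, ← mul_assoc P', iP',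
          one_mul]
      rw [this, ← mul_assoc, h1', one_mul]
    have hr : (T' * Y') * (Y' - Y)ᵀ * Tᵀ + T' * (Y' - Y) * (T * Y)ᵀ =
        T' * (Q + Y' * Y'ᵀ) * Tᵀ - T' * (Q + Y * Yᵀ) * Tᵀ := by
      simp only [transpose_sub, transpose_mul, Matrix.mul_sub, Matrix.sub_mul, Matrix.mul_add,
        Matrix.add_mul, Matrix.mul_assoc]
      abel
    rw [hl, hr, g1, g2]
  have e3 : frobSq (K * P) ≤ frobSq (K * P + P' * K) := by
    have h3 : frobSq (K * P + P' * K) =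
        frobSq (K * P) + frobSq (P' * K) + 2 * trace (P * K * P' * K) := by
      simp only [frobSq_eq_trace, transpose_add, add_mul, mul_add, trace_add, transpose_mul, sK, sP,
        sP']
      have h4 : trace (K * P' * (K * P)) = trace (P * K * (P' * K)) := by
        rw [← mul_assoc, trace_mul_comm]
        simp only [mul_assoc]
      rw [h4]
      simp only [mul_assoc]
      ring
    have := trace_mul_mul_mul_nonneg hP.posSemidef hP'.posSemidef sK
    have := frobSq_nonneg (P' * K)
    linarith
  have e4 : frobSq (P * K) = frobSq (K * P) := by
    rw [← frobSq_transpose, transpose_mul, sK, sP]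
  have hδ := frobSq_nonneg (Y' - Y)
  have sq16 {A : Matrix ι ι ℝ} (hA : ‖A‖ ≤ 4) : ‖A‖ ^ 2 ≤ 16 := by
    have := pow_le_pow_left₀ (norm_nonneg _) hA 2
    linarith
  have sq1 {A : Matrix ι κ ℝ} (hA : ‖A‖ ≤ 1) : ‖A‖ ^ 2 ≤ 1 := by
    have := pow_le_pow_left₀ (norm_nonneg _) hA 2
    linarith
  have e5 : frobSq (T' * Y' * (Y' - Y)ᵀ * Tᵀ) ≤ 16 * frobSq (Y' - Y) := by
    calc _ ≤ frobSq (T' * Y' * (Y' - Y)ᵀ) * ‖Tᵀ‖ ^ 2 := frobSq_mul_le' _ _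
      _ ≤ (‖T' * Y'‖ ^ 2 * frobSq (Y' - Y)ᵀ) * ‖Tᵀ‖ ^ 2 := by gcongr; exact frobSq_mul_le _ _
      _ ≤ (1 * frobSq (Y' - Y)) * 16 := by
          rw [opNorm_transpose, frobSq_transpose]
          gcongr
          exacts [sq1 n2', sq16 n1]
      _ = _ := by ring
  have e6 : frobSq (T' * (Y' - Y) * (T * Y)ᵀ) ≤ 16 * frobSq (Y' - Y) := by
    calc _ ≤ frobSq (T' * (Y' - Y)) * ‖(T * Y)ᵀ‖ ^ 2 := frobSq_mul_le' _ _
      _ ≤ (‖T'‖ ^ 2 * frobSq (Y' - Y)) * ‖(T * Y)ᵀ‖ ^ 2 := by gcongr; exact frobSq_mul_le _ _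
      _ ≤ (16 * frobSq (Y' - Y)) * 1 := by
          rw [opNorm_transpose]
          gcongr
          exacts [sq16 n1', sq1 n2]
      _ = _ := by ring
  have e7 : frobSq (Y - Y') = frobSq (Y' - Y) := by
    simp only [frobSq, Matrix.sub_apply]
    exact Finset.sum_congr rfl fun i _ ↦ Finset.sum_congr rfl fun j _ ↦ by ring
  rw [e1, e7]
  calc _ ≤ frobSq (P * K) * ‖T'‖ ^ 2 := frobSq_mul_le' _ _
    _ ≤ (2 * (16 * frobSq (Y' - Y)) + 2 * (16 * frobSq (Y' - Y))) * 16 := by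
        gcongr
        · rw [e4]
          refine e3.trans ?_
          rw [e2]
          refine (frobSq_add_le _ _).trans ?_
          gcongr
        · exact sq16 n1'
    _ = _ := by ring

end MatrixNorms

section PolarFactor

lemma integrable_inv_one_add_div_sq {a : ℝ} (ha : a ≠ 0) :
    Integrable fun t : ℝ ↦ (1 + (t / a) ^ 2)⁻¹ :=
  integrable_inv_one_add_sq.comp_div ha

lemma integral_inv_one_add_div_sq {a : ℝ} (ha : 0 < a) :
    ∫ t : ℝ, (1 + (t / a) ^ 2)⁻¹ = a * π := by
  rw [Measure.integral_comp_div (fun t : ℝ ↦ (1 + t ^ 2)⁻¹) a, integral_univ_inv_one_add_sq,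
    abs_of_pos ha, smul_eq_mul]

lemma inv_sq_add_eq {a : ℝ} (ha : 0 < a) (t : ℝ) :
    (t ^ 2 + a)⁻¹ = a⁻¹ * (1 + (t / √a) ^ 2)⁻¹ := by
  rw [← mul_inv, div_pow, Real.sq_sqrt ha.le]
  congr 1
  field_simp
  ring

variable {ι κ : Type*} [Fintype ι] [DecidableEq ι] [Fintype κ] [DecidableEq κ]

lemma Matrix.PosDef.exists_orthogonal_diagonalization {A : Matrix ι ι ℝ} (hA : A.PosDef) :
    ∃ (U : Matrix ι ι ℝ) (l : ι → ℝ), Uᵀ * U = 1 ∧ U * Uᵀ = 1 ∧ (∀ i, 0 < l i) ∧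
      A = U * diagonal l * Uᵀ := by
  refine ⟨hA.isHermitian.eigenvectorUnitary, hA.isHermitian.eigenvalues, ?_, ?_,
    hA.eigenvalues_pos, ?_⟩
  · have := Unitary.coe_star_mul_self hA.isHermitian.eigenvectorUnitary
    rwa [star_eq_conjTranspose, conjTranspose_eq_transpose_of_trivial] at this
  · have := Unitary.coe_mul_star_self hA.isHermitian.eigenvectorUnitary
    rwa [Unitary.coe_star, star_eq_conjTranspose, conjTranspose_eq_transpose_of_trivial] at this
  · have := hA.isHermitian.spectral_theorem
    rw [Unitary.conjStarAlgAut_apply, star_eq_conjTranspose,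
      conjTranspose_eq_transpose_of_trivial] at this
    exact this

/-- The weighted resolvent `(t² D⁻² + S)⁻¹`. -/
def weightedResolvent (d : ι → ℝ) (S : Matrix ι ι ℝ) (t : ℝ) : Matrix ι ι ℝ :=
  (diagonal (fun i ↦ (t / d i) ^ 2) + S)⁻¹

/-- The polar factor `(D S D)^{-1/2} D`, written through its resolvent integral. -/
def polarFactor (d : ι → ℝ) (S : Matrix ι ι ℝ) : Matrix ι ι ℝ :=
  of fun i j ↦ π⁻¹ * ∫ t : ℝ, (d i)⁻¹ * weightedResolvent d S t i j

lemma posDef_of_dotProduct {S : Matrix ι ι ℝ} (hs : Sᵀ = S) {c : ℝ} (hc : 0 < c)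
    (hS : ∀ w, c * (w ⬝ᵥ w) ≤ w ⬝ᵥ S *ᵥ w) : S.PosDef := by
  refine Matrix.PosDef.of_dotProduct_mulVec_pos ?_ fun w hw ↦ ?_
  · rw [IsHermitian, conjTranspose_eq_transpose_of_trivial, hs]
  · rw [star_trivial]
    refine lt_of_lt_of_le (mul_pos hc ?_) (hS w)
    exact lt_of_le_of_ne (dotProduct_self_nonneg' w) fun h ↦ hw (dotProduct_self_eq_zero.1 h.symm)

lemma weightedResolvent_spectral {d : ι → ℝ} (hd : ∀ i, 0 < d i) {S : Matrix ι ι ℝ}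
    (hS : S.PosDef) : ∃ (U : Matrix ι ι ℝ) (l : ι → ℝ), Uᵀ * U = 1 ∧ U * Uᵀ = 1 ∧ (∀ i, 0 < l i) ∧
      S = diagonal d⁻¹ * (U * diagonal l * Uᵀ) * diagonal d⁻¹ ∧
      ∀ t, weightedResolvent d S t =
        diagonal d * (U * diagonal (fun k ↦ (t ^ 2 + l k)⁻¹) * Uᵀ) * diagonal d := by
  have e1 : diagonal d * diagonal d⁻¹ = 1 := by
    rw [diagonal_mul_diagonal, ← diagonal_one]
    congr 1
    ext i
    exact mul_inv_cancel₀ (hd i).ne'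
  have e2 : diagonal d⁻¹ * diagonal d = 1 := mul_eq_one_comm.1 e1
  have hM : (diagonal d * S * diagonal d).PosDef := by
    have h := hS.conjTranspose_mul_mul_same (B := diagonal d)
      (Matrix.mulVec_injective_iff_isUnit.2 (IsUnit.of_mul_eq_one _ e1))
    simpa using h
  obtain ⟨U, l, h1, h2, hl, hM'⟩ := hM.exists_orthogonal_diagonalization
  have hS' : S = diagonal d⁻¹ * (U * diagonal l * Uᵀ) * diagonal d⁻¹ := by
    rw [← hM']
    simp only [← mul_assoc]
    rw [e2, one_mul, mul_assoc, e1, mul_one]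
  refine ⟨U, l, h1, h2, hl, hS', fun t ↦ ?_⟩
  refine Matrix.inv_eq_right_inv ?_
  have e3 : diagonal (fun i ↦ (t / d i) ^ 2) + S =
      diagonal d⁻¹ * (U * diagonal (fun k ↦ t ^ 2 + l k) * Uᵀ) * diagonal d⁻¹ := by
    have e4 : diagonal (fun k ↦ t ^ 2 + l k) = (t ^ 2) • (1 : Matrix ι ι ℝ) + diagonal l := by
      rw [smul_one_eq_diagonal, diagonal_add]
    rw [e4, mul_add, add_mul, mul_add, add_mul, ← hS', mul_smul_comm, mul_one, smul_mul_assoc, h2,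
      mul_smul_comm, mul_one, smul_mul_assoc, diagonal_mul_diagonal, ← diagonal_smul]
    congr 2
    ext i
    simp only [Pi.smul_apply, Pi.inv_apply, smul_eq_mul]
    ring
  rw [e3]
  calc _ = diagonal d⁻¹ * (U * diagonal (fun k ↦ t ^ 2 + l k) * (Uᵀ * ((diagonal d⁻¹ *
        diagonal d) * U)) * diagonal (fun k ↦ (t ^ 2 + l k)⁻¹) * Uᵀ) * diagonal d := by
        simp only [mul_assoc]
    _ = 1 := by
        have e5 : diagonal (fun k ↦ t ^ 2 + l k) * diagonal (fun k ↦ (t ^ 2 + l k)⁻¹) = 1 := by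
          rw [diagonal_mul_diagonal, ← diagonal_one]
          congr 1
          ext k
          have := hl k
          exact mul_inv_cancel₀ (by positivity)
        rw [e2, one_mul, h1, mul_one, mul_assoc U, e5, mul_one, h2, mul_one, e2]

lemma integrable_weightedResolvent {d : ι → ℝ} (hd : ∀ i, 0 < d i) {S : Matrix ι ι ℝ}
    (hS : S.PosDef) (i j : ι) : Integrable fun t ↦ weightedResolvent d S t i j := by
  obtain ⟨U, l, -, -, hl, -, hR⟩ := weightedResolvent_spectral hd hS
  have : (fun t ↦ weightedResolvent d S t i j) =
      fun t ↦ ∑ k, (d i * U i k * U j k * d j * (l k)⁻¹) * (1 + (t / √(l k)) ^ 2)⁻¹ := by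
    ext t
    rw [hR, mul_diagonal, diagonal_mul, Matrix.mul_apply, Finset.mul_sum, Finset.sum_mul]
    refine Finset.sum_congr rfl fun k _ ↦ ?_
    rw [mul_diagonal, transpose_apply, inv_sq_add_eq (hl k)]
    ring
  rw [this]
  exact integrable_finsetSum _ fun k _ ↦
    (integrable_inv_one_add_div_sq (Real.sqrt_ne_zero'.2 (hl k))).const_mul _

lemma isPolarFactor_polarFactor {d : ι → ℝ} (hd : ∀ i, 0 < d i) {S : Matrix ι ι ℝ}
    (hS : S.PosDef) : IsPolarFactor d S (polarFactor d S) := by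
  obtain ⟨U, l, h1, h2, hl, hSe, hR⟩ := weightedResolvent_spectral hd hS
  set P := U * diagonal (fun k ↦ (√(l k))⁻¹) * Uᵀ with hP
  have hsP : Pᵀ = P := by
    simp [hP, transpose_mul, mul_assoc]
  have hpd : P.PosDef := by
    have h := (Matrix.PosDef.diagonal (d := fun k ↦ (√(l k))⁻¹)
      fun k ↦ inv_pos.2 (Real.sqrt_pos.2 (hl k))).conjTranspose_mul_mul_same (B := Uᵀ)
      (Matrix.mulVec_injective_iff_isUnit.2 (IsUnit.of_mul_eq_one _ h1))
    rwa [conjTranspose_eq_transpose_of_trivial, transpose_transpose] at h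
  have hT : polarFactor d S = P * diagonal d := by
    ext i j
    have e : (fun t ↦ (d i)⁻¹ * weightedResolvent d S t i j) =
        fun t ↦ ∑ k, (U i k * U j k * d j * (l k)⁻¹) * (1 + (t / √(l k)) ^ 2)⁻¹ := by
      ext t
      rw [hR, mul_diagonal, diagonal_mul, Matrix.mul_apply, Finset.mul_sum, Finset.sum_mul,
        Finset.mul_sum]
      refine Finset.sum_congr rfl fun k _ ↦ ?_
      rw [mul_diagonal, transpose_apply, inv_sq_add_eq (hl k)]
      have := (hd i).ne'
      field_simp
    rw [polarFactor, of_apply, e, integral_finsetSum _ fun k _ ↦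
      (integrable_inv_one_add_div_sq (Real.sqrt_ne_zero'.2 (hl k))).const_mul _, mul_diagonal, hP,
      Matrix.mul_apply, Finset.mul_sum, Finset.sum_mul]
    refine Finset.sum_congr rfl fun k _ ↦ ?_
    rw [integral_const_mul, integral_inv_one_add_div_sq (Real.sqrt_pos.2 (hl k)), mul_diagonal,
      transpose_apply]
    have h3 := Real.sqrt_pos.2 (hl k)
    have h4 := Real.sq_sqrt (hl k).le
    have := Real.pi_pos
    have : (l k)⁻¹ = (√(l k))⁻¹ * (√(l k))⁻¹ := by
      rw [← mul_inv, ← sq, h4]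
    rw [this]
    field_simp
  refine ⟨P, hpd, hT, ?_⟩
  have e1 : diagonal d * diagonal d⁻¹ = 1 := by
    rw [diagonal_mul_diagonal, ← diagonal_one]
    congr 1
    ext i
    exact mul_inv_cancel₀ (hd i).ne'
  have e2 : diagonal d⁻¹ * diagonal d = 1 := mul_eq_one_comm.1 e1
  rw [hT, transpose_mul, diagonal_transpose, hsP, hSe]
  calc _ = P * (diagonal d * diagonal d⁻¹) * (U * diagonal l * Uᵀ) *
        (diagonal d⁻¹ * diagonal d) * P := by simp only [mul_assoc]
    _ = U * diagonal (fun k ↦ (√(l k))⁻¹) * (Uᵀ * U) * diagonal l * (Uᵀ * U) *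
        diagonal (fun k ↦ (√(l k))⁻¹) * Uᵀ := by
        rw [e1, e2, hP]; simp only [mul_assoc, mul_one]
    _ = U * (diagonal (fun k ↦ (√(l k))⁻¹) * diagonal l * diagonal (fun k ↦ (√(l k))⁻¹)) * Uᵀ := by
        rw [h1]; simp only [mul_assoc, mul_one]
    _ = 1 := by
        rw [diagonal_mul_diagonal, diagonal_mul_diagonal]
        have : (fun k ↦ (√(l k))⁻¹ * l k * (√(l k))⁻¹) = 1 := by
          ext k
          have h3 := (Real.sqrt_pos.2 (hl k)).ne'
          have h4 := Real.mul_self_sqrt (hl k).le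
          field_simp
          simp only [Pi.one_apply]
          linarith
        rw [this, diagonal_one', mul_one, h2]

lemma dotProduct_polarFactor_mulVec {d : ι → ℝ} (hd : ∀ i, 0 < d i) {S : Matrix ι ι ℝ}
    (hS : S.PosDef) (u v : ι → ℝ) :
    Integrable (fun t ↦ (fun i ↦ (d i)⁻¹ * u i) ⬝ᵥ weightedResolvent d S t *ᵥ v) ∧
    u ⬝ᵥ polarFactor d S *ᵥ v =
      π⁻¹ * ∫ t, (fun i ↦ (d i)⁻¹ * u i) ⬝ᵥ weightedResolvent d S t *ᵥ v := by
  have hi (i j : ι) : Integrable fun t ↦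
      (d i)⁻¹ * u i * (weightedResolvent d S t i j * v j) :=
    ((integrable_weightedResolvent hd hS i j).mul_const _).const_mul _
  have e (t : ℝ) : (fun i ↦ (d i)⁻¹ * u i) ⬝ᵥ weightedResolvent d S t *ᵥ v =
      ∑ i, ∑ j, (d i)⁻¹ * u i * (weightedResolvent d S t i j * v j) := by
    simp only [dotProduct, mulVec, Finset.mul_sum]
  simp_rw [e]
  refine ⟨integrable_finsetSum _ fun i _ ↦ integrable_finsetSum _ fun j _ ↦ hi i j, ?_⟩
  rw [integral_finsetSum _ fun i _ ↦ integrable_finsetSum _ fun j _ ↦ hi i j, Finset.mul_sum,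
    dotProduct]
  refine Finset.sum_congr rfl fun i _ ↦ ?_
  rw [integral_finsetSum _ fun j _ ↦ hi i j, Finset.mul_sum, mulVec, dotProduct, Finset.mul_sum]
  refine Finset.sum_congr rfl fun j _ ↦ ?_
  rw [polarFactor, of_apply, integral_const_mul, integral_const_mul, integral_mul_const]
  ring

lemma polarFactor_eq_of_isPolarFactor {d : ι → ℝ} (hd : ∀ i, 0 < d i) {S T : Matrix ι ι ℝ}
    (hs : Sᵀ = S) (hS : ∀ w, w ⬝ᵥ w / 16 ≤ w ⬝ᵥ S *ᵥ w) (hT : IsPolarFactor d S T) :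
    T = polarFactor d S := by
  have hpd : S.PosDef := posDef_of_dotProduct hs (c := 1 / 16) (by norm_num) fun w ↦ by
    have := hS w; linarith
  have e : S + (0 : Matrix ι ι ℝ) * 0ᵀ = S := by simp
  have h := frobSq_sub_le_of_isPolarFactor (Y := (0 : Matrix ι ι ℝ)) (Y' := 0) hS
    (by rwa [e]) (by rw [e]; exact isPolarFactor_polarFactor hd hpd)
  have h0 : frobSq ((0 : Matrix ι ι ℝ) - 0) = 0 := by simp [frobSq]
  rw [h0, mul_zero] at h
  have h1 := opNorm_sq_le_frobSq (T - polarFactor d S)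
  have h2 : ‖T - polarFactor d S‖ = 0 := by
    have := norm_nonneg (T - polarFactor d S)
    nlinarith
  exact sub_eq_zero.1 (norm_eq_zero.1 h2)

end PolarFactor

section RankOne

variable {ι κ : Type*} [Fintype ι] [DecidableEq ι] [Fintype κ] [DecidableEq κ]

/-- Isotropy and a fourth-moment bound for a random vector. -/
structure ColumnMoments (ν : Measure (ι → ℝ)) (B : ℝ) : Prop where
  one_le : 1 ≤ B
  integrable_four : Integrable (fun x ↦ (x ⬝ᵥ x) ^ 2) ν
  integral_mul : ∀ a b : ι → ℝ, ∫ x, (a ⬝ᵥ x) * (b ⬝ᵥ x) ∂ν = a ⬝ᵥ b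
  integral_quad : ∀ N : Matrix ι ι ℝ, ∫ x, (x ⬝ᵥ N *ᵥ x - trace N) ^ 2 ∂ν ≤ B * frobSq N

lemma frobSq_vecMulVec (a : ι → ℝ) (b : κ → ℝ) :
    frobSq (vecMulVec a b) = (a ⬝ᵥ a) * (b ⬝ᵥ b) := by
  simp only [frobSq, vecMulVec_apply, dotProduct, Finset.sum_mul_sum]
  exact Finset.sum_congr rfl fun i _ ↦ Finset.sum_congr rfl fun j _ ↦ by ring

lemma dotProduct_vecMulVec_mulVec (x a : ι → ℝ) (b y : κ → ℝ) :
    x ⬝ᵥ vecMulVec a b *ᵥ y = (a ⬝ᵥ x) * (b ⬝ᵥ y) := by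
  rw [vecMulVec_mulVec, dotProduct_smul, dotProduct_comm x a]
  simp

lemma abs_quad_le (N : Matrix ι ι ℝ) (x : ι → ℝ) : |x ⬝ᵥ N *ᵥ x| ≤ ‖N‖ * (x ⬝ᵥ x) := by
  have := abs_dotProduct_mulVec_le N x x
  rwa [mul_assoc, ← sq, vecNorm_sq] at this

namespace ColumnMoments

variable {ν : Measure (ι → ℝ)} [IsProbabilityMeasure ν] {B : ℝ}

lemma integrable_two (hν : ColumnMoments ν B) : Integrable (fun x ↦ x ⬝ᵥ x) ν := by
  refine (hν.integrable_four.add (integrable_const (1 : ℝ))).mono'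
    (by fun_prop) (Filter.Eventually.of_forall fun x ↦ ?_)
  rw [Real.norm_eq_abs, abs_of_nonneg (dotProduct_self_nonneg' x)]
  simp only [Pi.add_apply]
  nlinarith [sq_nonneg (x ⬝ᵥ x - 1)]

lemma integrable_mul (hν : ColumnMoments ν B) (a b : ι → ℝ) :
    Integrable (fun x ↦ (a ⬝ᵥ x) * (b ⬝ᵥ x)) ν := by
  refine (hν.integrable_two.const_mul (vecNorm a * vecNorm b)).mono' (by fun_prop)
    (Filter.Eventually.of_forall fun x ↦ ?_)
  rw [Real.norm_eq_abs, abs_mul]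
  refine (mul_le_mul (abs_dotProduct_le a x) (abs_dotProduct_le b x) (abs_nonneg _)
    (mul_nonneg (vecNorm_nonneg _) (vecNorm_nonneg _))).trans (le_of_eq ?_)
  rw [← vecNorm_sq]; ring

lemma integrable_quad (hν : ColumnMoments ν B) (N : Matrix ι ι ℝ) :
    Integrable (fun x ↦ x ⬝ᵥ N *ᵥ x) ν := by
  refine (hν.integrable_two.const_mul ‖N‖).mono' (by fun_prop)
    (Filter.Eventually.of_forall fun x ↦ abs_quad_le N x)

lemma integrable_quad_sq (hν : ColumnMoments ν B) (N : Matrix ι ι ℝ) :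
    Integrable (fun x ↦ (x ⬝ᵥ N *ᵥ x) ^ 2) ν := by
  refine (hν.integrable_four.const_mul (‖N‖ ^ 2)).mono' (by fun_prop)
    (Filter.Eventually.of_forall fun x ↦ ?_)
  rw [Real.norm_eq_abs, abs_pow, ← mul_pow]
  exact pow_le_pow_left₀ (abs_nonneg _) (abs_quad_le N x) 2

lemma integrable_quad_sub_sq (hν : ColumnMoments ν B) (N : Matrix ι ι ℝ) (c : ℝ) :
    Integrable (fun x ↦ (x ⬝ᵥ N *ᵥ x - c) ^ 2) ν := by
  have h := ((hν.integrable_quad_sq N).sub ((hν.integrable_quad N).const_mul (2 * c))).add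
    (integrable_const (c ^ 2))
  refine h.congr (Filter.Eventually.of_forall fun x ↦ ?_)
  simp only [Pi.add_apply, Pi.sub_apply]
  ring

lemma integral_quad_sq_le (hν : ColumnMoments ν B) (N : Matrix ι ι ℝ) :
    ∫ x, (x ⬝ᵥ N *ᵥ x) ^ 2 ∂ν ≤ 2 * (B * frobSq N) + 2 * trace N ^ 2 := by
  have h1 : ∫ x, (x ⬝ᵥ N *ᵥ x) ^ 2 ∂ν ≤
      ∫ x, (2 * (x ⬝ᵥ N *ᵥ x - trace N) ^ 2 + 2 * trace N ^ 2) ∂ν := by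
    refine integral_mono (hν.integrable_quad_sq N)
      (((hν.integrable_quad_sub_sq N _).const_mul 2).add (integrable_const _)) fun x ↦ ?_
    simp only
    nlinarith [sq_nonneg (x ⬝ᵥ N *ᵥ x - 2 * trace N)]
  rw [integral_add ((hν.integrable_quad_sub_sq N _).const_mul 2) (integrable_const _),
    integral_const_mul, integral_const] at h1
  have := hν.integral_quad N
  simp at h1
  linarith

lemma integral_mul_sq_le (hν : ColumnMoments ν B) (a b : ι → ℝ) :
    ∫ x, ((a ⬝ᵥ x) * (b ⬝ᵥ x)) ^ 2 ∂ν ≤ 4 * B * ((a ⬝ᵥ a) * (b ⬝ᵥ b)) := by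
  have h := hν.integral_quad_sq_le (vecMulVec a b)
  simp only [dotProduct_vecMulVec_mulVec, trace_vecMulVec, frobSq_vecMulVec] at h
  have h1 : (a ⬝ᵥ b) ^ 2 ≤ (a ⬝ᵥ a) * (b ⬝ᵥ b) := by
    have := pow_le_pow_left₀ (abs_nonneg _) (abs_dotProduct_le a b) 2
    rwa [sq_abs, mul_pow, vecNorm_sq, vecNorm_sq] at this
  have h2 := mul_nonneg (dotProduct_self_nonneg' a) (dotProduct_self_nonneg' b)
  have := hν.one_le
  nlinarith

lemma integral_self (hν : ColumnMoments ν B) : ∫ x, x ⬝ᵥ x ∂ν = Fintype.card ι := by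
  have e (x : ι → ℝ) : x ⬝ᵥ x = ∑ i, (Pi.single i 1 ⬝ᵥ x) * (Pi.single i 1 ⬝ᵥ x) := by
    simp_rw [single_one_dotProduct]
    rfl
  simp_rw [e]
  rw [integral_finsetSum _ fun i _ ↦ hν.integrable_mul _ _]
  simp only [hν.integral_mul]
  simp

lemma map_orthogonal (hν : ColumnMoments ν B) {O : Matrix ι ι ℝ} (hO : Oᵀ * O = 1) :
    ColumnMoments (ν.map fun x ↦ O *ᵥ x) B := by
  have hO' : O * Oᵀ = 1 := mul_eq_one_comm.1 hO
  have hm : Measurable fun x : ι → ℝ ↦ O *ᵥ x := by fun_prop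
  have hdot (x : ι → ℝ) : O *ᵥ x ⬝ᵥ O *ᵥ x = x ⬝ᵥ x := by
    rw [dotProduct_mulVec, vecMul_mulVec, hO, vecMul_one]
  have hdot' (a x : ι → ℝ) : a ⬝ᵥ O *ᵥ x = (Oᵀ *ᵥ a) ⬝ᵥ x := by
    rw [dotProduct_mulVec, mulVec_transpose]
  refine ⟨hν.one_le, ?_, fun a b ↦ ?_, fun N ↦ ?_⟩
  · refine (integrable_map_measure (by fun_prop) hm.aemeasurable).2 ?_
    simpa only [Function.comp_def, hdot] using hν.integrable_four
  · rw [integral_map hm.aemeasurable (by fun_prop)]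
    simp_rw [hdot', hν.integral_mul]
    rw [mulVec_transpose, ← dotProduct_mulVec, mulVec_mulVec, hO', one_mulVec]
  · rw [integral_map hm.aemeasurable (by fun_prop)]
    have h := hν.integral_quad (Oᵀ * N * O)
    have e1 : trace (Oᵀ * N * O) = trace N := by
      rw [trace_mul_comm, ← mul_assoc, hO', one_mul]
    have e2 : frobSq (Oᵀ * N * O) = frobSq N := by
      rw [frobSq_eq_trace, frobSq_eq_trace]
      simp only [transpose_mul, transpose_transpose, mul_assoc]
      rw [trace_mul_comm]
      simp only [mul_assoc]
      rw [hO', mul_one, ← mul_assoc O, hO', one_mul]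
    rw [e1, e2] at h
    have e3 (x : ι → ℝ) : O *ᵥ x ⬝ᵥ N *ᵥ (O *ᵥ x) = x ⬝ᵥ (Oᵀ * N * O) *ᵥ x := by
      rw [mul_assoc, ← mulVec_mulVec, ← mulVec_mulVec, dotProduct_mulVec x, vecMul_transpose]
    simpa only [e3] using h

end ColumnMoments

lemma integral_abs_mul_le {Ω : Type*} [MeasurableSpace Ω] {μ : Measure Ω} {f g : Ω → ℝ}
    (hf : Integrable (fun x ↦ f x ^ 2) μ) (hg : Integrable (fun x ↦ g x ^ 2) μ)
    (hfm : AEStronglyMeasurable f μ) (hgm : AEStronglyMeasurable g μ)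
    {a b : ℝ} (ha : 0 ≤ a) (hb : 0 ≤ b)
    (h1 : ∫ x, f x ^ 2 ∂μ ≤ a ^ 2) (h2 : ∫ x, g x ^ 2 ∂μ ≤ b ^ 2) :
    ∫ x, |f x * g x| ∂μ ≤ a * b := by
  have h := integral_mul_norm_le_Lp_mul_Lq (μ := μ) (f := f) (g := g) Real.HolderConjugate.two_two
    (by simpa using (memLp_two_iff_integrable_sq hfm).2 hf)
    (by simpa using (memLp_two_iff_integrable_sq hgm).2 hg)
  simp only [Real.norm_eq_abs, Real.rpow_two, sq_abs, ← Real.sqrt_eq_rpow] at h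
  simp only [abs_mul]
  refine h.trans (mul_le_mul ?_ ?_ (Real.sqrt_nonneg _) ha)
  · exact Real.sqrt_le_iff.2 ⟨ha, h1⟩
  · exact Real.sqrt_le_iff.2 ⟨hb, h2⟩

lemma inv_add_smul_vecMulVec {A : Matrix ι ι ℝ} (hA : A.PosDef) {n : ℝ} (hn : 0 < n)
    (y : ι → ℝ) :
    (A + n⁻¹ • vecMulVec y y)⁻¹ =
      A⁻¹ - (n + y ⬝ᵥ A⁻¹ *ᵥ y)⁻¹ • vecMulVec (A⁻¹ *ᵥ y) (A⁻¹ *ᵥ y) := by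
  have hq : 0 ≤ y ⬝ᵥ A⁻¹ *ᵥ y := by
    have := hA.inv.posSemidef.dotProduct_mulVec_nonneg y
    rwa [star_trivial] at this
  set q := y ⬝ᵥ A⁻¹ *ᵥ y with hqd
  have hs : A⁻¹ᵀ = A⁻¹ := by
    rw [← conjTranspose_eq_transpose_of_trivial]; exact hA.inv.isHermitian
  have iA : A * A⁻¹ = 1 := Matrix.mul_nonsing_inv _ ((Matrix.isUnit_iff_isUnit_det _).1 hA.isUnit)
  refine Matrix.inv_eq_right_inv ?_
  have e1 : vecMulVec y y * A⁻¹ = vecMulVec y (A⁻¹ *ᵥ y) := by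
    rw [vecMulVec_mul, ← mulVec_transpose, hs]
  have e2 : A * vecMulVec (A⁻¹ *ᵥ y) (A⁻¹ *ᵥ y) = vecMulVec y (A⁻¹ *ᵥ y) := by
    rw [mul_vecMulVec, mulVec_mulVec, iA, one_mulVec]
  have e3 : vecMulVec y y * vecMulVec (A⁻¹ *ᵥ y) (A⁻¹ *ᵥ y) = q • vecMulVec y (A⁻¹ *ᵥ y) := by
    rw [vecMulVec_mul_vecMulVec, ← hqd, vecMulVec_smul]
  rw [mul_sub, add_mul, add_mul, iA, smul_mul_assoc, e1, mul_smul_comm, e2, smul_mul_assoc,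
    mul_smul_comm, e3, smul_smul, smul_smul, add_sub_assoc, ← sub_sub, ← sub_smul, ← sub_smul]
  convert add_zero (1 : Matrix ι ι ℝ)
  convert zero_smul ℝ (vecMulVec y (A⁻¹ *ᵥ y))
  have : n + q ≠ 0 := by positivity
  field_simp
  ring

end RankOne

section OneColumn

variable {ι κ : Type*} [Fintype ι] [DecidableEq ι] [Fintype κ] [DecidableEq κ]

lemma vecNorm_add_le (u v : ι → ℝ) : vecNorm (u + v) ≤ vecNorm u + vecNorm v := by
  simp only [vecNorm_eq_norm, WithLp.toLp_add]
  exact norm_add_le _ _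

lemma vecNorm_smul (c : ℝ) (v : ι → ℝ) : vecNorm (c • v) = |c| * vecNorm v := by
  simp only [vecNorm_eq_norm, WithLp.toLp_smul, norm_smul, Real.norm_eq_abs]

lemma vecNorm_neg (v : ι → ℝ) : vecNorm (-v) = vecNorm v := by
  simp [vecNorm]

lemma vecNorm_sum_le {τ : Type*} (s : Finset τ) (f : τ → ι → ℝ) :
    vecNorm (∑ i ∈ s, f i) ≤ ∑ i ∈ s, vecNorm (f i) := by
  simp only [vecNorm_eq_norm, WithLp.toLp_sum]
  exact norm_sum_le _ _

/-- Symmetric matrices dominating `1/16`. -/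
structure CoerciveMatrix (Q : Matrix ι ι ℝ) : Prop where
  symm : Qᵀ = Q
  le_quad : ∀ w, w ⬝ᵥ w / 16 ≤ w ⬝ᵥ Q *ᵥ w

lemma CoerciveMatrix.posDef {Q : Matrix ι ι ℝ} (hQ : CoerciveMatrix Q) : Q.PosDef :=
  posDef_of_dotProduct hQ.symm (c := 1 / 16) (by norm_num) fun w ↦ by
    have := hQ.le_quad w; linarith

lemma CoerciveMatrix.add {Q N : Matrix ι ι ℝ} (hQ : CoerciveMatrix Q) (hN : Nᵀ = N)
    (hN0 : ∀ w, 0 ≤ w ⬝ᵥ N *ᵥ w) : CoerciveMatrix (Q + N) where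
  symm := by rw [transpose_add, hQ.symm, hN]
  le_quad w := by
    rw [add_mulVec, dotProduct_add]
    linarith [hQ.le_quad w, hN0 w]

lemma CoerciveMatrix.add_smul_vecMulVec {Q : Matrix ι ι ℝ} (hQ : CoerciveMatrix Q)
    {c : ℝ} (hc : 0 ≤ c)
    (y : ι → ℝ) : CoerciveMatrix (Q + c • vecMulVec y y) :=
  hQ.add (by rw [transpose_smul, transpose_vecMulVec]) fun w ↦ by
    rw [smul_mulVec, dotProduct_smul, dotProduct_vecMulVec_mulVec, smul_eq_mul]
    exact mul_nonneg hc (mul_self_nonneg _)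

lemma CoerciveMatrix.add_diagonal_sq {Q : Matrix ι ι ℝ} (hQ : CoerciveMatrix Q) (f : ι → ℝ) :
    CoerciveMatrix (diagonal (fun i ↦ f i ^ 2) + Q) := by
  rw [add_comm]
  refine hQ.add (diagonal_transpose _) fun w ↦ ?_
  simp only [dotProduct, mulVec_diagonal]
  exact Finset.sum_nonneg fun i _ ↦ by nlinarith [mul_nonneg (sq_nonneg (f i)) (sq_nonneg (w i))]

lemma CoerciveMatrix.opNorm_inv_le {A : Matrix ι ι ℝ} (hA : CoerciveMatrix A) : ‖A⁻¹‖ ≤ 16 := by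
  have iA : A * A⁻¹ = 1 :=
    Matrix.mul_nonsing_inv _ ((Matrix.isUnit_iff_isUnit_det _).1 hA.posDef.isUnit)
  refine opNorm_le_of_vecNorm_le (by norm_num) fun w ↦ ?_
  have h1 := hA.le_quad (A⁻¹ *ᵥ w)
  rw [mulVec_mulVec, iA, one_mulVec, ← vecNorm_sq] at h1
  have h2 := (le_abs_self _).trans (abs_dotProduct_le (A⁻¹ *ᵥ w) w)
  rcases (vecNorm_nonneg (A⁻¹ *ᵥ w)).eq_or_lt with h0 | h0
  · rw [← h0]; exact mul_nonneg (by norm_num) (vecNorm_nonneg w)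
  · nlinarith

section Resolvent

variable {d : ι → ℝ} {Q : Matrix ι ι ℝ}

lemma weightedResolvent_posDef (hQ : CoerciveMatrix Q) (t : ℝ) : (weightedResolvent d Q t).PosDef :=
  (hQ.add_diagonal_sq fun i ↦ t / d i).posDef.inv

lemma weightedResolvent_transpose (hQ : CoerciveMatrix Q) (t : ℝ) :
    (weightedResolvent d Q t)ᵀ = weightedResolvent d Q t := by
  rw [← conjTranspose_eq_transpose_of_trivial]
  exact (weightedResolvent_posDef hQ t).isHermitian

lemma opNorm_weightedResolvent_le (hQ : CoerciveMatrix Q) (t : ℝ) :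
    ‖weightedResolvent d Q t‖ ≤ 16 :=
  (hQ.add_diagonal_sq fun i ↦ t / d i).opNorm_inv_le

lemma weightedResolvent_quad_nonneg (hQ : CoerciveMatrix Q) (t : ℝ) (y : ι → ℝ) :
    0 ≤ y ⬝ᵥ weightedResolvent d Q t *ᵥ y := by
  have := (weightedResolvent_posDef (d := d) hQ t).posSemidef.dotProduct_mulVec_nonneg y
  rwa [star_trivial] at this

lemma continuous_weightedResolvent (hd : ∀ i, 0 < d i) (hQ : CoerciveMatrix Q) :
    Continuous (weightedResolvent d Q) := by
  obtain ⟨U, l, -, -, hl, -, hR⟩ := weightedResolvent_spectral hd hQ.posDef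
  rw [funext hR]
  have : Continuous fun t : ℝ ↦ diagonal (fun k ↦ (t ^ 2 + l k)⁻¹) := by
    refine Continuous.matrix_diagonal (continuous_pi fun k ↦ ?_)
    refine Continuous.inv₀ (by fun_prop) fun t ↦ ?_
    have := hl k
    positivity
  fun_prop

lemma vecNorm_weightedResolvent_single_le (hQ : CoerciveMatrix Q) (t : ℝ) (i : ι) :
    vecNorm (weightedResolvent d Q t *ᵥ Pi.single i 1) * (1 + (t / d i) ^ 2) ≤
      17 + 16 * vecNorm (Q *ᵥ Pi.single i 1) := by
  set R := weightedResolvent d Q t with hR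
  set e : ι → ℝ := Pi.single i 1 with he
  have hen : vecNorm e = 1 := by simp [vecNorm, he]
  have hRN : R * (diagonal (fun i ↦ (t / d i) ^ 2) + Q) = 1 :=
    Matrix.nonsing_inv_mul _ ((Matrix.isUnit_iff_isUnit_det _).1
      (hQ.add_diagonal_sq fun i ↦ t / d i).posDef.isUnit)
  have h1 : (t / d i) ^ 2 • (R *ᵥ e) = e + -(R *ᵥ (Q *ᵥ e)) := by
    have h2 : R *ᵥ ((diagonal (fun i ↦ (t / d i) ^ 2) + Q) *ᵥ e) = e := by
      rw [mulVec_mulVec, hRN, one_mulVec]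
    have h3 : diagonal (fun i ↦ (t / d i) ^ 2) *ᵥ e = (t / d i) ^ 2 • e := by
      rw [he, diagonal_mulVec_single, ← Pi.single_smul]
      simp
    rw [add_mulVec, mulVec_add, h3, mulVec_smul] at h2
    rw [← eq_sub_iff_add_eq] at h2
    rw [h2, sub_eq_add_neg]
  have h4 := vecNorm_add_le e (-(R *ᵥ (Q *ᵥ e)))
  rw [← h1, vecNorm_smul, vecNorm_neg, hen, abs_of_nonneg (sq_nonneg _)] at h4
  have hRn : ‖R‖ ≤ 16 := opNorm_weightedResolvent_le hQ t
  have h5 := vecNorm_mulVec_le R (Q *ᵥ e)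
  have h6 := vecNorm_mulVec_le R e
  have h7 := mul_le_mul_of_nonneg_right hRn (vecNorm_nonneg (Q *ᵥ e))
  rw [hen] at h6
  linarith

lemma exists_integrable_bound_weightedResolvent (hd : ∀ i, 0 < d i) (hQ : CoerciveMatrix Q)
    (u : ι → ℝ) : ∃ α : ℝ → ℝ, Integrable α ∧
      (∀ t, vecNorm (weightedResolvent d Q t *ᵥ fun i ↦ (d i)⁻¹ * u i) ≤ α t) ∧
      √(Fintype.card ι) * ∫ t, α t ≤ π * (25 * (Fintype.card ι + frobSq Q) * vecNorm u) := by
  set q : ι → ℝ := fun i ↦ 17 + 16 * vecNorm (Q *ᵥ Pi.single i 1) with hq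
  have hInt (i : ι) : Integrable fun t ↦ (|u i| * q i * (d i)⁻¹) * (1 + (t / d i) ^ 2)⁻¹ :=
    (integrable_inv_one_add_div_sq (hd i).ne').const_mul _
  refine ⟨fun t ↦ ∑ i, (|u i| * q i * (d i)⁻¹) * (1 + (t / d i) ^ 2)⁻¹,
    integrable_finsetSum _ fun i _ ↦ hInt i, fun t ↦ ?_, ?_⟩
  · have e : (fun i ↦ (d i)⁻¹ * u i) = ∑ i, ((d i)⁻¹ * u i) • (Pi.single i 1 : ι → ℝ) := by
      ext j
      simp [Finset.sum_apply, Pi.single_apply]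
    rw [e, mulVec_sum]
    refine (vecNorm_sum_le _ _).trans (Finset.sum_le_sum fun i _ ↦ ?_)
    rw [mulVec_smul, vecNorm_smul, abs_mul, abs_of_pos (inv_pos.2 (hd i))]
    have h := vecNorm_weightedResolvent_single_le (d := d) hQ t i
    have hpos : 0 < 1 + (t / d i) ^ 2 := by positivity
    rw [← le_div_iff₀ hpos] at h
    have := mul_le_mul_of_nonneg_left h
      (mul_nonneg (inv_pos.2 (hd i)).le (abs_nonneg (u i)))
    refine this.trans (le_of_eq ?_)
    rw [hq, div_eq_mul_inv]
    ring
  · rw [integral_finsetSum _ fun i _ ↦ hInt i]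
    have e1 : ∑ i, ∫ t, (|u i| * q i * (d i)⁻¹) * (1 + (t / d i) ^ 2)⁻¹ =
        π * ∑ i, |u i| * q i := by
      rw [Finset.mul_sum]
      refine Finset.sum_congr rfl fun i _ ↦ ?_
      rw [integral_const_mul, integral_inv_one_add_div_sq (hd i)]
      have := (hd i).ne'
      field_simp
    rw [e1, mul_left_comm]
    refine mul_le_mul_of_nonneg_left ?_ Real.pi_pos.le
    have e2 : ∑ i, |u i| * q i ≤ vecNorm u * vecNorm q := by
      have := (le_abs_self _).trans (abs_dotProduct_le (fun i ↦ |u i|) q)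
      refine this.trans (le_of_eq ?_)
      congr 1
      simp [vecNorm, dotProduct]
    have e3 : vecNorm q ^ 2 ≤ 600 * (Fintype.card ι + frobSq Q) := by
      have hc : frobSq Q = ∑ i, vecNorm (Q *ᵥ Pi.single i 1) ^ 2 := by
        rw [← frobSq_transpose]
        refine Finset.sum_congr rfl fun i _ ↦ ?_
        rw [vecNorm_sq]
        simp [dotProduct, sq]
      rw [vecNorm_sq, hc, dotProduct]
      have : (Fintype.card ι : ℝ) = ∑ _i : ι, 1 := by simp
      rw [this, ← Finset.sum_add_distrib, Finset.mul_sum]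
      refine Finset.sum_le_sum fun i _ ↦ ?_
      simp only [hq]
      nlinarith [sq_nonneg (17 - 16 * vecNorm (Q *ᵥ Pi.single i 1)),
        sq_nonneg (vecNorm (Q *ᵥ Pi.single i 1))]
    set Z := (Fintype.card ι + frobSq Q : ℝ) with hZ
    have hZ0 : 0 ≤ Z := add_nonneg (Nat.cast_nonneg _) (frobSq_nonneg Q)
    have e4 : √(Fintype.card ι) * vecNorm q ≤ 25 * Z := by
      refine abs_le_of_sq_le_sq' ?_ (by positivity) |>.2
      rw [mul_pow, Real.sq_sqrt (Nat.cast_nonneg _)]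
      have h1 : (Fintype.card ι : ℝ) ≤ Z := by
        have := frobSq_nonneg Q
        linarith
      have := mul_le_mul h1 e3 (sq_nonneg _) hZ0
      nlinarith
    calc √(Fintype.card ι) * ∑ i, |u i| * q i
        ≤ √(Fintype.card ι) * (vecNorm u * vecNorm q) := by gcongr
      _ = (√(Fintype.card ι) * vecNorm q) * vecNorm u := by ring
      _ ≤ _ := mul_le_mul_of_nonneg_right e4 (vecNorm_nonneg u)

end Resolvent

/-- Deterministic value around which the polar factor of a random rank-one update sits. -/
def rankOneCentre (d : ι → ℝ) (Q : Matrix ι ι ℝ) (n : ℝ) (u v : ι → ℝ) : ℝ :=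
  u ⬝ᵥ polarFactor d Q *ᵥ v - π⁻¹ * ∫ t,
    ((weightedResolvent d Q t *ᵥ fun i ↦ (d i)⁻¹ * u i) ⬝ᵥ (weightedResolvent d Q t *ᵥ v)) /
      (n + trace (weightedResolvent d Q t))

lemma dotProduct_polarFactor_add_smul_vecMulVec {d : ι → ℝ} (hd : ∀ i, 0 < d i)
    {Q : Matrix ι ι ℝ} (hQ : CoerciveMatrix Q) {n : ℝ} (hn : 0 < n) (u v y : ι → ℝ) :
    u ⬝ᵥ polarFactor d (Q + n⁻¹ • vecMulVec y y) *ᵥ v = u ⬝ᵥ polarFactor d Q *ᵥ v -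
      π⁻¹ * ∫ t, ((weightedResolvent d Q t *ᵥ fun i ↦ (d i)⁻¹ * u i) ⬝ᵥ y) *
        ((weightedResolvent d Q t *ᵥ v) ⬝ᵥ y) / (n + y ⬝ᵥ weightedResolvent d Q t *ᵥ y) := by
  have hQ' := hQ.add_smul_vecMulVec (inv_pos.2 hn).le y
  obtain ⟨i1, h1⟩ := dotProduct_polarFactor_mulVec hd hQ.posDef u v
  obtain ⟨i2, h2⟩ := dotProduct_polarFactor_mulVec hd hQ'.posDef u v
  rw [h1, h2, ← mul_sub]
  congr 1
  rw [eq_sub_iff_add_eq, ← eq_sub_iff_add_eq', ← integral_sub i1 i2]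
  refine integral_congr_ae (Filter.Eventually.of_forall fun t ↦ ?_)
  simp only
  set R := weightedResolvent d Q t with hR
  have hs : Rᵀ = R := weightedResolvent_transpose hQ t
  have e : weightedResolvent d (Q + n⁻¹ • vecMulVec y y) t =
      R - (n + y ⬝ᵥ R *ᵥ y)⁻¹ • vecMulVec (R *ᵥ y) (R *ᵥ y) := by
    rw [weightedResolvent, ← add_assoc,
      inv_add_smul_vecMulVec (hQ.add_diagonal_sq fun i ↦ t / d i).posDef hn]
    rfl
  have hsw (a b : ι → ℝ) : (R *ᵥ a) ⬝ᵥ b = a ⬝ᵥ R *ᵥ b := by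
    rw [dotProduct_mulVec, ← mulVec_transpose, hs]
  rw [e, sub_mulVec, dotProduct_sub, smul_mulVec, dotProduct_smul, dotProduct_vecMulVec_mulVec,
    sub_sub_cancel, smul_eq_mul, hsw _ y, hsw v y, hsw y v, dotProduct_comm (R *ᵥ y),
    dotProduct_comm v, hsw]
  ring

lemma abs_integral_rankOne_sub_le {ν : Measure (ι → ℝ)} [IsProbabilityMeasure ν] {B : ℝ}
    (hν : ColumnMoments ν B) {R : Matrix ι ι ℝ} (hR0 : ∀ y, 0 ≤ y ⬝ᵥ R *ᵥ y) (htr : 0 ≤ trace R)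
    {n : ℝ} (hn : 0 < n) (a b : ι → ℝ) :
    |∫ y, (a ⬝ᵥ y) * (b ⬝ᵥ y) / (n + y ⬝ᵥ R *ᵥ y) ∂ν - (a ⬝ᵥ b) / (n + trace R)| ≤
      2 * B * vecNorm a * vecNorm b * √(frobSq R) / n ^ 2 := by
  have hi1 : Integrable (fun y ↦ (a ⬝ᵥ y) * (b ⬝ᵥ y) / (n + y ⬝ᵥ R *ᵥ y)) ν := by
    refine ((hν.integrable_mul a b).norm.const_mul n⁻¹).mono' ?_
      (Filter.Eventually.of_forall fun y ↦ ?_)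
    · refine Measurable.aestronglyMeasurable ?_
      fun_prop
    · have h1 := hR0 y
      rw [norm_div, Real.norm_eq_abs (n + _), abs_of_pos (by positivity), div_eq_inv_mul]
      gcongr
      linarith
  have hi2 : Integrable (fun y ↦ (a ⬝ᵥ y) * (b ⬝ᵥ y) / (n + trace R)) ν :=
    (hν.integrable_mul a b).div_const _
  have e : (a ⬝ᵥ b) / (n + trace R) = ∫ y, (a ⬝ᵥ y) * (b ⬝ᵥ y) / (n + trace R) ∂ν := by
    rw [integral_div, hν.integral_mul]
  rw [e, ← integral_sub hi1 hi2]
  have hB := hν.one_le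
  have hF := frobSq_nonneg R
  have sqi : Integrable (fun y ↦ ((a ⬝ᵥ y) * (b ⬝ᵥ y)) ^ 2) ν := by
    simpa only [dotProduct_vecMulVec_mulVec] using hν.integrable_quad_sq (vecMulVec a b)
  have hCS : ∫ y, |(a ⬝ᵥ y) * (b ⬝ᵥ y) * (y ⬝ᵥ R *ᵥ y - trace R)| ∂ν ≤
      (2 * √B * vecNorm a * vecNorm b) * (√B * √(frobSq R)) := by
    have va := vecNorm_nonneg a
    have vb := vecNorm_nonneg b
    refine integral_abs_mul_le sqi (hν.integrable_quad_sub_sq R _) (by fun_prop) (by fun_prop)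
      (by positivity) (by positivity) ?_ ?_
    · refine (hν.integral_mul_sq_le a b).trans (le_of_eq ?_)
      rw [mul_pow, mul_pow, mul_pow, Real.sq_sqrt (by linarith), vecNorm_sq, vecNorm_sq]
      ring
    · refine (hν.integral_quad R).trans (le_of_eq ?_)
      rw [mul_pow, Real.sq_sqrt (by linarith), Real.sq_sqrt hF]
  have hbd : ∀ y, ‖(a ⬝ᵥ y) * (b ⬝ᵥ y) / (n + y ⬝ᵥ R *ᵥ y) -
      (a ⬝ᵥ y) * (b ⬝ᵥ y) / (n + trace R)‖ ≤
      |(a ⬝ᵥ y) * (b ⬝ᵥ y) * (y ⬝ᵥ R *ᵥ y - trace R)| / n ^ 2 := fun y ↦ by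
    have h1 := hR0 y
    have p1 : 0 < n + y ⬝ᵥ R *ᵥ y := by positivity
    have p2 : 0 < n + trace R := by positivity
    have e2 : (a ⬝ᵥ y) * (b ⬝ᵥ y) / (n + y ⬝ᵥ R *ᵥ y) - (a ⬝ᵥ y) * (b ⬝ᵥ y) / (n + trace R) =
        -((a ⬝ᵥ y) * (b ⬝ᵥ y) * (y ⬝ᵥ R *ᵥ y - trace R)) /
          ((n + y ⬝ᵥ R *ᵥ y) * (n + trace R)) := by
      field_simp
      ring
    rw [e2, norm_div, norm_neg, Real.norm_eq_abs, Real.norm_eq_abs, abs_of_pos (mul_pos p1 p2), sq]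
    gcongr <;> linarith
  have hInt : Integrable (fun y ↦ |(a ⬝ᵥ y) * (b ⬝ᵥ y) * (y ⬝ᵥ R *ᵥ y - trace R)| / n ^ 2) ν := by
    refine Integrable.div_const ?_ _
    refine Integrable.abs ?_
    refine (sqi.add (hν.integrable_quad_sub_sq R (trace R))).mono' (by fun_prop)
      (Filter.Eventually.of_forall fun y ↦ ?_)
    simp only [Pi.add_apply]
    rw [Real.norm_eq_abs, abs_le]
    constructor <;> nlinarith [sq_nonneg ((a ⬝ᵥ y) * (b ⬝ᵥ y) - (y ⬝ᵥ R *ᵥ y - trace R)),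
      sq_nonneg ((a ⬝ᵥ y) * (b ⬝ᵥ y) + (y ⬝ᵥ R *ᵥ y - trace R)),
      sq_nonneg ((a ⬝ᵥ y) * (b ⬝ᵥ y)), sq_nonneg (y ⬝ᵥ R *ᵥ y - trace R)]
  refine (norm_integral_le_of_norm_le hInt (Filter.Eventually.of_forall hbd)).trans ?_
  rw [integral_div]
  gcongr
  refine hCS.trans (le_of_eq ?_)
  have := Real.mul_self_sqrt (show 0 ≤ B by linarith)
  linear_combination (2 * vecNorm a * vecNorm b * √(frobSq R)) * this

theorem abs_integral_polarFactor_sub_rankOneCentre_le {d : ι → ℝ} (hd : ∀ i, 0 < d i)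
    {Q : Matrix ι ι ℝ} (hQ : CoerciveMatrix Q)
    {ν : Measure (ι → ℝ)} [IsProbabilityMeasure ν] {B : ℝ}
    (hν : ColumnMoments ν B) {n : ℝ} (hn : 0 < n) (u v : ι → ℝ) :
    |∫ y, u ⬝ᵥ polarFactor d (Q + n⁻¹ • vecMulVec y y) *ᵥ v ∂ν - rankOneCentre d Q n u v| ≤
      12800 * B * (Fintype.card ι + frobSq Q) * vecNorm u * vecNorm v / n ^ 2 := by
  set R := weightedResolvent d Q with hR
  set a : ℝ → ι → ℝ := fun t ↦ R t *ᵥ fun i ↦ (d i)⁻¹ * u i with ha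
  set b : ℝ → ι → ℝ := fun t ↦ R t *ᵥ v with hb
  have hRc : Continuous R := continuous_weightedResolvent hd hQ
  have hac : Continuous a := by fun_prop
  have hbc : Continuous b := by fun_prop
  have hR0 (t : ℝ) (y : ι → ℝ) : 0 ≤ y ⬝ᵥ R t *ᵥ y := weightedResolvent_quad_nonneg hQ t y
  have htr (t : ℝ) : 0 ≤ trace (R t) := (weightedResolvent_posDef hQ t).posSemidef.trace_nonneg
  have hRn (t : ℝ) : ‖R t‖ ≤ 16 := opNorm_weightedResolvent_le hQ t
  have hvb (t : ℝ) : vecNorm (b t) ≤ 16 * vecNorm v :=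
    (vecNorm_mulVec_le _ _).trans (mul_le_mul_of_nonneg_right (hRn t) (vecNorm_nonneg v))
  obtain ⟨α, hαi, hα, hαint⟩ := exists_integrable_bound_weightedResolvent hd hQ u
  change ∀ t, vecNorm (a t) ≤ α t at hα
  have hα0 (t : ℝ) : 0 ≤ α t := (vecNorm_nonneg _).trans (hα t)
  have hB := hν.one_le
  have hv := vecNorm_nonneg v
  have hprod : Integrable (fun p : (ι → ℝ) × ℝ ↦ (a p.2 ⬝ᵥ p.1) * (b p.2 ⬝ᵥ p.1) /
      (n + p.1 ⬝ᵥ R p.2 *ᵥ p.1)) (ν.prod volume) := by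
    have hdom : Integrable (fun p : (ι → ℝ) × ℝ ↦ (n⁻¹ * (16 * vecNorm v) * (p.1 ⬝ᵥ p.1)) * α p.2)
        (ν.prod volume) := (hν.integrable_two.const_mul _).mul_prod hαi
    refine hdom.mono' ?_ (Filter.Eventually.of_forall fun p ↦ ?_)
    · have hc : Continuous fun p : (ι → ℝ) × ℝ ↦ (a p.2 ⬝ᵥ p.1) * (b p.2 ⬝ᵥ p.1) /
          (n + p.1 ⬝ᵥ R p.2 *ᵥ p.1) := by
        refine Continuous.div (by fun_prop) (by fun_prop) fun p ↦ ?_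
        have := hR0 p.2 p.1
        positivity
      exact hc.aestronglyMeasurable
    · have h1 := hR0 p.2 p.1
      rw [norm_div, Real.norm_eq_abs (n + _), abs_of_pos (by positivity), div_eq_inv_mul, norm_mul,
        Real.norm_eq_abs, Real.norm_eq_abs]
      have hn' : (n + p.1 ⬝ᵥ R p.2 *ᵥ p.1)⁻¹ ≤ n⁻¹ := by gcongr; linarith
      have va := vecNorm_nonneg p.1
      have h2 : |a p.2 ⬝ᵥ p.1| ≤ α p.2 * vecNorm p.1 :=
        (abs_dotProduct_le _ _).trans (mul_le_mul_of_nonneg_right (hα _) va)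
      have h3 : |b p.2 ⬝ᵥ p.1| ≤ 16 * vecNorm v * vecNorm p.1 :=
        (abs_dotProduct_le _ _).trans (mul_le_mul_of_nonneg_right (hvb _) va)
      have hα' := hα0 p.2
      calc _ ≤ n⁻¹ * ((α p.2 * vecNorm p.1) * (16 * vecNorm v * vecNorm p.1)) := by gcongr
        _ = n⁻¹ * (16 * vecNorm v) * vecNorm p.1 ^ 2 * α p.2 := by ring
        _ = _ := by rw [vecNorm_sq]
  have hG : Integrable fun t ↦ (a t ⬝ᵥ b t) / (n + trace (R t)) := by
    refine (hαi.const_mul (n⁻¹ * (16 * vecNorm v))).mono' ?_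
      (Filter.Eventually.of_forall fun t ↦ ?_)
    · have hc : Continuous fun t ↦ (a t ⬝ᵥ b t) / (n + trace (R t)) := by
        refine Continuous.div (by fun_prop) (by fun_prop) fun t ↦ ?_
        have := htr t
        positivity
      exact hc.aestronglyMeasurable
    · have h1 := htr t
      rw [norm_div, Real.norm_eq_abs (n + _), abs_of_pos (by positivity), div_eq_inv_mul,
        Real.norm_eq_abs]
      have hn' : (n + trace (R t))⁻¹ ≤ n⁻¹ := by gcongr; linarith
      have h2 : |a t ⬝ᵥ b t| ≤ α t * (16 * vecNorm v) :=
        (abs_dotProduct_le _ _).trans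
          (mul_le_mul (hα _) (hvb _) (vecNorm_nonneg _) (hα0 t))
      have hα' := hα0 t
      calc _ ≤ n⁻¹ * (α t * (16 * vecNorm v)) := by gcongr
        _ = _ := by ring
  have hswap := integral_integral_swap (f := fun (y : ι → ℝ) t ↦ (a t ⬝ᵥ y) * (b t ⬝ᵥ y) /
      (n + y ⬝ᵥ R t *ᵥ y)) hprod
  have hF : Integrable fun t ↦ ∫ y, (a t ⬝ᵥ y) * (b t ⬝ᵥ y) / (n + y ⬝ᵥ R t *ᵥ y) ∂ν :=
    hprod.integral_prod_right
  simp_rw [dotProduct_polarFactor_add_smul_vecMulVec hd hQ hn u v, rankOneCentre]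
  rw [integral_sub (integrable_const _) (hprod.integral_prod_left.const_mul _), integral_const_mul,
    hswap, integral_const]
  simp only [probReal_univ, one_smul]
  rw [sub_sub_sub_cancel_left, ← mul_sub, ← integral_sub hG hF, abs_mul,
    abs_of_pos (inv_pos.2 Real.pi_pos)]
  have hfR (t : ℝ) : √(frobSq (R t)) ≤ 16 * √(Fintype.card ι) := by
    refine Real.sqrt_le_iff.2 ⟨by positivity, ?_⟩
    rw [mul_pow, Real.sq_sqrt (Nat.cast_nonneg _), mul_comm]
    refine (frobSq_le_card_mul _).trans ?_
    gcongr
    exact hRn t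
  have hkey (t : ℝ) : ‖(a t ⬝ᵥ b t) / (n + trace (R t)) -
      ∫ y, (a t ⬝ᵥ y) * (b t ⬝ᵥ y) / (n + y ⬝ᵥ R t *ᵥ y) ∂ν‖ ≤
      (512 * B * vecNorm v * √(Fintype.card ι) / n ^ 2) * α t := by
    rw [Real.norm_eq_abs, abs_sub_comm]
    refine (abs_integral_rankOne_sub_le hν (hR0 t) (htr t) hn (a t) (b t)).trans ?_
    have hα' := hα0 t
    have h3 := vecNorm_nonneg (b t)
    calc 2 * B * vecNorm (a t) * vecNorm (b t) * √(frobSq (R t)) / n ^ 2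
        ≤ 2 * B * α t * (16 * vecNorm v) * (16 * √(Fintype.card ι)) / n ^ 2 := by
          gcongr
          exacts [hα t, hvb t, hfR t]
      _ = _ := by ring
  have hfin := norm_integral_le_of_norm_le (hαi.const_mul _) (Filter.Eventually.of_forall hkey)
  rw [integral_const_mul, Real.norm_eq_abs] at hfin
  have hpi := Real.pi_pos
  calc _ ≤ π⁻¹ * ((512 * B * vecNorm v * √(Fintype.card ι) / n ^ 2) * ∫ t, α t) := by gcongr
    _ = π⁻¹ * ((512 * B * vecNorm v / n ^ 2) * (√(Fintype.card ι) * ∫ t, α t)) := by ring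
    _ ≤ π⁻¹ * ((512 * B * vecNorm v / n ^ 2) *
        (π * (25 * (Fintype.card ι + frobSq Q) * vecNorm u))) := by gcongr
    _ = _ := by field_simp; ring

end OneColumn

section Replacement

variable {ι κ : Type*} [Fintype ι] [DecidableEq ι] [Fintype κ] [DecidableEq κ]

/-- The matrix `n⁻¹ ∑ₖ yₖ yₖᵀ`. -/
def scaledGram (n : ℝ) (Y : κ → ι → ℝ) : Matrix ι ι ℝ := ∑ k, n⁻¹ • vecMulVec (Y k) (Y k)

lemma scaledGram_transpose (n : ℝ) (Y : κ → ι → ℝ) : (scaledGram n Y)ᵀ = scaledGram n Y := by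
  simp only [scaledGram, transpose_sum, transpose_smul, transpose_vecMulVec]

lemma scaledGram_quad (n : ℝ) (Y : κ → ι → ℝ) (u v : ι → ℝ) :
    u ⬝ᵥ scaledGram n Y *ᵥ v = n⁻¹ * ∑ k, (Y k ⬝ᵥ u) * (Y k ⬝ᵥ v) := by
  simp only [scaledGram, sum_mulVec, dotProduct_sum, smul_mulVec, dotProduct_smul,
    dotProduct_vecMulVec_mulVec, smul_eq_mul, Finset.mul_sum]

lemma scaledGram_quad_nonneg {n : ℝ} (hn : 0 ≤ n) (Y : κ → ι → ℝ) (w : ι → ℝ) :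
    0 ≤ w ⬝ᵥ scaledGram n Y *ᵥ w := by
  rw [scaledGram_quad]
  exact mul_nonneg (inv_nonneg.2 hn) (Finset.sum_nonneg fun k _ ↦ mul_self_nonneg _)

lemma scaledGram_mulVec (n : ℝ) (O : Matrix ι ι ℝ) (Y : κ → ι → ℝ) :
    scaledGram n (fun k ↦ O *ᵥ Y k) = O * scaledGram n Y * Oᵀ := by
  simp only [scaledGram, Matrix.mul_sum, Matrix.sum_mul, Matrix.mul_smul, Matrix.smul_mul]
  refine Finset.sum_congr rfl fun k _ ↦ ?_
  rw [mul_vecMulVec, vecMulVec_mul, vecMul_transpose]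

lemma scaledGram_eq_mul_transpose {n : ℝ} (hn : 0 ≤ n) (Y : κ → ι → ℝ) :
    scaledGram n Y = (of fun i k ↦ (√n)⁻¹ * Y k i) * (of fun i k ↦ (√n)⁻¹ * Y k i)ᵀ := by
  ext i j
  simp only [scaledGram, Matrix.sum_apply, Matrix.smul_apply, vecMulVec_apply, Matrix.mul_apply,
    transpose_apply, of_apply, smul_eq_mul]
  refine Finset.sum_congr rfl fun k _ ↦ ?_
  have : (√n)⁻¹ * (√n)⁻¹ = n⁻¹ := by rw [← mul_inv, Real.mul_self_sqrt hn]
  rw [← this]; ring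

lemma CoerciveMatrix.add_scaledGram {Q : Matrix ι ι ℝ} (hQ : CoerciveMatrix Q) {n : ℝ} (hn : 0 ≤ n)
    (Y : κ → ι → ℝ) : CoerciveMatrix (Q + scaledGram n Y) :=
  hQ.add (scaledGram_transpose n Y) (scaledGram_quad_nonneg hn Y)

lemma opNorm_polarFactor_le {d : ι → ℝ} (hd : ∀ i, 0 < d i) {Q : Matrix ι ι ℝ}
    (hQ : CoerciveMatrix Q) : ‖polarFactor d Q‖ ≤ 4 := by
  obtain ⟨P, -, -, h⟩ := isPolarFactor_polarFactor hd hQ.posDef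
  exact opNorm_le_four_of_congr_eq_one hQ.le_quad h

lemma abs_polarFactor_sub_le {d : ι → ℝ} (hd : ∀ i, 0 < d i) {Q : Matrix ι ι ℝ}
    (hQ : CoerciveMatrix Q) {n : ℝ} (hn : 0 ≤ n) (u v : ι → ℝ) (Y Y' : κ → ι → ℝ) :
    |u ⬝ᵥ polarFactor d (Q + scaledGram n Y) *ᵥ v - u ⬝ᵥ polarFactor d (Q + scaledGram n Y') *ᵥ v| ≤
      32 * (√n)⁻¹ * (vecNorm u * vecNorm v) * √(∑ k, ∑ i, (Y k i - Y' k i) ^ 2) := by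
  have h1 := isPolarFactor_polarFactor hd (hQ.add_scaledGram hn Y).posDef
  have h2 := isPolarFactor_polarFactor hd (hQ.add_scaledGram hn Y').posDef
  set T := polarFactor d (Q + scaledGram n Y)
  set T' := polarFactor d (Q + scaledGram n Y')
  rw [scaledGram_eq_mul_transpose hn] at h1 h2
  have h3 := (opNorm_sq_le_frobSq (T - T')).trans (frobSq_sub_le_of_isPolarFactor hQ.le_quad h1 h2)
  have e : frobSq ((of fun i k ↦ (√n)⁻¹ * Y k i) - (of fun i k ↦ (√n)⁻¹ * Y' k i)) =
      (√n)⁻¹ ^ 2 * ∑ k, ∑ i, (Y k i - Y' k i) ^ 2 := by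
    rw [← frobSq_transpose]
    simp only [frobSq, Finset.mul_sum, transpose_apply, Matrix.sub_apply, of_apply]
    exact Finset.sum_congr rfl fun k _ ↦ Finset.sum_congr rfl fun i _ ↦ by ring
  have h0 : 0 ≤ ∑ k, ∑ i, (Y k i - Y' k i) ^ 2 := by positivity
  have h4 : ‖T - T'‖ ≤ 32 * (√n)⁻¹ * √(∑ k, ∑ i, (Y k i - Y' k i) ^ 2) := by
    refine abs_le_of_sq_le_sq' ?_ (by positivity) |>.2
    rw [mul_pow, mul_pow, Real.sq_sqrt h0]
    rw [e] at h3
    linarith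
  rw [← dotProduct_sub, ← sub_mulVec]
  refine (abs_dotProduct_mulVec_le _ u v).trans ?_
  have := mul_le_mul_of_nonneg_right h4 (mul_nonneg (vecNorm_nonneg u) (vecNorm_nonneg v))
  linarith

lemma abs_dotProduct_polarFactor_le {d : ι → ℝ} (hd : ∀ i, 0 < d i) {Q : Matrix ι ι ℝ}
    (hQ : CoerciveMatrix Q) (u v : ι → ℝ) :
    |u ⬝ᵥ polarFactor d Q *ᵥ v| ≤ 4 * vecNorm u * vecNorm v := by
  refine (abs_dotProduct_mulVec_le _ u v).trans ?_
  have := vecNorm_nonneg u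
  have := vecNorm_nonneg v
  gcongr
  exact opNorm_polarFactor_le hd hQ

lemma continuous_dotProduct_polarFactor {d : ι → ℝ} (hd : ∀ i, 0 < d i) {Q : Matrix ι ι ℝ}
    (hQ : CoerciveMatrix Q) {n : ℝ} (hn : 0 ≤ n) (u v : ι → ℝ) :
    Continuous fun Y : κ → ι → ℝ ↦ u ⬝ᵥ polarFactor d (Q + scaledGram n Y) *ᵥ v := by
  refine continuous_iff_continuousAt.2 fun Y₀ ↦ ?_
  rw [ContinuousAt, tendsto_iff_dist_tendsto_zero]
  refine squeeze_zero (fun _ ↦ dist_nonneg) (fun Y ↦ abs_polarFactor_sub_le hd hQ hn u v Y Y₀) ?_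
  have : Continuous fun Y : κ → ι → ℝ ↦ 32 * (√n)⁻¹ * (vecNorm u * vecNorm v) *
      √(∑ k, ∑ i, (Y k i - Y₀ k i) ^ 2) := by fun_prop
  simpa using this.tendsto Y₀

lemma map_update_prod {ν ν' : κ → Measure (ι → ℝ)} [∀ k, IsProbabilityMeasure (ν k)]
    [∀ k, IsProbabilityMeasure (ν' k)] {k : κ} (h : ∀ j, j ≠ k → ν j = ν' j) :
    ((Measure.pi ν).prod (ν' k)).map (fun p ↦ Function.update p.1 k p.2) = Measure.pi ν' := by
  have hm : Measurable fun p : (κ → ι → ℝ) × (ι → ℝ) ↦ Function.update p.1 k p.2 := by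
    fun_prop
  refine (Measure.pi_eq fun s hs ↦ ?_).symm
  rw [Measure.map_apply hm (MeasurableSet.univ_pi hs)]
  have e : (fun p : (κ → ι → ℝ) × (ι → ℝ) ↦ Function.update p.1 k p.2) ⁻¹' Set.univ.pi s =
      (Set.univ.pi (Function.update s k Set.univ)) ×ˢ (s k) := by
    ext p
    simp only [Set.mem_preimage, Set.mem_pi, Set.mem_univ, true_implies, Set.mem_prod]
    constructor
    · intro hp
      refine ⟨fun j ↦ ?_, by simpa using hp k⟩
      rcases eq_or_ne j k with rfl | hj
      · simp
      · simpa [hj] using hp j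
    · rintro ⟨h1, h2⟩ j
      rcases eq_or_ne j k with rfl | hj
      · simpa using h2
      · simpa [hj] using h1 j
  rw [e, Measure.prod_prod, Measure.pi_pi,
    ← Finset.prod_erase_mul _ _ (Finset.mem_univ k),
    ← Finset.prod_erase_mul _ _ (Finset.mem_univ k)]
  simp only [Function.update_self, measure_univ, mul_one]
  congr 1
  refine Finset.prod_congr rfl fun j hj ↦ ?_
  have hj' := Finset.ne_of_mem_erase hj
  rw [Function.update_of_ne hj', h j hj']

lemma integral_update {ν ν' : κ → Measure (ι → ℝ)} [∀ k, IsProbabilityMeasure (ν k)]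
    [∀ k, IsProbabilityMeasure (ν' k)] {k : κ} (h : ∀ j, j ≠ k → ν j = ν' j)
    {f : (κ → ι → ℝ) → ℝ} (hf : Integrable f (Measure.pi ν')) :
    Integrable (fun X ↦ ∫ y, f (Function.update X k y) ∂(ν' k)) (Measure.pi ν) ∧
    ∫ X, f X ∂(Measure.pi ν') = ∫ X, ∫ y, f (Function.update X k y) ∂(ν' k) ∂(Measure.pi ν) := by
  have hm : Measurable fun p : (κ → ι → ℝ) × (ι → ℝ) ↦ Function.update p.1 k p.2 := by
    fun_prop
  have hi : Integrable (fun p : (κ → ι → ℝ) × (ι → ℝ) ↦ f (Function.update p.1 k p.2))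
      ((Measure.pi ν).prod (ν' k)) := by
    rw [← map_update_prod h] at hf
    exact hf.comp_measurable hm
  refine ⟨hi.integral_prod_left, ?_⟩
  rw [← integral_prod _ hi, ← map_update_prod h, integral_map hm.aemeasurable]
  rw [map_update_prod h]
  exact hf.aestronglyMeasurable

section Moments

variable {ν : κ → Measure (ι → ℝ)} [∀ k, IsProbabilityMeasure (ν k)] {B : ℝ}

lemma integrable_dotProduct_sq (hν : ∀ k, ColumnMoments (ν k) B) (j l : κ) :
    Integrable (fun X : κ → ι → ℝ ↦ (X j ⬝ᵥ X l) ^ 2) (Measure.pi ν) := by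
  have h (k : κ) : Integrable (fun X : κ → ι → ℝ ↦ (X k ⬝ᵥ X k) ^ 2) (Measure.pi ν) :=
    (measurePreserving_eval ν k).integrable_comp_of_integrable (hν k).integrable_four
  refine ((h j).add (h l)).mono' (by fun_prop) (Filter.Eventually.of_forall fun X ↦ ?_)
  have h1 := abs_dotProduct_le (X j) (X l)
  have h2 := pow_le_pow_left₀ (abs_nonneg _) h1 2
  rw [mul_pow, vecNorm_sq, vecNorm_sq, sq_abs] at h2
  rw [Real.norm_eq_abs, abs_of_nonneg (sq_nonneg _)]
  simp only [Pi.add_apply]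
  nlinarith [sq_nonneg (X j ⬝ᵥ X j - X l ⬝ᵥ X l), sq_nonneg (X j ⬝ᵥ X j), sq_nonneg (X l ⬝ᵥ X l)]

lemma integral_dotProduct_sq (hν : ∀ k, ColumnMoments (ν k) B) {j l : κ} (h : j ≠ l) :
    ∫ X, (X j ⬝ᵥ X l) ^ 2 ∂(Measure.pi ν) = Fintype.card ι := by
  rw [(integral_update (k := l) (fun _ _ ↦ rfl) (integrable_dotProduct_sq hν j l)).2]
  simp only [Function.update_self, Function.update_of_ne h, sq, (hν l).integral_mul]
  have := integral_map (μ := Measure.pi ν) (φ := fun X ↦ X j)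
    (measurePreserving_eval ν j).measurable.aemeasurable (f := fun x ↦ x ⬝ᵥ x) (by fun_prop)
  rw [← this]
  rw [show (fun X : κ → ι → ℝ ↦ X j) = Function.eval j from rfl,
    (measurePreserving_eval ν j).map_eq, (hν j).integral_self]

lemma integral_dotProduct_self_sq_le (hν : ∀ k, ColumnMoments (ν k) B) (j : κ) :
    ∫ X, (X j ⬝ᵥ X j) ^ 2 ∂(Measure.pi ν) ≤ 2 * B * Fintype.card ι + 2 * Fintype.card ι ^ 2 := by
  have := integral_map (μ := Measure.pi ν) (φ := Function.eval j)
    (measurePreserving_eval ν j).measurable.aemeasurable (f := fun x ↦ (x ⬝ᵥ x) ^ 2) (by fun_prop)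
  simp only [Function.eval] at this
  rw [← this]
  rw [(measurePreserving_eval ν j).map_eq]
  have h := (hν j).integral_quad_sq_le 1
  rw [frobSq_eq_trace, transpose_one, mul_one, trace_one] at h
  simp only [one_mulVec] at h
  linarith

lemma frobSq_scaledGram (n : ℝ) (Y : κ → ι → ℝ) :
    frobSq (scaledGram n Y) = (n ^ 2)⁻¹ * ∑ j, ∑ l, (Y j ⬝ᵥ Y l) ^ 2 := by
  rw [frobSq_eq_trace, scaledGram_transpose]
  simp only [scaledGram, Matrix.sum_mul, trace_sum, Matrix.smul_mul,
    Matrix.mul_smul, trace_smul, smul_eq_mul, Finset.mul_sum, vecMulVec_mul_vecMulVec,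
    trace_vecMulVec]
  refine Finset.sum_congr rfl fun j _ ↦ Finset.sum_congr rfl fun l _ ↦ ?_
  simp [dotProduct_comm]
  ring

lemma integral_frobSq_scaledGram_le (hν : ∀ k, ColumnMoments (ν k) B) {n : ℝ} (hn : 0 < n)
    (hκ : (Fintype.card κ : ℝ) ≤ n) (hι : (Fintype.card ι : ℝ) ≤ n) (hB : B ≤ n) :
    Integrable (fun X : κ → ι → ℝ ↦ frobSq (scaledGram n X)) (Measure.pi ν) ∧
    ∫ X, frobSq (scaledGram n X) ∂(Measure.pi ν) ≤ 5 * Fintype.card ι := by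
  simp only [frobSq_scaledGram]
  have hi (j l : κ) := integrable_dotProduct_sq hν j l
  refine ⟨(integrable_finsetSum _ fun j _ ↦ integrable_finsetSum _ fun l _ ↦ hi j l).const_mul _,
    ?_⟩
  rw [integral_const_mul, integral_finsetSum _ fun j _ ↦ integrable_finsetSum _ fun l _ ↦ hi j l]
  simp_rw [fun j ↦ integral_finsetSum (Finset.univ) fun l _ ↦ hi j l]
  set r : ℝ := (Fintype.card ι : ℝ)
  set N : ℝ := (Fintype.card κ : ℝ) with hN
  have hr : 0 ≤ r := Nat.cast_nonneg _
  have hN0 : 0 ≤ N := Nat.cast_nonneg _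
  have h1 (j : κ) : ∑ l, ∫ X, (X j ⬝ᵥ X l) ^ 2 ∂(Measure.pi ν) ≤ 5 * n * r := by
    rw [← Finset.sum_erase_add _ _ (Finset.mem_univ j)]
    have h2 : ∑ l ∈ Finset.univ.erase j, ∫ X, (X j ⬝ᵥ X l) ^ 2 ∂(Measure.pi ν) ≤ N * r := by
      rw [Finset.sum_congr rfl fun l hl ↦
        integral_dotProduct_sq hν (Finset.ne_of_mem_erase hl).symm, Finset.sum_const, nsmul_eq_mul]
      refine mul_le_mul_of_nonneg_right ?_ hr
      exact Nat.cast_le.2 (Finset.card_le_univ _)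
    have h3 := integral_dotProduct_self_sq_le hν j
    nlinarith [mul_le_mul_of_nonneg_right hB hr, mul_le_mul_of_nonneg_right hι hr,
      mul_le_mul_of_nonneg_right hκ hr]
  have h2 : ∑ j, ∑ l, ∫ X, (X j ⬝ᵥ X l) ^ 2 ∂(Measure.pi ν) ≤ N * (5 * n * r) := by
    refine (Finset.sum_le_sum fun j _ ↦ h1 j).trans (le_of_eq ?_)
    rw [Finset.sum_const, nsmul_eq_mul, hN, Finset.card_univ]
  rw [inv_mul_le_iff₀ (by positivity)]
  refine h2.trans ?_
  have : N * (5 * n * r) ≤ n * (5 * n * r) := by gcongr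
  linarith

end Moments

lemma scaledGram_update (n : ℝ) (X : κ → ι → ℝ) (k : κ) (y : ι → ℝ) :
    scaledGram n (Function.update X k y) =
      scaledGram n (Function.update X k 0) + n⁻¹ • vecMulVec y y := by
  simp only [scaledGram]
  rw [← Finset.sum_erase_add _ _ (Finset.mem_univ k), ← Finset.sum_erase_add _ (fun j ↦
    n⁻¹ • vecMulVec (Function.update X k 0 j) (Function.update X k 0 j)) (Finset.mem_univ k)]
  simp only [Function.update_self]
  have (z : ι → ℝ) : ∑ j ∈ Finset.univ.erase k,
      n⁻¹ • vecMulVec (Function.update X k z j) (Function.update X k z j) =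
      ∑ j ∈ Finset.univ.erase k, n⁻¹ • vecMulVec (X j) (X j) :=
    Finset.sum_congr rfl fun j hj ↦ by rw [Function.update_of_ne (Finset.ne_of_mem_erase hj)]
  rw [this, this]
  simp

lemma frobSq_scaledGram_update_zero_le {n : ℝ} (X : κ → ι → ℝ) (k : κ) :
    frobSq (scaledGram n (Function.update X k 0)) ≤ frobSq (scaledGram n X) := by
  rw [frobSq_scaledGram, frobSq_scaledGram]
  refine mul_le_mul_of_nonneg_left (Finset.sum_le_sum fun j _ ↦ Finset.sum_le_sum fun l _ ↦ ?_)
    (by positivity)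
  rcases eq_or_ne j k with rfl | hj
  · simp [sq_nonneg]
  rcases eq_or_ne l k with rfl | hl
  · simp [sq_nonneg]
  rw [Function.update_of_ne hj, Function.update_of_ne hl]

section Swap

variable {d : ι → ℝ} {Q : Matrix ι ι ℝ} {B n : ℝ} (u v : ι → ℝ)

lemma abs_integral_polarFactor_sub_le_of_agree (hd : ∀ i, 0 < d i) (hQ : CoerciveMatrix Q)
    (hn : 0 < n) (hκ : (Fintype.card κ : ℝ) ≤ n) (hι : (Fintype.card ι : ℝ) ≤ n) (hB : B ≤ n)
    {ν ν' : κ → Measure (ι → ℝ)} [∀ k, IsProbabilityMeasure (ν k)]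
    [∀ k, IsProbabilityMeasure (ν' k)] (hν : ∀ k, ColumnMoments (ν k) B)
    (hν' : ∀ k, ColumnMoments (ν' k) B) {k : κ} (h : ∀ j, j ≠ k → ν j = ν' j) :
    |∫ X, u ⬝ᵥ polarFactor d (Q + scaledGram n X) *ᵥ v ∂(Measure.pi ν) -
      ∫ X, u ⬝ᵥ polarFactor d (Q + scaledGram n X) *ᵥ v ∂(Measure.pi ν')| ≤
      25600 * B * (11 * Fintype.card ι + 2 * frobSq Q) * vecNorm u * vecNorm v / n ^ 2 := by
  have hInt (ρ : Measure (κ → ι → ℝ)) [IsProbabilityMeasure ρ] :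
      Integrable (fun X ↦ u ⬝ᵥ polarFactor d (Q + scaledGram n X) *ᵥ v) ρ :=
    Integrable.of_bound (continuous_dotProduct_polarFactor hd hQ hn.le u v).aestronglyMeasurable
      (4 * vecNorm u * vecNorm v) (Filter.Eventually.of_forall fun X ↦
        abs_dotProduct_polarFactor_le hd (hQ.add_scaledGram hn.le X) u v)
  obtain ⟨i1, e1⟩ := integral_update (k := k) (ν := ν) (fun _ _ ↦ rfl) (hInt (Measure.pi ν))
  obtain ⟨i2, e2⟩ := integral_update (k := k) h (hInt (Measure.pi ν'))
  rw [e1, e2, ← integral_sub i1 i2]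
  obtain ⟨iF, hF⟩ := integral_frobSq_scaledGram_le hν hn hκ hι hB
  have hB1 := (hν k).one_le
  have hu := vecNorm_nonneg u
  have hv := vecNorm_nonneg v
  set c := 25600 * B * vecNorm u * vecNorm v / n ^ 2 with hc
  have hc0 : 0 ≤ c := by positivity
  set r : ℝ := (Fintype.card ι : ℝ) with hr
  have hbd (X : κ → ι → ℝ) :
      ‖∫ y, u ⬝ᵥ polarFactor d (Q + scaledGram n (Function.update X k y)) *ᵥ v ∂(ν k) -
        ∫ y, u ⬝ᵥ polarFactor d (Q + scaledGram n (Function.update X k y)) *ᵥ v ∂(ν' k)‖ ≤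
      c * (r + 2 * frobSq Q) + (c * 2) * frobSq (scaledGram n X) := by
    set Q' := Q + scaledGram n (Function.update X k 0) with hQ'
    have e (y : ι → ℝ) : Q + scaledGram n (Function.update X k y) = Q' + n⁻¹ • vecMulVec y y := by
      rw [scaledGram_update, hQ', add_assoc]
    simp only [e]
    have hc' : CoerciveMatrix Q' := hQ.add_scaledGram hn.le _
    have a1 := abs_integral_polarFactor_sub_rankOneCentre_le hd hc' (hν k) hn u v
    have a2 := abs_integral_polarFactor_sub_rankOneCentre_le hd hc' (hν' k) hn u v
    have a3 : frobSq Q' ≤ 2 * frobSq Q + 2 * frobSq (scaledGram n X) :=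
      (frobSq_add_le _ _).trans (by
        have := frobSq_scaledGram_update_zero_le (n := n) X k
        linarith)
    have a4 := mul_le_mul_of_nonneg_left a3 hc0
    rw [Real.norm_eq_abs]
    have a5 : 12800 * B * (r + frobSq Q') * vecNorm u * vecNorm v / n ^ 2 =
      c / 2 * (r + frobSq Q') := by rw [hc]; ring
    rw [a5] at a1 a2
    rw [abs_le] at a1 a2 ⊢
    constructor <;> nlinarith
  refine (norm_integral_le_of_norm_le ((integrable_const _).add (iF.const_mul (c * 2)))
    (Filter.Eventually.of_forall hbd)).trans ?_
  simp only [Pi.add_apply]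
  rw [integral_add (integrable_const _) (iF.const_mul (c * 2)), integral_const, integral_const_mul]
  simp only [probReal_univ, one_smul]
  have := mul_le_mul_of_nonneg_left hF (mul_nonneg hc0 zero_le_two)
  calc _ ≤ c * (11 * r + 2 * frobSq Q) := by linarith
    _ = _ := by rw [hc]; ring

/-- Replacing all the independent columns by others with the same first two moments barely changes
the mean of the polar factor. -/
theorem abs_integral_polarFactor_sub_le (hd : ∀ i, 0 < d i) (hQ : CoerciveMatrix Q)
    (hn : 0 < n) (hκ : (Fintype.card κ : ℝ) ≤ n) (hι : (Fintype.card ι : ℝ) ≤ n) (hB : B ≤ n)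
    {ν ν' : κ → Measure (ι → ℝ)} [∀ k, IsProbabilityMeasure (ν k)]
    [∀ k, IsProbabilityMeasure (ν' k)] (hν : ∀ k, ColumnMoments (ν k) B)
    (hν' : ∀ k, ColumnMoments (ν' k) B) (hB0 : 0 ≤ B) :
    |∫ X, u ⬝ᵥ polarFactor d (Q + scaledGram n X) *ᵥ v ∂(Measure.pi ν) -
      ∫ X, u ⬝ᵥ polarFactor d (Q + scaledGram n X) *ᵥ v ∂(Measure.pi ν')| ≤
      25600 * B * (11 * Fintype.card ι + 2 * frobSq Q) * vecNorm u * vecNorm v / n := by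
  set c := 25600 * B * (11 * Fintype.card ι + 2 * frobSq Q) * vecNorm u * vecNorm v with hc
  have hu := vecNorm_nonneg u
  have hv := vecNorm_nonneg v
  have hF := frobSq_nonneg Q
  have hc0 : 0 ≤ c := by positivity
  have key (s : Finset κ) :
      |∫ X, u ⬝ᵥ polarFactor d (Q + scaledGram n X) *ᵥ v ∂(Measure.pi ν) -
        ∫ X, u ⬝ᵥ polarFactor d (Q + scaledGram n X) *ᵥ v
          ∂(Measure.pi fun k ↦ if k ∈ s then ν' k else ν k)| ≤ s.card * (c / n ^ 2) := by
    induction s using Finset.induction_on with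
    | empty => simp
    | insert k s hk ih =>
      have i1 (s : Finset κ) (j : κ) : IsProbabilityMeasure (if j ∈ s then ν' j else ν j) := by
        split_ifs <;> infer_instance
      have m1 (s : Finset κ) (j : κ) : ColumnMoments (if j ∈ s then ν' j else ν j) B := by
        split_ifs
        exacts [hν' j, hν j]
      have := abs_integral_polarFactor_sub_le_of_agree (u := u) (v := v) hd hQ hn hκ hι hB
        (m1 s) (m1 (insert k s)) (k := k) fun j hj ↦ by simp [Finset.mem_insert, hj]
      rw [Finset.card_insert_of_notMem hk]
      push_cast
      rw [abs_le] at *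
      constructor <;> linarith
  have h := key Finset.univ
  simp only [Finset.mem_univ, if_true] at h
  refine h.trans ?_
  rw [Finset.card_univ]
  calc (Fintype.card κ : ℝ) * (c / n ^ 2) ≤ n * (c / n ^ 2) := by gcongr
    _ = c / n := by field_simp

end Swap

end Replacement

section ProductMoments

variable {ι : Type*} [Fintype ι] [DecidableEq ι] {β : Measure ℝ} [IsProbabilityMeasure β]

lemma integral_pi_eq_zero_of_odd (hβ : MeasurePreserving (fun x : ℝ ↦ -x) β β)
    {f : (ι → ℝ) → ℝ} (m : ι)
    (hf : ∀ x, f (Function.update x m (-x m)) = -f x) :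
    ∫ x, f x ∂(Measure.pi fun _ : ι ↦ β) = 0 := by
  have hmp : MeasurePreserving (fun (x : ι → ℝ) j ↦ (if j = m then -x j else x j))
      (Measure.pi fun _ : ι ↦ β) (Measure.pi fun _ : ι ↦ β) := by
    refine measurePreserving_pi (fun _ ↦ β) (fun _ ↦ β) (f := fun j x ↦ if j = m then -x else x)
      fun j ↦ ?_
    split_ifs
    exacts [hβ, MeasurePreserving.id β]
  have hinv : Function.Involutive (fun (x : ι → ℝ) j ↦ (if j = m then -x j else x j)) := fun x ↦ by
    ext j
    by_cases h : j = m <;> simp [h]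
  have he := hmp.integral_comp
    (MeasurableEquiv.ofInvolutive _ hinv hmp.measurable).measurableEmbedding f
  have e (x : ι → ℝ) : (fun j ↦ if j = m then -x j else x j) = Function.update x m (-x m) := by
    ext j
    by_cases h : j = m
    · subst h; simp
    · simp [h]
  simp only [e, hf, integral_neg] at he
  linarith

lemma integral_pi_eval (f : ℝ → ℝ) (hf : Measurable f) (i : ι) :
    ∫ x : ι → ℝ, f (x i) ∂(Measure.pi fun _ : ι ↦ β) = ∫ x, f x ∂β := by
  have h := measurePreserving_eval (fun _ : ι ↦ β) i
  have := integral_map (μ := Measure.pi fun _ : ι ↦ β) (φ := Function.eval i)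
    h.measurable.aemeasurable (f := f) hf.aestronglyMeasurable
  rw [h.map_eq] at this
  exact this.symm

/-- Independent symmetric coordinates with unit variance. -/
theorem columnMoments_pi (hβ : MeasurePreserving (fun x : ℝ ↦ -x) β β) {m4 : ℝ}
    (h4 : Integrable (fun x : ℝ ↦ x ^ 4) β) (hm2 : ∫ x, x ^ 2 ∂β = 1) (hm4 : ∫ x, x ^ 4 ∂β = m4) :
    ColumnMoments (Measure.pi fun _ : ι ↦ β) (2 * (1 + m4)) := by
  set μ := Measure.pi fun _ : ι ↦ β with hμ
  have hm40 : 0 ≤ m4 := by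
    rw [← hm4]
    exact integral_nonneg fun x ↦ by positivity
  have hi4 (i : ι) : Integrable (fun x : ι → ℝ ↦ x i ^ 4) μ :=
    (measurePreserving_eval (fun _ : ι ↦ β) i).integrable_comp_of_integrable h4
  have hE4 (i : ι) : ∫ x, x i ^ 4 ∂μ = m4 := by
    rw [← hm4]
    exact integral_pi_eval (fun x ↦ x ^ 4) (by fun_prop) i
  have hE2 (i : ι) : ∫ x, x i ^ 2 ∂μ = 1 := by
    rw [← hm2]
    exact integral_pi_eval (fun x ↦ x ^ 2) (by fun_prop) i
  have amgm (a b : ℝ) : |a * b| ≤ a ^ 2 + b ^ 2 := by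
    rw [abs_le]
    constructor <;> nlinarith [sq_nonneg (a + b), sq_nonneg (a - b)]
  have hi22 (i j : ι) : Integrable (fun x : ι → ℝ ↦ x i ^ 2 * x j ^ 2) μ := by
    refine ((hi4 i).add (hi4 j)).mono' (by fun_prop) (Filter.Eventually.of_forall fun x ↦ ?_)
    have := amgm (x i ^ 2) (x j ^ 2)
    simp only [Pi.add_apply, Real.norm_eq_abs]
    linarith
  have hi11 (i j : ι) : Integrable (fun x : ι → ℝ ↦ x i * x j) μ := by
    refine ((hi22 i j).add (integrable_const (1 : ℝ))).mono' (by fun_prop)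
      (Filter.Eventually.of_forall fun x ↦ ?_)
    simp only [Pi.add_apply, Real.norm_eq_abs]
    have := amgm (x i * x j) 1
    rw [mul_one] at this
    nlinarith
  have hi1111 (i j k l : ι) : Integrable (fun x : ι → ℝ ↦ (x i * x j) * (x k * x l)) μ := by
    refine ((hi22 i j).add (hi22 k l)).mono' (by fun_prop) (Filter.Eventually.of_forall fun x ↦ ?_)
    simp only [Pi.add_apply, Real.norm_eq_abs]
    have := amgm (x i * x j) (x k * x l)
    nlinarith
  have hE11 {i j : ι} (h : i ≠ j) : ∫ x, x i * x j ∂μ = 0 :=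
    integral_pi_eq_zero_of_odd hβ i fun x ↦ by
      rw [Function.update_self, Function.update_of_ne h.symm]; ring
  have hE22 {i j : ι} (h : i ≠ j) : ∫ x, x i ^ 2 * x j ^ 2 ∂μ = 1 := by
    have hind : IndepFun (fun x : ι → ℝ ↦ x i ^ 2) (fun x ↦ x j ^ 2) μ := by
      have := iIndepFun_pi (μ := fun _ : ι ↦ β) (X := fun _ x ↦ x ^ 2)
        (fun _ ↦ (by fun_prop))
      exact this.indepFun h
    rw [hind.integral_fun_mul_eq_mul_integral
      (Measurable.aestronglyMeasurable (by fun_prop))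
      (Measurable.aestronglyMeasurable (by fun_prop)), hE2, hE2, one_mul]
  set g : ι × ι → (ι → ℝ) → ℝ := fun p x ↦ x p.1 * x p.2 - (1 : Matrix ι ι ℝ) p.1 p.2 with hg
  have hgi (p q : ι × ι) : Integrable (fun x ↦ g p x * g q x) μ := by
    have := (((hi1111 p.1 p.2 q.1 q.2).sub
      ((hi11 p.1 p.2).mul_const ((1 : Matrix ι ι ℝ) q.1 q.2))).sub
      ((hi11 q.1 q.2).const_mul ((1 : Matrix ι ι ℝ) p.1 p.2))).add
      (integrable_const ((1 : Matrix ι ι ℝ) p.1 p.2 * (1 : Matrix ι ι ℝ) q.1 q.2))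
    refine this.congr (Filter.Eventually.of_forall fun x ↦ ?_)
    simp only [Pi.add_apply, Pi.sub_apply, hg]
    ring
  have hoff {p q : ι × ι} (hp : p.1 ≠ p.2) (h1 : q ≠ p) (h2 : q ≠ p.swap) :
      ∫ x, g p x * g q x ∂μ = 0 := by
    obtain ⟨i, j⟩ := p
    obtain ⟨k, l⟩ := q
    simp only [hg, Prod.swap, ne_eq, Prod.mk.injEq, not_and] at *
    rw [one_apply_ne hp]
    by_cases hi : i ≠ k ∧ i ≠ l
    · refine integral_pi_eq_zero_of_odd hβ i fun x ↦ ?_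
      rw [Function.update_self, Function.update_of_ne (Ne.symm hp),
        Function.update_of_ne hi.1.symm, Function.update_of_ne hi.2.symm]
      ring
    · have hj : j ≠ k ∧ j ≠ l := by grind
      refine integral_pi_eq_zero_of_odd hβ j fun x ↦ ?_
      rw [Function.update_self, Function.update_of_ne hp,
        Function.update_of_ne hj.1.symm, Function.update_of_ne hj.2.symm]
      ring
  have hzero {p q : ι × ι} (h1 : q ≠ p) (h2 : q ≠ p.swap) : ∫ x, g p x * g q x ∂μ = 0 := by
    by_cases hp : p.1 = p.2
    · by_cases hq : q.1 = q.2
      · obtain ⟨i, j⟩ := p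
        obtain ⟨k, l⟩ := q
        simp only at hp hq
        subst hp hq
        have hik : i ≠ k := by rintro rfl; exact h1 rfl
        have e (x : ι → ℝ) : g (i, i) x * g (k, k) x =
            x i ^ 2 * x k ^ 2 - x i * x i - x k * x k + 1 := by
          simp only [hg, one_apply_eq]; ring
        simp only [e]
        have j1 : Integrable (fun x : ι → ℝ ↦ x i ^ 2 * x k ^ 2 - x i * x i) μ :=
          (hi22 i k).sub (hi11 i i)
        have j2 : Integrable (fun x : ι → ℝ ↦ x i ^ 2 * x k ^ 2 - x i * x i - x k * x k) μ :=
          j1.sub (hi11 k k)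
        rw [integral_add j2 (integrable_const _), integral_sub j1 (hi11 k k),
          integral_sub (hi22 i k) (hi11 i i), hE22 hik]
        simp only [← sq, hE2, integral_const, probReal_univ, one_smul]
        ring
      · simp only [mul_comm (g p _)]
        refine hoff hq h1.symm ?_
        rintro rfl
        exact h2 (Prod.swap_swap q).symm
    · exact hoff hp h1 h2
  have hdiag (p : ι × ι) : ∫ x, g p x * g p x ∂μ ≤ 1 + m4 := by
    obtain ⟨i, j⟩ := p
    by_cases hp : i = j
    · subst hp
      have e (x : ι → ℝ) : g (i, i) x * g (i, i) x = x i ^ 4 - 2 * (x i ^ 2) + 1 := by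
        simp only [hg, one_apply_eq]; ring
      simp only [e]
      have hi2 : Integrable (fun x : ι → ℝ ↦ 2 * x i ^ 2) μ := by
        simpa only [sq] using (hi11 i i).const_mul 2
      have j1 : Integrable (fun x : ι → ℝ ↦ x i ^ 4 - 2 * x i ^ 2) μ := (hi4 i).sub hi2
      rw [integral_add j1 (integrable_const _), integral_sub (hi4 i) hi2,
        integral_const_mul, hE4, hE2]
      simp
      linarith
    · have e (x : ι → ℝ) : g (i, j) x * g (i, j) x = x i ^ 2 * x j ^ 2 := by
        simp only [hg, one_apply_ne hp]; ring
      simp only [e]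
      rw [hE22 hp]
      linarith
  have hswap (p : ι × ι) (x : ι → ℝ) : g p.swap x = g p x := by
    simp only [hg, Prod.fst_swap, Prod.snd_swap]
    rw [mul_comm, ← transpose_apply (1 : Matrix ι ι ℝ), transpose_one]
    rfl
  refine ⟨by linarith, ?_, fun a b ↦ ?_, fun N ↦ ?_⟩
  · have e (x : ι → ℝ) : (x ⬝ᵥ x) ^ 2 = ∑ i, ∑ j, x i ^ 2 * x j ^ 2 := by
      simp only [dotProduct, ← sq]
      rw [sq, Finset.sum_mul_sum]
    simp only [e]
    exact integrable_finsetSum _ fun i _ ↦ integrable_finsetSum _ fun j _ ↦ hi22 i j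
  · have e (x : ι → ℝ) : (a ⬝ᵥ x) * (b ⬝ᵥ x) = ∑ i, ∑ j, (a i * b j) * (x i * x j) := by
      simp only [dotProduct, Finset.sum_mul_sum]
      exact Finset.sum_congr rfl fun i _ ↦ Finset.sum_congr rfl fun j _ ↦ by ring
    simp only [e]
    rw [integral_finsetSum _ fun i _ ↦ integrable_finsetSum _ fun j _ ↦ (hi11 i j).const_mul _]
    rw [dotProduct]
    refine Finset.sum_congr rfl fun i _ ↦ ?_
    rw [integral_finsetSum _ fun j _ ↦ (hi11 i j).const_mul _]
    rw [Finset.sum_eq_single i]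
    · rw [integral_const_mul]
      simp only [← sq, hE2, mul_one]
    · intro j _ hj
      rw [integral_const_mul, hE11 hj.symm, mul_zero]
    · simp
  · have e (x : ι → ℝ) : x ⬝ᵥ N *ᵥ x - trace N = ∑ p : ι × ι, N p.1 p.2 * g p x := by
      have h1 : x ⬝ᵥ N *ᵥ x = ∑ i, ∑ j, N i j * (x i * x j) := by
        simp only [dotProduct, mulVec, Finset.mul_sum]
        exact Finset.sum_congr rfl fun i _ ↦ Finset.sum_congr rfl fun j _ ↦ by ring
      have h2 : trace N = ∑ i, ∑ j, N i j * (1 : Matrix ι ι ℝ) i j := by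
        simp [trace, one_apply]
      rw [h1, h2, ← Finset.sum_sub_distrib, Fintype.sum_prod_type]
      refine Finset.sum_congr rfl fun i _ ↦ ?_
      rw [← Finset.sum_sub_distrib]
      exact Finset.sum_congr rfl fun j _ ↦ by simp only [hg]; ring
    have e2 (x : ι → ℝ) : (x ⬝ᵥ N *ᵥ x - trace N) ^ 2 =
        ∑ p : ι × ι, ∑ q : ι × ι, (N p.1 p.2 * N q.1 q.2) * (g p x * g q x) := by
      rw [e, sq, Finset.sum_mul_sum]
      exact Finset.sum_congr rfl fun i _ ↦ Finset.sum_congr rfl fun j _ ↦ by ring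
    simp only [e2]
    rw [integral_finsetSum _ fun p _ ↦ integrable_finsetSum _ fun q _ ↦ (hgi p q).const_mul _]
    have hpq (p : ι × ι) : ∫ x, ∑ q : ι × ι, (N p.1 p.2 * N q.1 q.2) * (g p x * g q x) ∂μ ≤
        (1 + m4) * (N p.1 p.2 ^ 2 + |N p.1 p.2 * N p.2 p.1|) := by
      rw [integral_finsetSum _ fun q _ ↦ (hgi p q).const_mul _]
      simp only [integral_const_mul]
      have hd0 : 0 ≤ ∫ x, g p x * g p x ∂μ := integral_nonneg fun x ↦ mul_self_nonneg _
      have hterm (q : ι × ι) : N p.1 p.2 * N q.1 q.2 * ∫ x, g p x * g q x ∂μ ≤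
          (if q = p then (1 + m4) * N p.1 p.2 ^ 2 else 0) +
            (if q = p.swap then (1 + m4) * |N p.1 p.2 * N p.2 p.1| else 0) := by
        by_cases h1 : q = p
        · subst h1
          have : 0 ≤ (if q = q.swap then (1 + m4) * |N q.1 q.2 * N q.2 q.1| else 0) := by
            split_ifs <;> positivity
          have h3 := mul_le_mul_of_nonneg_left (hdiag q) (sq_nonneg (N q.1 q.2))
          rw [if_pos rfl]
          nlinarith
        · by_cases h2 : q = p.swap
          · subst h2
            rw [if_neg h1, if_pos rfl]
            simp only [hswap, Prod.fst_swap, Prod.snd_swap, zero_add]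
            have h3 := mul_le_mul (le_abs_self (N p.1 p.2 * N p.2 p.1)) (hdiag p) hd0 (abs_nonneg _)
            linarith
          · rw [hzero h1 h2, if_neg h1, if_neg h2]
            simp
      refine (Finset.sum_le_sum fun q _ ↦ hterm q).trans (le_of_eq ?_)
      rw [Finset.sum_add_distrib, Finset.sum_ite_eq', Finset.sum_ite_eq',
        if_pos (Finset.mem_univ _),
        if_pos (Finset.mem_univ _)]
      ring
    refine (Finset.sum_le_sum fun p _ ↦ hpq p).trans ?_
    have hle (p : ι × ι) : (1 + m4) * (N p.1 p.2 ^ 2 + |N p.1 p.2 * N p.2 p.1|) ≤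
        (1 + m4) * (N p.1 p.2 ^ 2 + (N p.1 p.2 ^ 2 + N p.2 p.1 ^ 2) / 2) := by
      refine mul_le_mul_of_nonneg_left ?_ (by linarith)
      have : |N p.1 p.2 * N p.2 p.1| ≤ (N p.1 p.2 ^ 2 + N p.2 p.1 ^ 2) / 2 := by
        rw [abs_le]
        constructor <;> nlinarith [sq_nonneg (N p.1 p.2 + N p.2 p.1),
          sq_nonneg (N p.1 p.2 - N p.2 p.1)]
      linarith
    refine (Finset.sum_le_sum fun p _ ↦ hle p).trans (le_of_eq ?_)
    have f1 : ∑ p : ι × ι, N p.1 p.2 ^ 2 = frobSq N := by rw [Fintype.sum_prod_type]; rfl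
    have f2 : ∑ p : ι × ι, N p.2 p.1 ^ 2 = frobSq N := by
      rw [← frobSq_transpose, Fintype.sum_prod_type]; rfl
    rw [← Finset.mul_sum, Finset.sum_add_distrib, ← Finset.sum_div, Finset.sum_add_distrib, f1, f2]
    ring

end ProductMoments

section Nets

variable {ι : Type*} [Fintype ι] [DecidableEq ι]

/-- A finite set of vectors of the unit ball that is `1/2`-dense in it. -/
structure IsHalfNet (s : Finset (ι → ℝ)) : Prop where
  vecNorm_le : ∀ u ∈ s, vecNorm u ≤ 1
  exists_near : ∀ w : ι → ℝ, vecNorm w ≤ 1 → ∃ u ∈ s, vecNorm (w - u) ≤ 1 / 2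

lemma exists_isHalfNet (ι : Type*) [Fintype ι] :
    ∃ s : Finset (ι → ℝ), s.card ≤ 5 ^ Fintype.card ι ∧ IsHalfNet s := by
  classical
  set P : Finset (EuclideanSpace ℝ ι) → Prop := fun s ↦
    (∀ c ∈ s, ‖c‖ ≤ 2) ∧ ∀ c ∈ s, ∀ d ∈ s, c ≠ d → 1 ≤ ‖c - d‖ with hP
  have hcard (s) (hs : P s) : s.card ≤ 5 ^ Fintype.card ι := by
    simpa using Besicovitch.card_le_of_separated s hs.1 hs.2
  obtain ⟨s, hs, hmax⟩ : ∃ s, P s ∧ ∀ t, P t → t.card ≤ s.card := by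
    have hne : {m | ∃ s, P s ∧ s.card = m}.Nonempty := ⟨0, ∅, by simp [hP], rfl⟩
    have hb : BddAbove {m | ∃ s, P s ∧ s.card = m} :=
      ⟨5 ^ Fintype.card ι, by rintro _ ⟨s, hs, rfl⟩; exact hcard s hs⟩
    obtain ⟨s, hs, hm⟩ := Nat.sSup_mem hne hb
    exact ⟨s, hs, fun t ht ↦ hm ▸ le_csSup hb ⟨t, ht, rfl⟩⟩
  refine ⟨s.image fun c ↦ ((2 : ℝ)⁻¹ • c).ofLp, Finset.card_image_le.trans (hcard s hs), ?_, ?_⟩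
  · intro u hu
    obtain ⟨c, hc, rfl⟩ := Finset.mem_image.1 hu
    rw [vecNorm_eq_norm, WithLp.toLp_ofLp, norm_smul]
    have := hs.1 c hc
    norm_num
    linarith
  · intro w hw
    set x : EuclideanSpace ℝ ι := WithLp.toLp 2 ((2 : ℝ) • w) with hx
    have hxn : ‖x‖ ≤ 2 := by
      rw [hx, ← vecNorm_eq_norm, vecNorm_smul]
      norm_num
      linarith
    obtain ⟨c, hc, hxc⟩ : ∃ c ∈ s, ‖x - c‖ ≤ 1 := by
      by_contra! hcon
      have hxs : x ∉ s := fun h ↦ by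
        have := hcon x h
        simp at this
        linarith
      have hP' : P (insert x s) := by
        refine ⟨fun c hc ↦ ?_, fun c hc d hd hcd ↦ ?_⟩
        · rcases Finset.mem_insert.1 hc with rfl | hc
          exacts [hxn, hs.1 c hc]
        · rcases Finset.mem_insert.1 hc with rfl | hc <;>
            rcases Finset.mem_insert.1 hd with rfl | hd
          · exact absurd rfl hcd
          · exact (hcon d hd).le
          · rw [norm_sub_rev]; exact (hcon c hc).le
          · exact hs.2 c hc d hd hcd
      have := hmax _ hP'
      rw [Finset.card_insert_of_notMem hxs] at this
      omega
    refine ⟨_, Finset.mem_image_of_mem _ hc, ?_⟩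
    have e : w - ((2 : ℝ)⁻¹ • c).ofLp = (2 : ℝ)⁻¹ • (x - c).ofLp := by
      ext i
      simp [hx]
      ring
    rw [e, vecNorm_smul, vecNorm_eq_norm, WithLp.toLp_ofLp]
    norm_num
    linarith

lemma IsHalfNet.vecNorm_le_of_dotProduct {s : Finset (ι → ℝ)} (hs : IsHalfNet s) {z : ι → ℝ} {c : ℝ}
    (h : ∀ u ∈ s, |u ⬝ᵥ z| ≤ c) : vecNorm z ≤ 2 * c := by
  rcases (vecNorm_nonneg z).eq_or_lt with h0 | h0
  · obtain ⟨u, hu, -⟩ := hs.exists_near 0 (by simp [vecNorm])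
    rw [← h0]
    linarith [(abs_nonneg _).trans (h u hu)]
  · obtain ⟨u, hu, hn⟩ := hs.exists_near ((vecNorm z)⁻¹ • z) (by
      rw [vecNorm_smul, abs_of_pos (inv_pos.2 h0), inv_mul_cancel₀ h0.ne'])
    have e : ((vecNorm z)⁻¹ • z) ⬝ᵥ z = vecNorm z := by
      rw [smul_dotProduct, ← vecNorm_sq, smul_eq_mul]
      field_simp
    have h1 := (le_abs_self _).trans (abs_dotProduct_le ((vecNorm z)⁻¹ • z - u) z)
    rw [sub_dotProduct, e] at h1
    have h2 := (le_abs_self _).trans (h u hu)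
    have := mul_le_mul_of_nonneg_right hn h0.le
    linarith

lemma IsHalfNet.opNorm_le {s : Finset (ι → ℝ)} (hs : IsHalfNet s) {A : Matrix ι ι ℝ} {c : ℝ}
    (h : ∀ u ∈ s, ∀ v ∈ s, |u ⬝ᵥ A *ᵥ v| ≤ c) : ‖A‖ ≤ 4 * c := by
  have hc : 0 ≤ c := by
    obtain ⟨u, hu, -⟩ := hs.exists_near 0 (by simp [vecNorm])
    exact (abs_nonneg _).trans (h u hu u hu)
  have h1 (v) (hv : v ∈ s) : vecNorm (A *ᵥ v) ≤ 2 * c :=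
    hs.vecNorm_le_of_dotProduct fun u hu ↦ h u hu v hv
  have h2 : ‖A‖ ≤ 2 * c + ‖A‖ / 2 := by
    refine opNorm_le_of_vecNorm_le (by positivity) fun w ↦ ?_
    rcases (vecNorm_nonneg w).eq_or_lt with h0 | h0
    · have := vecNorm_mulVec_le A w
      rw [← h0] at this ⊢
      simpa using this
    · obtain ⟨v, hv, hn⟩ := hs.exists_near ((vecNorm w)⁻¹ • w) (by
        rw [vecNorm_smul, abs_of_pos (inv_pos.2 h0), inv_mul_cancel₀ h0.ne'])
      have e : A *ᵥ w = vecNorm w • (A *ᵥ v + A *ᵥ ((vecNorm w)⁻¹ • w - v)) := by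
        rw [← mulVec_add, add_sub_cancel, mulVec_smul, smul_smul, mul_inv_cancel₀ h0.ne', one_smul]
      rw [e, vecNorm_smul, abs_of_pos h0, mul_comm]
      refine mul_le_mul_of_nonneg_right ?_ h0.le
      refine (vecNorm_add_le _ _).trans (add_le_add (h1 v hv) ?_)
      refine (vecNorm_mulVec_le _ _).trans ?_
      have := mul_le_mul_of_nonneg_left hn (norm_nonneg A)
      linarith
  linarith

end Nets

section OperatorConcentration

variable {ι κ : Type*} [Fintype ι] [DecidableEq ι] [Fintype κ] [DecidableEq κ]

lemma measure_exists_net_le {Ω : Type*} [MeasurableSpace Ω] (μ : Measure Ω) {s : Finset (ι → ℝ)}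
    (hs : s.card ≤ 5 ^ Fintype.card ι) {E E' : (ι → ℝ) → (ι → ℝ) → Set Ω} {e : ℝ} (he : 0 ≤ e)
    (hE : ∀ u v, u ∈ s → v ∈ s → μ (E u v) ≤ ENNReal.ofReal (2 * e))
    (hE' : ∀ u v, u ∈ s → v ∈ s → μ (E' u v) ≤ ENNReal.ofReal (2 * e)) :
    μ {ω | ∃ u ∈ s, ∃ v ∈ s, ω ∈ E u v ∪ E' u v} ≤
      ENNReal.ofReal (4 * 25 ^ Fintype.card ι * e) := by
  have hsub : {ω | ∃ u ∈ s, ∃ v ∈ s, ω ∈ E u v ∪ E' u v} =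
      ⋃ p ∈ s ×ˢ s, (E p.1 p.2 ∪ E' p.1 p.2) := by
    ext ω
    simp only [Set.mem_ofPred_eq, Set.mem_iUnion, Finset.mem_product, exists_prop, Prod.exists]
    constructor
    · rintro ⟨u, hu, v, hv, h⟩; exact ⟨u, v, ⟨hu, hv⟩, h⟩
    · rintro ⟨u, v, ⟨hu, hv⟩, h⟩; exact ⟨u, hu, v, hv, h⟩
  rw [hsub]
  refine (measure_biUnion_finset_le _ _).trans ?_
  have h1 (p) (hp : p ∈ s ×ˢ s) : μ (E p.1 p.2 ∪ E' p.1 p.2) ≤ ENNReal.ofReal (4 * e) := by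
    obtain ⟨h1, h2⟩ := Finset.mem_product.1 hp
    refine (measure_union_le _ _).trans ((add_le_add (hE _ _ h1 h2) (hE' _ _ h1 h2)).trans ?_)
    rw [← ENNReal.ofReal_add (by positivity) (by positivity)]
    exact ENNReal.ofReal_le_ofReal (by linarith)
  refine (Finset.sum_le_sum h1).trans ?_
  rw [Finset.sum_const, nsmul_eq_mul, Finset.card_product, ← ENNReal.ofReal_natCast,
    ← ENNReal.ofReal_mul (by positivity)]
  refine ENNReal.ofReal_le_ofReal ?_
  have h2 : (s.card : ℝ) ≤ 5 ^ Fintype.card ι := by exact_mod_cast hs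
  have h3 : (25 : ℝ) ^ Fintype.card ι = 5 ^ Fintype.card ι * 5 ^ Fintype.card ι := by
    rw [← mul_pow]; norm_num
  rw [h3]
  push_cast
  calc (s.card : ℝ) * s.card * (4 * e)
      ≤ 5 ^ Fintype.card ι * 5 ^ Fintype.card ι * (4 * e) := by gcongr
    _ = _ := by ring

/-- The error scale `M √(r / n)`. -/
def errorScale (ι : Type*) [Fintype ι] (M n : ℝ) : ℝ := M * √(Fintype.card ι / n)

lemma errorScale_nonneg {M : ℝ} (hM : 0 ≤ M) (n : ℝ) : 0 ≤ errorScale ι M n :=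
  mul_nonneg hM (Real.sqrt_nonneg _)

variable {ν : Measure (ι → ℝ)} [IsProbabilityMeasure ν] {B M n : ℝ}

lemma sum_sq_mulVec_sub {O : Matrix ι ι ℝ} (hO : Oᵀ * O = 1) (x y : κ → ι → ℝ) :
    ∑ k, ∑ i, ((O *ᵥ x k) i - (O *ᵥ y k) i) ^ 2 = ∑ k, ∑ i, (x k i - y k i) ^ 2 := by
  refine Finset.sum_congr rfl fun k _ ↦ ?_
  have e (a b : ι → ℝ) : ∑ i, (a i - b i) ^ 2 = (a - b) ⬝ᵥ (a - b) := by
    simp [dotProduct, sq]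
  rw [e, e, ← mulVec_sub, dotProduct_mulVec, vecMul_mulVec, hO, vecMul_one]

/-- Rotating the random half of the columns barely moves the polar factor. -/
theorem measure_polarFactor_rotate_le (hν : ColumnMoments ν B) (hM : 0 < M)
    (hconc : FrobeniusConcentration (Measure.pi fun _ : κ ↦ ν) M)
    {d : ι → ℝ} (hd : ∀ i, 0 < d i) {Q : Matrix ι ι ℝ} (hQ : CoerciveMatrix Q)
    (hQF : frobSq Q ≤ 4 * Fintype.card ι) (hn : 0 < n)
    (hκ : (Fintype.card κ : ℝ) ≤ n) (hι : (Fintype.card ι : ℝ) ≤ n) (hB : B ≤ n) (hBM : B ≤ M)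
    {O O' : Matrix ι ι ℝ} (hO : Oᵀ * O = 1) (hO' : O'ᵀ * O' = 1) :
    (Measure.pi fun _ : κ ↦ ν) {X | 1948000 * errorScale ι M n <
      ‖polarFactor d (Q + scaledGram n fun k ↦ O *ᵥ X k) -
        polarFactor d (Q + scaledGram n fun k ↦ O' *ᵥ X k)‖} ≤
      ENNReal.ofReal (4 * 25 ^ Fintype.card ι * Real.exp (-(8 * Fintype.card ι))) := by
  set μ := Measure.pi fun _ : κ ↦ ν with hμ
  obtain ⟨s, hs, hnet⟩ := exists_isHalfNet ι
  set r : ℝ := (Fintype.card ι : ℝ) with hr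
  have hr0 : 0 ≤ r := Nat.cast_nonneg _
  set f : Matrix ι ι ℝ → (ι → ℝ) → (ι → ℝ) → (κ → ι → ℝ) → ℝ := fun O u v X ↦
    u ⬝ᵥ polarFactor d (Q + scaledGram n fun k ↦ O *ᵥ X k) *ᵥ v with hf
  set L := 32 * (√n)⁻¹ with hL
  have hsn : 0 < √n := Real.sqrt_pos.2 hn
  have hL0 : 0 < L := by positivity
  have hε : 0 ≤ errorScale ι M n := errorScale_nonneg hM.le n
  have hML : M * (√r * L) = 32 * errorScale ι M n := by
    rw [errorScale, Real.sqrt_div hr0, hL]; ring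
  set t := 8 * √r * (M * L) with ht
  have ht0 : 0 ≤ t := by positivity
  have ht' : t = 256 * errorScale ι M n := by rw [ht]; linear_combination 8 * hML
  have hdev {O : Matrix ι ι ℝ} (hO : Oᵀ * O = 1) (u v) (hu : u ∈ s) (hv : v ∈ s) :
      μ {X | t ≤ |f O u v X - ∫ Y, f O u v Y ∂μ|} ≤ ENNReal.ofReal (2 * Real.exp (-(8 * r))) := by
    have h := (hconc (f O u v) L hL0.le fun x y ↦ ?_).2.1 t ht0
    · have e : t ^ 2 / (8 * (M * L) ^ 2) = 8 * r := by
        rw [ht, mul_pow, mul_pow, Real.sq_sqrt hr0]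
        field_simp
      rwa [e] at h
    · refine (abs_polarFactor_sub_le hd hQ hn.le u v _ _).trans ?_
      rw [sum_sq_mulVec_sub hO]
      refine mul_le_mul_of_nonneg_right ?_ (Real.sqrt_nonneg _)
      rw [← hL]
      refine mul_le_of_le_one_right hL0.le ?_
      exact mul_le_one₀ (hnet.vecNorm_le u hu) (vecNorm_nonneg v) (hnet.vecNorm_le v hv)
  have hmean {O : Matrix ι ι ℝ} (u v : ι → ℝ) : ∫ X, f O u v X ∂μ =
      ∫ X, u ⬝ᵥ polarFactor d (Q + scaledGram n X) *ᵥ v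
        ∂(Measure.pi fun _ : κ ↦ ν.map fun x ↦ O *ᵥ x) := by
    have hm : Measurable fun x : ι → ℝ ↦ O *ᵥ x := by fun_prop
    have : IsProbabilityMeasure (ν.map fun x ↦ O *ᵥ x) :=
      Measure.isProbabilityMeasure_map hm.aemeasurable
    have hm' : Measurable fun (X : κ → ι → ℝ) k ↦ O *ᵥ X k :=
      measurable_pi_lambda _ fun k ↦ hm.comp (measurable_pi_apply k)
    rw [← Measure.pi_map_pi (fun _ ↦ hm.aemeasurable), integral_map hm'.aemeasurable]
    exact (continuous_dotProduct_polarFactor hd hQ hn.le u v).aestronglyMeasurable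
  have hbias (u v) (hu : u ∈ s) (hv : v ∈ s) :
      |∫ X, f O u v X ∂μ - ∫ X, f O' u v X ∂μ| ≤ 486400 * errorScale ι M n := by
    have hp {O : Matrix ι ι ℝ} : IsProbabilityMeasure (ν.map fun x ↦ O *ᵥ x) :=
      Measure.isProbabilityMeasure_map (by fun_prop)
    rw [hmean, hmean]
    have h := abs_integral_polarFactor_sub_le u v hd hQ hn hκ hι hB
      (ν := fun _ : κ ↦ ν.map fun x ↦ O *ᵥ x) (ν' := fun _ ↦ ν.map fun x ↦ O' *ᵥ x)
      (fun _ ↦ hν.map_orthogonal hO) (fun _ ↦ hν.map_orthogonal hO') (by linarith [hν.one_le])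
    refine h.trans ?_
    have hB1 := hν.one_le
    have hF := frobSq_nonneg Q
    have hvn := vecNorm_nonneg v
    have hun := vecNorm_nonneg u
    have hrn : r / n ≤ √(r / n) := by
      have h1 : r / n ≤ 1 := (div_le_one hn).2 hι
      have h2 : 0 ≤ r / n := by positivity
      nlinarith [Real.sq_sqrt h2, Real.sqrt_nonneg (r / n), Real.sqrt_le_one.2 h1]
    calc 25600 * B * (11 * r + 2 * frobSq Q) * vecNorm u * vecNorm v / n
        ≤ 25600 * B * (11 * r + 2 * (4 * r)) * 1 * 1 / n := by
          gcongr
          exacts [hnet.vecNorm_le u hu, hnet.vecNorm_le v hv]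
      _ = 486400 * (B * (r / n)) := by ring
      _ ≤ 486400 * (M * √(r / n)) := by gcongr
  refine (measure_mono fun X hX ↦ ?_).trans (measure_exists_net_le μ hs (Real.exp_pos _).le
    (hdev hO) (hdev hO'))
  by_contra hcon
  simp only [Set.mem_ofPred_eq, Set.mem_union, not_exists, not_and, not_or, not_le] at hcon hX
  refine hX.not_ge ?_
  have : ‖polarFactor d (Q + scaledGram n fun k ↦ O *ᵥ X k) -
      polarFactor d (Q + scaledGram n fun k ↦ O' *ᵥ X k)‖ ≤ 4 * (487000 * errorScale ι M n) := by
    refine hnet.opNorm_le fun u hu v hv ↦ ?_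
    rw [sub_mulVec, dotProduct_sub]
    obtain ⟨h1, h2⟩ := hcon u hu v hv
    have h3 := hbias u v hu hv
    rw [ht'] at h1 h2
    rw [abs_lt] at h1 h2
    rw [abs_le] at h3 ⊢
    simp only [hf] at h1 h2 h3
    constructor <;> linarith
  linarith

lemma integral_sum_dotProduct_sq (hν : ColumnMoments ν B) (a : ι → ℝ) :
    ∫ X : κ → ι → ℝ, ∑ k, (a ⬝ᵥ X k) ^ 2 ∂(Measure.pi fun _ : κ ↦ ν) =
      Fintype.card κ * (a ⬝ᵥ a) := by
  have hi (k : κ) : Integrable (fun X : κ → ι → ℝ ↦ (a ⬝ᵥ X k) ^ 2) (Measure.pi fun _ : κ ↦ ν) := by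
    have := (measurePreserving_eval (fun _ : κ ↦ ν) k).integrable_comp_of_integrable
      (hν.integrable_mul a a)
    simp only [← sq] at this
    exact this
  rw [integral_finsetSum _ fun k _ ↦ hi k]
  have h (k : κ) : ∫ X : κ → ι → ℝ, (a ⬝ᵥ X k) ^ 2 ∂(Measure.pi fun _ : κ ↦ ν) = a ⬝ᵥ a := by
    have hm := measurePreserving_eval (fun _ : κ ↦ ν) k
    have := integral_map (μ := Measure.pi fun _ : κ ↦ ν) (φ := Function.eval k)
      hm.measurable.aemeasurable (f := fun x ↦ (a ⬝ᵥ x) ^ 2) (by fun_prop)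
    rw [hm.map_eq] at this
    rw [← hν.integral_mul a a]
    simp only [← sq]
    exact this.symm
  simp [h]

lemma measure_quad_sub_le (hν : ColumnMoments ν B) (hM : 0 < M)
    (hconc : FrobeniusConcentration (Measure.pi fun _ : κ ↦ ν) M) (hκ : 0 < Fintype.card κ)
    (hι : 0 < Fintype.card ι) (hsmall : errorScale ι M (Fintype.card κ) ≤ 1) (a : ι → ℝ) :
    (Measure.pi fun _ : κ ↦ ν) {X | 88 * errorScale ι M (Fintype.card κ) * (a ⬝ᵥ a) <
      |a ⬝ᵥ (scaledGram (Fintype.card κ) X - 1) *ᵥ a|} ≤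
      ENNReal.ofReal (2 * Real.exp (-(8 * Fintype.card ι))) := by
  rcases (vecNorm_nonneg a).eq_or_lt with h0 | h0
  · have ha : a = 0 := by
      have := vecNorm_sq a
      rw [← h0] at this
      exact dotProduct_self_eq_zero.1 (by simpa using this.symm)
    subst ha
    simp
  set μ := Measure.pi fun _ : κ ↦ ν with hμ
  set N : ℝ := (Fintype.card κ : ℝ) with hN
  have hN0 : 0 < N := by rw [hN]; exact_mod_cast hκ
  set r : ℝ := (Fintype.card ι : ℝ) with hr
  have hr1 : 1 ≤ r := by rw [hr]; exact_mod_cast hι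
  set f : (κ → ι → ℝ) → ℝ := fun X ↦ vecNorm fun k ↦ a ⬝ᵥ X k with hf
  have hf2 (X) : f X ^ 2 = ∑ k, (a ⬝ᵥ X k) ^ 2 := by
    rw [hf, vecNorm_sq]; simp [dotProduct, sq]
  have hLip (x y : κ → ι → ℝ) : |f x - f y| ≤ vecNorm a * √(∑ k, ∑ i, (x k i - y k i) ^ 2) := by
    have h1 : |f x - f y| ≤ vecNorm ((fun k ↦ a ⬝ᵥ x k) - fun k ↦ a ⬝ᵥ y k) := by
      simp only [hf, vecNorm_eq_norm, WithLp.toLp_sub]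
      exact abs_norm_sub_norm_le _ _
    refine h1.trans ?_
    rw [vecNorm, vecNorm, ← Real.sqrt_mul (dotProduct_self_nonneg' a)]
    refine Real.sqrt_le_sqrt ?_
    rw [dotProduct, Finset.mul_sum]
    refine Finset.sum_le_sum fun k _ ↦ ?_
    have h2 := pow_le_pow_left₀ (abs_nonneg _) (abs_dotProduct_le a (x k - y k)) 2
    rw [sq_abs, mul_pow, vecNorm_sq, vecNorm_sq, dotProduct_sub] at h2
    rw [Pi.sub_apply, ← sq]
    refine h2.trans (le_of_eq ?_)
    simp [dotProduct, sq]
  obtain ⟨hInt, htail, hvi, hvar⟩ := hconc f (vecNorm a) h0.le hLip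
  set m := ∫ X, f X ∂μ with hm
  have hm0 : 0 ≤ m := integral_nonneg fun X ↦ vecNorm_nonneg _
  have hfi : Integrable (fun X ↦ f X ^ 2) μ := by
    have := (hvi.add (hInt.const_mul (2 * m))).sub (integrable_const (m ^ 2))
    refine this.congr (Filter.Eventually.of_forall fun X ↦ ?_)
    simp only [Pi.add_apply, Pi.sub_apply]
    ring
  have hvar' : ∫ X, (f X - m) ^ 2 ∂μ = N * vecNorm a ^ 2 - m ^ 2 := by
    have e (X) : (f X - m) ^ 2 = f X ^ 2 - (2 * m) * f X + m ^ 2 := by ring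
    have j1 : Integrable (fun X ↦ f X ^ 2 - (2 * m) * f X) μ := hfi.sub (hInt.const_mul _)
    simp only [e]
    rw [integral_add j1 (integrable_const _), integral_sub hfi (hInt.const_mul _),
      integral_const_mul, ← hm]
    simp only [hf2]
    rw [integral_sum_dotProduct_sq hν, vecNorm_sq]
    simp only [integral_const, probReal_univ, one_smul]
    ring
  rw [hvar'] at hvar
  have hvar0 : 0 ≤ N * vecNorm a ^ 2 - m ^ 2 := by
    rw [← hvar']; exact integral_nonneg fun X ↦ sq_nonneg _
  set ε := errorScale ι M N with hε
  have hε0 : 0 ≤ ε := errorScale_nonneg hM.le _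
  have hεN : ε * √N = M * √r := by
    rw [hε, errorScale, Real.sqrt_div (by positivity)]
    have := Real.sqrt_pos.2 hN0
    field_simp
    rw [hr]
  have hsN := Real.sq_sqrt hN0.le
  have hsr := Real.sq_sqrt (show 0 ≤ r by positivity)
  set t := 8 * √r * (M * vecNorm a) with ht
  have htl := htail t (by positivity)
  have e : t ^ 2 / (8 * (M * vecNorm a) ^ 2) = 8 * r := by
    rw [ht, mul_pow, mul_pow, hsr]
    field_simp
  rw [e] at htl
  refine (measure_mono fun X hX ↦ ?_).trans htl
  simp only [Set.mem_ofPred_eq] at hX ⊢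
  by_contra! hcon
  refine hX.not_ge ?_
  have hq : a ⬝ᵥ (scaledGram N X - 1) *ᵥ a = N⁻¹ * (f X ^ 2 - N * vecNorm a ^ 2) := by
    rw [sub_mulVec, dotProduct_sub, one_mulVec, scaledGram_quad, hf2, vecNorm_sq]
    simp only [dotProduct_comm (X _) a, ← sq]
    field_simp
  rw [hq, abs_mul, abs_of_pos (inv_pos.2 hN0), inv_mul_le_iff₀ hN0, ← vecNorm_sq]
  set A := vecNorm a with hA
  have ht2 : t = 8 * (ε * √N) * A := by rw [hεN, ht]; ring
  have hmA : m ≤ √N * A := by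
    refine abs_le_of_sq_le_sq' ?_ (by positivity) |>.2
    rw [mul_pow, hsN]; linarith
  have hM2 : M ^ 2 ≤ ε ^ 2 * N := by
    have : ε ^ 2 * N = M ^ 2 * r := by
      rw [← hsN, ← mul_pow, hεN, mul_pow, hsr]
    rw [this]; nlinarith [sq_nonneg M]
  have hε2 : ε ^ 2 ≤ ε := by nlinarith
  have hv8 : N * A ^ 2 - m ^ 2 ≤ 8 * ε * N * A ^ 2 := by
    calc N * A ^ 2 - m ^ 2 ≤ 8 * (M ^ 2) * A ^ 2 := by linarith
      _ ≤ 8 * (ε ^ 2 * N) * A ^ 2 := by gcongr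
      _ ≤ 8 * (ε * N) * A ^ 2 := by gcongr
      _ = _ := by ring
  have h1 : |f X ^ 2 - m ^ 2| ≤ t * (t + 2 * m) := by
    have : f X ^ 2 - m ^ 2 = (f X - m) * ((f X - m) + 2 * m) := by ring
    rw [this, abs_mul]
    refine mul_le_mul hcon.le ?_ (abs_nonneg _) (by positivity)
    refine (abs_add_le _ _).trans (add_le_add hcon.le ?_)
    rw [abs_of_nonneg (by positivity)]
  have h2 : t * (t + 2 * m) ≤ 80 * ε * N * A ^ 2 := by
    calc t * (t + 2 * m) ≤ t * (t + 2 * (√N * A)) := by gcongr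
      _ = (64 * ε ^ 2 + 16 * ε) * √N ^ 2 * A ^ 2 := by rw [ht2]; ring
      _ ≤ (64 * ε + 16 * ε) * √N ^ 2 * A ^ 2 := by gcongr
      _ = _ := by rw [hsN]; ring
  rw [abs_le] at h1 ⊢
  constructor <;> linarith

/-- The sample covariance of `card κ` columns is close to the identity. -/
theorem measure_scaledGram_sub_one_le (hν : ColumnMoments ν B) (hM : 0 < M)
    (hconc : FrobeniusConcentration (Measure.pi fun _ : κ ↦ ν) M) (hκ : 0 < Fintype.card κ)
    (hι : 0 < Fintype.card ι) (hsmall : errorScale ι M (Fintype.card κ) ≤ 1) :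
    (Measure.pi fun _ : κ ↦ ν) {X | 704 * errorScale ι M (Fintype.card κ) <
      ‖scaledGram (Fintype.card κ) X - 1‖} ≤
      ENNReal.ofReal (4 * 25 ^ Fintype.card ι * Real.exp (-(8 * Fintype.card ι))) := by
  obtain ⟨s, hs, hnet⟩ := exists_isHalfNet ι
  have hq := measure_quad_sub_le hν hM hconc hκ hι hsmall
  refine (measure_mono fun X hX ↦ ?_).trans (measure_exists_net_le _ hs (Real.exp_pos _).le
    (fun u v _ _ ↦ hq (u + v)) (fun u v _ _ ↦ hq (u - v)))
  by_contra hcon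
  simp only [Set.mem_ofPred_eq, Set.mem_union, not_exists, not_and, not_or, not_lt] at hcon hX
  refine hX.not_ge ?_
  set ε := errorScale ι M (Fintype.card κ)
  have hε0 : 0 ≤ ε := errorScale_nonneg hM.le _
  set A := scaledGram (Fintype.card κ : ℝ) X - 1 with hA
  have hsymm : Aᵀ = A := by rw [hA, transpose_sub, scaledGram_transpose, transpose_one]
  have : ‖A‖ ≤ 4 * (176 * ε) := by
    refine hnet.opNorm_le fun u hu v hv ↦ ?_
    obtain ⟨h1, h2⟩ := hcon u hu v hv
    have huv : v ⬝ᵥ A *ᵥ u = u ⬝ᵥ A *ᵥ v := by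
      rw [dotProduct_mulVec, dotProduct_comm, ← mulVec_transpose, hsymm]
    have hu1 : u ⬝ᵥ u ≤ 1 := by
      rw [← vecNorm_sq]
      exact pow_le_one₀ (vecNorm_nonneg _) (hnet.vecNorm_le u hu)
    have hv1 : v ⬝ᵥ v ≤ 1 := by
      rw [← vecNorm_sq]
      exact pow_le_one₀ (vecNorm_nonneg _) (hnet.vecNorm_le v hv)
    have p1 : (u + v) ⬝ᵥ (u + v) + (u - v) ⬝ᵥ (u - v) ≤ 4 := by
      simp only [add_dotProduct, dotProduct_add, sub_dotProduct, dotProduct_sub]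
      linarith
    have p2 : (u + v) ⬝ᵥ A *ᵥ (u + v) - (u - v) ⬝ᵥ A *ᵥ (u - v) = 4 * (u ⬝ᵥ A *ᵥ v) := by
      simp only [mulVec_add, mulVec_sub, add_dotProduct, dotProduct_add, sub_dotProduct,
        dotProduct_sub, huv]
      ring
    have p3 := mul_le_mul_of_nonneg_left p1 (show 0 ≤ 88 * ε by positivity)
    rw [abs_le] at h1 h2 ⊢
    constructor <;> linarith
  linarith

end OperatorConcentration

section SignConjugation

variable {ι : Type*} [Fintype ι] [DecidableEq ι]

/-- The diagonal matrix of a sign vector. -/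
def signMatrix (s : ι → ℤˣ) : Matrix ι ι ℝ := diagonal fun i ↦ ((s i : ℤ) : ℝ)

lemma signMatrix_transpose (s : ι → ℤˣ) : (signMatrix s)ᵀ = signMatrix s :=
  diagonal_transpose _

lemma signMatrix_mul_self (s : ι → ℤˣ) : signMatrix s * signMatrix s = 1 := by
  rw [signMatrix, diagonal_mul_diagonal, ← diagonal_one]
  congr 1
  ext i
  rcases Int.units_eq_one_or (s i) with h | h <;> simp [h]

lemma signMatrix_inv (s : ι → ℤˣ) : (signMatrix s)⁻¹ = signMatrix s :=
  inv_eq_right_inv (signMatrix_mul_self s)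

lemma signMatrix_mul_mul_apply (s : ι → ℤˣ) (A : Matrix ι ι ℝ) (i j : ι) :
    (signMatrix s * A * signMatrix s) i j = (s i : ℤ) * A i j * (s j : ℤ) := by
  rw [signMatrix, mul_diagonal, diagonal_mul]

lemma polarFactor_signMatrix (d : ι → ℝ) (S : Matrix ι ι ℝ) (s : ι → ℤˣ) :
    polarFactor d (signMatrix s * S * signMatrix s) =
      signMatrix s * polarFactor d S * signMatrix s := by
  have hR (t : ℝ) : weightedResolvent d (signMatrix s * S * signMatrix s) t =
      signMatrix s * weightedResolvent d S t * signMatrix s := by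
    have e : diagonal (fun i ↦ (t / d i) ^ 2) + signMatrix s * S * signMatrix s =
        signMatrix s * (diagonal (fun i ↦ (t / d i) ^ 2) + S) * signMatrix s := by
      rw [Matrix.mul_add, Matrix.add_mul]
      congr 1
      have : Commute (signMatrix s) (diagonal fun i ↦ (t / d i) ^ 2) := commute_diagonal _ _
      rw [this.eq, Matrix.mul_assoc, signMatrix_mul_self, Matrix.mul_one]
    rw [weightedResolvent, e, Matrix.mul_inv_rev, Matrix.mul_inv_rev, signMatrix_inv,
      ← Matrix.mul_assoc, weightedResolvent]
  ext i j
  rw [signMatrix_mul_mul_apply]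
  simp only [polarFactor, of_apply, hR, signMatrix_mul_mul_apply]
  rw [integral_const_mul, integral_const_mul, integral_mul_const, integral_const_mul]
  ring

lemma sum_sign_mul_sign {i j : ι} (h : i ≠ j) :
    ∑ s : ι → ℤˣ, ((s i : ℤ) : ℝ) * (s j : ℤ) = 0 := by
  have := Fintype.sum_equiv (Equiv.mulLeft (Pi.mulSingle i (-1) : ι → ℤˣ))
    (fun s ↦ -(((s i : ℤ) : ℝ) * (s j : ℤ))) (fun s ↦ ((s i : ℤ) : ℝ) * (s j : ℤ)) fun s ↦ by
      simp [Pi.mulSingle_eq_of_ne h.symm]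
  rw [Finset.sum_neg_distrib] at this
  linarith

/-- A matrix nearly invariant under all sign conjugations is nearly diagonal. -/
lemma opNorm_sub_diagonal_le {T : Matrix ι ι ℝ} {a : ℝ}
    (h : ∀ s : ι → ℤˣ, ‖T - signMatrix s * T * signMatrix s‖ ≤ a) :
    ‖T - diagonal fun i ↦ T i i‖ ≤ a := by
  set N : ℝ := (Fintype.card (ι → ℤˣ) : ℝ) with hN
  have hN0 : 0 < N := by rw [hN]; exact_mod_cast Fintype.card_pos
  have e : T - diagonal (fun i ↦ T i i) =
      N⁻¹ • ∑ s : ι → ℤˣ, (T - signMatrix s * T * signMatrix s) := by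
    ext i j
    rw [Matrix.smul_apply, Matrix.sum_apply, smul_eq_mul]
    simp only [Matrix.sub_apply, signMatrix_mul_mul_apply]
    rcases eq_or_ne i j with rfl | hij
    · have (s : ι → ℤˣ) : ((s i : ℤ) : ℝ) * T i i * (s i : ℤ) = T i i := by
        rcases Int.units_eq_one_or (s i) with h | h <;> simp [h]
      simp [this]
    · have : ∑ s : ι → ℤˣ, ((s i : ℤ) : ℝ) * T i j * (s j : ℤ) = 0 := by
        rw [Finset.sum_congr rfl fun s _ ↦ mul_right_comm ((s i : ℤ) : ℝ) (T i j) (s j : ℤ),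
          ← Finset.sum_mul, sum_sign_mul_sign hij, zero_mul]
      rw [Finset.sum_sub_distrib, this, diagonal_apply_ne _ hij, Finset.sum_const,
        Finset.card_univ, nsmul_eq_mul, ← hN, sub_zero, sub_zero, inv_mul_cancel_left₀ hN0.ne']
  rw [e, norm_smul, Real.norm_of_nonneg (inv_nonneg.2 hN0.le), inv_mul_le_iff₀ hN0]
  refine (norm_sum_le _ _).trans ((Finset.sum_le_sum fun s _ ↦ h s).trans (le_of_eq ?_))
  rw [Finset.sum_const, Finset.card_univ, nsmul_eq_mul]

lemma abs_apply_le_opNorm (A : Matrix ι ι ℝ) (i j : ι) : |A i j| ≤ ‖A‖ := by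
  have h := abs_dotProduct_mulVec_le A (Pi.single i 1) (Pi.single j 1)
  simpa [vecNorm, Matrix.mulVec_single_one] using h

lemma opNorm_diagonal_le {v : ι → ℝ} {a : ℝ} (ha : 0 ≤ a) (h : ∀ i, |v i| ≤ a) :
    ‖diagonal v‖ ≤ a := by
  rw [Matrix.l2_opNorm_diagonal]
  exact (pi_norm_le_iff_of_nonneg ha).2 h

/-- A nearly diagonal polar factor of a nearly isotropic matrix is nearly the identity. -/
lemma opNorm_polarFactor_sub_one_le {d : ι → ℝ} (hd : ∀ i, 0 < d i) {S : Matrix ι ι ℝ}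
    (hS : CoerciveMatrix S) {a b : ℝ} (hb : ‖S - 1‖ ≤ b)
    (ha : ∀ s : ι → ℤˣ, ‖polarFactor d S - signMatrix s * polarFactor d S * signMatrix s‖ ≤ a) :
    ‖polarFactor d S - 1‖ ≤ 16 * b + 9 * a := by
  have h4 := opNorm_polarFactor_le hd hS
  obtain ⟨P, hP, hTP, hTS⟩ := isPolarFactor_polarFactor hd hS.posDef
  set T := polarFactor d S
  have hb0 : 0 ≤ b := (norm_nonneg _).trans hb
  have ha0 : 0 ≤ a := (norm_nonneg _).trans (ha 1)
  have hdiag := opNorm_sub_diagonal_le ha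
  set t : ι → ℝ := fun i ↦ T i i with ht
  have ht0 (i) : 0 < t i := by
    simp only [ht, hTP, mul_diagonal]
    exact mul_pos hP.diag_pos (hd i)
  have hD4 : ‖diagonal t‖ ≤ 4 :=
    opNorm_diagonal_le (by norm_num) fun i ↦ (abs_apply_le_opNorm T i i).trans h4
  have hsq : ‖diagonal (fun i ↦ t i ^ 2 - 1)‖ ≤ 16 * b + 8 * a := by
    have e : diagonal (fun i ↦ t i ^ 2 - 1) =
        -(T * (S - 1) * Tᵀ) - (diagonal t * (T - diagonal t)ᵀ + (T - diagonal t) * Tᵀ) := by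
      have h1 : diagonal (fun i ↦ t i ^ 2 - 1) = diagonal t * diagonal t - 1 := by
        rw [diagonal_mul_diagonal, ← diagonal_one, diagonal_sub]
        simp only [sq]
      rw [h1, transpose_sub, diagonal_transpose, Matrix.mul_sub T, Matrix.sub_mul, hTS]
      simp only [Matrix.mul_sub, Matrix.sub_mul, Matrix.mul_one]
      abel
    have hT : ‖Tᵀ‖ ≤ 4 := by rwa [opNorm_transpose]
    rw [e]
    calc _ ≤ ‖T * (S - 1) * Tᵀ‖ + (‖diagonal t * (T - diagonal t)ᵀ‖ + ‖(T - diagonal t) * Tᵀ‖) := by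
          refine (norm_sub_le _ _).trans ?_
          rw [norm_neg]
          gcongr
          exact norm_add_le _ _
      _ ≤ 4 * b * 4 + (4 * a + a * 4) := by
          have hdt : ‖(T - diagonal t)ᵀ‖ ≤ a := by rwa [opNorm_transpose]
          refine add_le_add ?_ (add_le_add ?_ ?_)
          · refine (norm_mul_le _ _).trans ?_
            gcongr
            refine (norm_mul_le _ _).trans ?_
            gcongr
          · refine (norm_mul_le _ _).trans ?_
            gcongr
          · refine (norm_mul_le _ _).trans ?_
            gcongr
      _ = _ := by ring
  have h1 : ‖diagonal t - 1‖ ≤ 16 * b + 8 * a := by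
    rw [← diagonal_one, diagonal_sub]
    refine opNorm_diagonal_le (by positivity) fun i ↦ ?_
    have h2 := (abs_apply_le_opNorm _ i i).trans hsq
    rw [diagonal_apply_eq, show t i ^ 2 - 1 = (t i - 1) * (t i + 1) by ring, abs_mul,
      abs_of_pos (by linarith [ht0 i] : 0 < t i + 1)] at h2
    refine le_trans ?_ h2
    exact le_mul_of_one_le_right (abs_nonneg _) (by linarith [ht0 i])
  calc ‖T - 1‖ = ‖(T - diagonal t) + (diagonal t - 1)‖ := by congr 1; abel
    _ ≤ a + (16 * b + 8 * a) := (norm_add_le _ _).trans (add_le_add hdiag h1)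
    _ = _ := by ring

end SignConjugation

section Measurability

variable {ι Ω : Type*} [Fintype ι] [DecidableEq ι] [MeasurableSpace Ω]

lemma measurable_det {S : Ω → Matrix ι ι ℝ} (hS : ∀ i j, Measurable fun ω ↦ S ω i j) :
    Measurable fun ω ↦ (S ω).det := by
  simp only [det_apply]
  fun_prop

lemma measurable_inv_apply {S : Ω → Matrix ι ι ℝ} (hS : ∀ i j, Measurable fun ω ↦ S ω i j)
    (i j : ι) : Measurable fun ω ↦ (S ω)⁻¹ i j := by
  simp only [inv_def, Ring.inverse_eq_inv', Matrix.smul_apply, smul_eq_mul, adjugate_apply]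
  refine (measurable_det hS).inv.mul (measurable_det fun k l ↦ ?_)
  simp only [updateRow_apply]
  split_ifs
  · exact measurable_const
  · exact hS _ _

lemma measurable_polarFactor_apply (d : ι → ℝ) {S : Ω → Matrix ι ι ℝ}
    (hS : ∀ i j, Measurable fun ω ↦ S ω i j) (i j : ι) :
    Measurable fun ω ↦ polarFactor d (S ω) i j := by
  simp only [polarFactor, of_apply]
  refine Measurable.const_mul ?_ _
  have : Measurable fun q : Ω × ℝ ↦ (d i)⁻¹ * weightedResolvent d (S q.1) q.2 i j := by
    refine Measurable.const_mul (measurable_inv_apply (fun k l ↦ ?_) i j) _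
    simp only [Matrix.add_apply, diagonal_apply]
    refine Measurable.add ?_ ((hS k l).comp measurable_fst)
    split_ifs <;> fun_prop
  exact this.stronglyMeasurable.integral_prod_right.measurable

lemma measurable_opNorm {F : Ω → Matrix ι ι ℝ} (hF : ∀ i j, Measurable fun ω ↦ F ω i j) :
    Measurable fun ω ↦ ‖F ω‖ := by
  have hc : Continuous fun g : ι → ι → ℝ ↦ ‖of g‖ := continuous_norm (E := Matrix ι ι ℝ)
  exact hc.measurable.comp (measurable_pi_lambda _ fun i ↦ measurable_pi_lambda _ fun j ↦ hF i j)

lemma measurable_scaledGram_apply {κ : Type*} [Fintype κ] [DecidableEq κ] (n : ℝ)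
    {Y : Ω → κ → ι → ℝ} (hY : Measurable Y) (i j : ι) :
    Measurable fun ω ↦ scaledGram n (Y ω) i j := by
  simp only [scaledGram, Matrix.sum_apply, Matrix.smul_apply, vecMulVec_apply, smul_eq_mul]
  fun_prop

end Measurability

section Splitting

lemma prod_measure_le_of_fst_section {α β : Type*} [MeasurableSpace α] [MeasurableSpace β]
    {μ : Measure α} {ν : Measure β} [IsProbabilityMeasure μ] [IsProbabilityMeasure ν]
    {s : Set (α × β)} (hs : MeasurableSet s) {b : ENNReal}
    (h : ∀ x, ν (Prod.mk x ⁻¹' s) ≤ b) : μ.prod ν s ≤ b := by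
  rw [Measure.prod_apply hs]
  exact (lintegral_mono h).trans (by simp)

lemma prod_measure_le_of_snd_section {α β : Type*} [MeasurableSpace α] [MeasurableSpace β]
    {μ : Measure α} {ν : Measure β} [IsProbabilityMeasure μ] [IsProbabilityMeasure ν]
    {s : Set (α × β)} (hs : MeasurableSet s) {b : ENNReal}
    (h : ∀ y, μ ((fun x ↦ (x, y)) ⁻¹' s) ≤ b) : μ.prod ν s ≤ b := by
  rw [Measure.prod_apply_symm hs]
  exact (lintegral_mono h).trans (by simp)

variable {ι κ κ' : Type*} [Fintype ι] [DecidableEq ι] [Fintype κ] [DecidableEq κ]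
  [Fintype κ'] [DecidableEq κ']

lemma scaledGram_eq_smul {N : ℝ} (hN : N ≠ 0) (n : ℝ) (Y : κ → ι → ℝ) :
    scaledGram n Y = (N / n) • scaledGram N Y := by
  simp only [scaledGram, Finset.smul_sum, smul_smul]
  refine Finset.sum_congr rfl fun k _ ↦ ?_
  congr 1
  field_simp

lemma scaledGram_signMatrix_mul (n : ℝ) (s : ι → ℤˣ) (V : Matrix ι ι ℝ) (X : κ → ι → ℝ) :
    (scaledGram n fun k ↦ (signMatrix s * V) *ᵥ X k) =
      signMatrix s * (scaledGram n fun k ↦ V *ᵥ X k) * signMatrix s := by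
  rw [scaledGram_mulVec, scaledGram_mulVec, transpose_mul, signMatrix_transpose]
  simp only [Matrix.mul_assoc]

lemma measurable_mulVec_columns (O : Matrix ι ι ℝ) :
    Measurable fun (X : κ → ι → ℝ) k ↦ O *ᵥ X k :=
  measurable_pi_lambda _ fun k ↦
    (by fun_prop : Measurable fun x : ι → ℝ ↦ O *ᵥ x).comp (measurable_pi_apply k)

lemma opNorm_mul_mul_transpose_le {O : Matrix ι ι ℝ} (hO : Oᵀ * O = 1) (A : Matrix ι ι ℝ) :
    ‖O * A * Oᵀ‖ ≤ ‖A‖ := by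
  have h1 := opNorm_le_one_of_transpose_mul_self hO
  have h2 : ‖Oᵀ‖ ≤ 1 := by rwa [opNorm_transpose]
  calc ‖O * A * Oᵀ‖ ≤ ‖O‖ * ‖A‖ * ‖Oᵀ‖ := by
        refine (norm_mul_le _ _).trans ?_
        gcongr
        exact norm_mul_le _ _
    _ ≤ 1 * ‖A‖ * 1 := by gcongr
    _ = _ := by ring

lemma coerciveMatrix_scaledGram {X : κ → ι → ℝ} {N n : ℝ} (hn : 0 < n) (hN : n / 3 ≤ N)
    (hX : ‖scaledGram N X - 1‖ ≤ 1 / 4) {O : Matrix ι ι ℝ} (hO : Oᵀ * O = 1) :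
    CoerciveMatrix (scaledGram n fun k ↦ O *ᵥ X k) where
  symm := scaledGram_transpose _ _
  le_quad w := by
    have hN0 : 0 < N := by linarith
    have hO' : O * Oᵀ = 1 := mul_eq_one_comm.1 hO
    have h1 : (Oᵀ *ᵥ w) ⬝ᵥ (Oᵀ *ᵥ w) = w ⬝ᵥ w := by
      rw [dotProduct_mulVec, vecMul_mulVec, transpose_transpose, hO', vecMul_one]
    have h2 := abs_quad_le (scaledGram N X - 1) (Oᵀ *ᵥ w)
    have h3 : w ⬝ᵥ (scaledGram n fun k ↦ O *ᵥ X k) *ᵥ w =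
        N / n * ((Oᵀ *ᵥ w) ⬝ᵥ scaledGram N X *ᵥ (Oᵀ *ᵥ w)) := by
      rw [scaledGram_eq_smul hN0.ne', scaledGram_mulVec, smul_mulVec, dotProduct_smul, smul_eq_mul,
        ← mulVec_mulVec, ← mulVec_mulVec, dotProduct_mulVec, ← mulVec_transpose]
    rw [sub_mulVec, dotProduct_sub, one_mulVec, h1] at h2
    rw [h3]
    have hw := dotProduct_self_nonneg' w
    have h4 : 3 / 4 * (w ⬝ᵥ w) ≤ (Oᵀ *ᵥ w) ⬝ᵥ scaledGram N X *ᵥ (Oᵀ *ᵥ w) := by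
      have := (abs_le.1 (h2.trans (mul_le_mul_of_nonneg_right hX hw))).1
      linarith
    have h5 : 1 / 3 ≤ N / n := by rw [div_le_div_iff₀ (by norm_num) hn]; linarith
    have h6 : 1 / 3 * (3 / 4 * (w ⬝ᵥ w)) ≤
        N / n * ((Oᵀ *ᵥ w) ⬝ᵥ scaledGram N X *ᵥ (Oᵀ *ᵥ w)) :=
      mul_le_mul h5 h4 (by positivity) (by positivity)
    linarith

lemma frobSq_scaledGram_le {X : κ → ι → ℝ} {N n : ℝ} (hN : 0 < N) (hNn : N ≤ n)
    (hX : ‖scaledGram N X - 1‖ ≤ 1 / 4) {O : Matrix ι ι ℝ} (hO : Oᵀ * O = 1) :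
    frobSq (scaledGram n fun k ↦ O *ᵥ X k) ≤ 4 * Fintype.card ι := by
  have hn : 0 < n := hN.trans_le hNn
  have h1 : ‖scaledGram N X‖ ≤ 2 := by
    calc ‖scaledGram N X‖ = ‖(scaledGram N X - 1) + 1‖ := by rw [sub_add_cancel]
      _ ≤ 1 / 4 + 1 := (norm_add_le _ _).trans (add_le_add hX opNorm_one_le)
      _ ≤ 2 := by norm_num
  have h2 : ‖scaledGram n fun k ↦ O *ᵥ X k‖ ≤ 2 := by
    rw [scaledGram_eq_smul hN.ne', norm_smul, Real.norm_of_nonneg (by positivity),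
      scaledGram_mulVec]
    calc N / n * ‖O * scaledGram N X * Oᵀ‖ ≤ 1 * 2 := by
          gcongr
          · exact (div_le_one hn).2 hNn
          · exact (opNorm_mul_mul_transpose_le hO _).trans h1
      _ = 2 := one_mul 2
  calc _ ≤ (Fintype.card ι : ℝ) * ‖scaledGram n fun k ↦ O *ᵥ X k‖ ^ 2 := frobSq_le_card_mul _
    _ ≤ Fintype.card ι * 2 ^ 2 := by gcongr
    _ = _ := by ring

lemma opNorm_scaledGram_add_sub_one_le {X : κ → ι → ℝ} {X' : κ' → ι → ℝ} {N N' n b : ℝ}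
    (hN : 0 < N) (hN' : 0 < N') (hn : N + N' = n) (hX : ‖scaledGram N X - 1‖ ≤ b)
    (hX' : ‖scaledGram N' X' - 1‖ ≤ b) {O : Matrix ι ι ℝ} (hO : Oᵀ * O = 1) :
    ‖(scaledGram n fun k ↦ O *ᵥ X k) + (scaledGram n fun k ↦ O *ᵥ X' k) - 1‖ ≤ b := by
  have hn0 : 0 < n := by linarith
  have hO' : O * Oᵀ = 1 := mul_eq_one_comm.1 hO
  have e : (scaledGram n fun k ↦ O *ᵥ X k) + (scaledGram n fun k ↦ O *ᵥ X' k) - 1 =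
      (N / n) • (O * (scaledGram N X - 1) * Oᵀ) + (N' / n) • (O * (scaledGram N' X' - 1) * Oᵀ) := by
    have h1 : (N / n) • (1 : Matrix ι ι ℝ) + (N' / n) • (1 : Matrix ι ι ℝ) = 1 := by
      rw [← add_smul, ← add_div, hn, div_self hn0.ne', one_smul]
    rw [scaledGram_eq_smul hN.ne' n fun k ↦ O *ᵥ X k,
      scaledGram_eq_smul hN'.ne' n fun k ↦ O *ᵥ X' k,
      scaledGram_mulVec, scaledGram_mulVec]
    simp only [Matrix.mul_sub, Matrix.sub_mul, Matrix.mul_one, hO', smul_sub]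
    nth_rewrite 1 [← h1]
    abel
  rw [e]
  calc _ ≤ N / n * b + N' / n * b := by
        refine (norm_add_le _ _).trans ?_
        rw [norm_smul, norm_smul, Real.norm_of_nonneg (by positivity),
          Real.norm_of_nonneg (by positivity)]
        gcongr
        · exact (opNorm_mul_mul_transpose_le hO _).trans hX
        · exact (opNorm_mul_mul_transpose_le hO _).trans hX'
    _ = b := by rw [← add_mul, ← add_div, hn, div_self hn0.ne', one_mul]

lemma errorScale_le_two_mul {M N n : ℝ} (hM : 0 ≤ M) (hn : 0 < n) (hN : n / 3 ≤ N) :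
    errorScale ι M N ≤ 2 * errorScale ι M n := by
  have : √(Fintype.card ι / N) ≤ 2 * √(Fintype.card ι / n) := by
    have h2 : (2 : ℝ) = √4 := by
      rw [show (4 : ℝ) = 2 ^ 2 by norm_num, Real.sqrt_sq (by norm_num)]
    rw [h2, ← Real.sqrt_mul (by norm_num)]
    refine Real.sqrt_le_sqrt ?_
    rw [← mul_div_assoc, div_le_div_iff₀ (by linarith) hn]
    have : (0 : ℝ) ≤ Fintype.card ι := Nat.cast_nonneg _
    nlinarith
  unfold errorScale
  calc M * √(Fintype.card ι / N) ≤ M * (2 * √(Fintype.card ι / n)) := by gcongr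
    _ = _ := by ring

lemma eight_mul_pow_mul_exp_le {r : ℕ} (hr : 0 < r) :
    2 * (4 * 25 ^ r * Real.exp (-(8 * r))) + 2 ^ r * (2 * (4 * 25 ^ r * Real.exp (-(8 * r)))) ≤
      2 * Real.exp (-(r : ℝ)) := by
  have he : (2.7 : ℝ) < Real.exp 1 := lt_trans (by norm_num) Real.exp_one_gt_d9
  have h50 : (50 : ℝ) ^ r ≤ Real.exp (4 * r) := by
    rw [show (4 * r : ℝ) = r * 4 by ring, Real.exp_nat_mul]
    refine pow_le_pow_left₀ (by norm_num) ?_ r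
    rw [show (4 : ℝ) = (4 : ℕ) * 1 by norm_num, Real.exp_nat_mul]
    calc (50 : ℝ) ≤ 2.7 ^ 4 := by norm_num
      _ ≤ _ := by gcongr
  have h8 : (8 : ℝ) ≤ Real.exp (3 * r) := by
    have h1 : (1 : ℝ) ≤ r := by exact_mod_cast hr
    calc (8 : ℝ) ≤ 2.7 ^ 3 := by norm_num
      _ ≤ Real.exp 1 ^ 3 := by gcongr
      _ = Real.exp 3 := by rw [← Real.exp_nat_mul]; norm_num
      _ ≤ _ := Real.exp_le_exp.2 (by linarith)
  have h2 : (1 : ℝ) ≤ 2 ^ r := one_le_pow₀ (by norm_num)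
  have h50' : (50 : ℝ) ^ r = 2 ^ r * 25 ^ r := by rw [← mul_pow]; norm_num
  calc _ = 8 * (1 + 2 ^ r) * 25 ^ r * Real.exp (-(8 * r)) := by ring
    _ ≤ 8 * (2 * 2 ^ r) * 25 ^ r * Real.exp (-(8 * r)) := by gcongr; linarith
    _ = 2 * (8 * 50 ^ r * Real.exp (-(8 * r))) := by rw [h50']; ring
    _ ≤ 2 * (Real.exp (3 * r) * Real.exp (4 * r) * Real.exp (-(8 * r))) := by gcongr
    _ = _ := by rw [← Real.exp_add, ← Real.exp_add]; congr 2; ring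

variable {ν : Measure (ι → ℝ)} [IsProbabilityMeasure ν] {B M n : ℝ}

/-- With overwhelming probability the polar factor of a sample covariance matrix is close to the
identity, whatever the weights `d`. -/
theorem measure_polarFactor_sub_one_le (hν : ColumnMoments ν B) (hM : 0 < M)
    (hconc : FrobeniusConcentration (Measure.pi fun _ : κ ↦ ν) M)
    (hconc' : FrobeniusConcentration (Measure.pi fun _ : κ' ↦ ν) M)
    {d : ι → ℝ} (hd : ∀ i, 0 < d i) (hn : 0 < n)
    (hcard : (Fintype.card κ : ℝ) + Fintype.card κ' = n)
    (hκ : n / 3 ≤ Fintype.card κ) (hκ' : n / 3 ≤ Fintype.card κ') (hι : 0 < Fintype.card ι)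
    (hB : B ≤ n) (hBM : B ≤ M) (hsmall : 5632 * errorScale ι M n ≤ 1)
    {V : Matrix ι ι ℝ} (hV : Vᵀ * V = 1) :
    ((Measure.pi fun _ : κ ↦ ν).prod (Measure.pi fun _ : κ' ↦ ν))
      {q | ¬ (CoerciveMatrix
          ((scaledGram n fun k ↦ V *ᵥ q.1 k) + (scaledGram n fun k ↦ V *ᵥ q.2 k)) ∧
        ‖polarFactor d ((scaledGram n fun k ↦ V *ᵥ q.1 k) + (scaledGram n fun k ↦ V *ᵥ q.2 k)) - 1‖
          ≤ 35086528 * errorScale ι M n)} ≤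
      ENNReal.ofReal (2 * Real.exp (-(Fintype.card ι : ℝ))) := by
  set μ := Measure.pi fun _ : κ ↦ ν with hμ
  set μ' := Measure.pi fun _ : κ' ↦ ν with hμ'
  set N : ℝ := (Fintype.card κ : ℝ) with hN
  set N' : ℝ := (Fintype.card κ' : ℝ) with hN'
  set ε := errorScale ι M n with hε
  set b := 4 * 25 ^ Fintype.card ι * Real.exp (-(8 * Fintype.card ι)) with hb
  have hb0 : 0 ≤ b := by positivity
  have hε0 : 0 ≤ ε := errorScale_nonneg hM.le n
  have hN0 : 0 < N := by linarith
  have hN0' : 0 < N' := by linarith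
  have hεN : errorScale ι M N ≤ 2 * ε := errorScale_le_two_mul hM.le hn hκ
  have hεN' : errorScale ι M N' ≤ 2 * ε := errorScale_le_two_mul hM.le hn hκ'
  have hιn : (Fintype.card ι : ℝ) ≤ n := by
    have h1 : √(Fintype.card ι / n) ≤ 1 := by
      have := hν.one_le
      have h2 : M * √(Fintype.card ι / n) ≤ 1 := by
        rw [← errorScale]; linarith
      nlinarith [Real.sqrt_nonneg ((Fintype.card ι : ℝ) / n)]
    exact (div_le_one hn).1 (Real.sqrt_le_one.1 h1)
  have hΞ (s : ι → ℤˣ) : (signMatrix s * V)ᵀ * (signMatrix s * V) = 1 := by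
    rw [transpose_mul, signMatrix_transpose, Matrix.mul_assoc, ← Matrix.mul_assoc (signMatrix s),
      signMatrix_mul_self, Matrix.one_mul, hV]
  set E : Set ((κ → ι → ℝ) × (κ' → ι → ℝ)) :=
    {X | 704 * errorScale ι M N < ‖scaledGram N X - 1‖} ×ˢ Set.univ with hE
  set E' : Set ((κ → ι → ℝ) × (κ' → ι → ℝ)) :=
    Set.univ ×ˢ {X | 704 * errorScale ι M N' < ‖scaledGram N' X - 1‖} with hE'
  set F : (ι → ℤˣ) → Set ((κ → ι → ℝ) × (κ' → ι → ℝ)) := fun s ↦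
    {q | ‖scaledGram N q.1 - 1‖ ≤ 1 / 4 ∧ 1948000 * ε <
      ‖polarFactor d ((scaledGram n fun k ↦ V *ᵥ q.1 k) + scaledGram n fun k ↦ V *ᵥ q.2 k) -
        polarFactor d ((scaledGram n fun k ↦ V *ᵥ q.1 k) +
          scaledGram n fun k ↦ (signMatrix s * V) *ᵥ q.2 k)‖} with hF
  set F' : (ι → ℤˣ) → Set ((κ → ι → ℝ) × (κ' → ι → ℝ)) := fun s ↦
    {q | ‖scaledGram N' q.2 - 1‖ ≤ 1 / 4 ∧ 1948000 * ε <
      ‖polarFactor d ((scaledGram n fun k ↦ (signMatrix s * V) *ᵥ q.2 k) +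
          scaledGram n fun k ↦ V *ᵥ q.1 k) -
        polarFactor d ((scaledGram n fun k ↦ (signMatrix s * V) *ᵥ q.2 k) +
          scaledGram n fun k ↦ (signMatrix s * V) *ᵥ q.1 k)‖} with hF'
  have hg1 (O : Matrix ι ι ℝ) (i j : ι) : Measurable fun q : (κ → ι → ℝ) × (κ' → ι → ℝ) ↦
      (scaledGram n fun k ↦ O *ᵥ q.1 k) i j :=
    measurable_scaledGram_apply n ((measurable_mulVec_columns O).comp measurable_fst) i j
  have hg2 (O : Matrix ι ι ℝ) (i j : ι) : Measurable fun q : (κ → ι → ℝ) × (κ' → ι → ℝ) ↦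
      (scaledGram n fun k ↦ O *ᵥ q.2 k) i j :=
    measurable_scaledGram_apply n ((measurable_mulVec_columns O).comp measurable_snd) i j
  have hmE : (μ.prod μ') E ≤ ENNReal.ofReal b := by
    rw [hE, Measure.prod_prod, measure_univ, mul_one]
    exact measure_scaledGram_sub_one_le hν hM hconc (Nat.cast_pos.1 hN0) hι (by linarith)
  have hmE' : (μ.prod μ') E' ≤ ENNReal.ofReal b := by
    rw [hE', Measure.prod_prod, measure_univ, one_mul]
    exact measure_scaledGram_sub_one_le hν hM hconc' (Nat.cast_pos.1 hN0') hι (by linarith)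
  have hmF (s) : (μ.prod μ') (F s) ≤ ENNReal.ofReal b := by
    refine prod_measure_le_of_fst_section ?_ fun x ↦ ?_
    · refine MeasurableSet.inter (measurableSet_le (measurable_opNorm fun i j ↦ ?_)
        measurable_const) (measurableSet_lt measurable_const (measurable_opNorm fun i j ↦ ?_))
      · exact (measurable_scaledGram_apply N measurable_fst i j).sub measurable_const
      · exact (measurable_polarFactor_apply d (fun i j ↦ (hg1 _ i j).add (hg2 _ i j)) i j).sub
          (measurable_polarFactor_apply d (fun i j ↦ (hg1 _ i j).add (hg2 _ i j)) i j)
    · by_cases hx : ‖scaledGram N x - 1‖ ≤ 1 / 4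
      · refine (measure_mono fun y hy ↦ ?_).trans (measure_polarFactor_rotate_le hν hM hconc' hd
          (coerciveMatrix_scaledGram hn hκ hx hV)
          (frobSq_scaledGram_le hN0 (by linarith) hx hV) hn (by linarith) hιn hB hBM hV (hΞ s))
        exact hy.2
      · have : Prod.mk x ⁻¹' F s = ∅ := Set.eq_empty_of_forall_notMem fun y hy ↦ hx hy.1
        simp [this]
  have hmF' (s) : (μ.prod μ') (F' s) ≤ ENNReal.ofReal b := by
    refine prod_measure_le_of_snd_section ?_ fun x ↦ ?_
    · refine MeasurableSet.inter (measurableSet_le (measurable_opNorm fun i j ↦ ?_)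
        measurable_const) (measurableSet_lt measurable_const (measurable_opNorm fun i j ↦ ?_))
      · exact (measurable_scaledGram_apply N' measurable_snd i j).sub measurable_const
      · exact (measurable_polarFactor_apply d (fun i j ↦ (hg2 _ i j).add (hg1 _ i j)) i j).sub
          (measurable_polarFactor_apply d (fun i j ↦ (hg2 _ i j).add (hg1 _ i j)) i j)
    · by_cases hx : ‖scaledGram N' x - 1‖ ≤ 1 / 4
      · refine (measure_mono fun y hy ↦ ?_).trans (measure_polarFactor_rotate_le hν hM hconc hd
          (coerciveMatrix_scaledGram hn hκ' hx (hΞ s))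
          (frobSq_scaledGram_le hN0' (by linarith) hx (hΞ s)) hn (by linarith) hιn hB hBM hV (hΞ s))
        exact hy.2
      · have : (fun y ↦ (y, x)) ⁻¹' F' s = ∅ := Set.eq_empty_of_forall_notMem fun y hy ↦ hx hy.1
        simp [this]
  have hmU : (μ.prod μ') (E ∪ E' ∪ ⋃ s ∈ (Finset.univ : Finset (ι → ℤˣ)), (F s ∪ F' s)) ≤
      ENNReal.ofReal (2 * Real.exp (-(Fintype.card ι : ℝ))) := by
    refine (measure_union_le _ _).trans ((add_le_add ((measure_union_le _ _).trans
      (add_le_add hmE hmE')) ((measure_biUnion_finset_le _ _).trans (Finset.sum_le_sum fun s _ ↦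
        (measure_union_le _ _).trans (add_le_add (hmF s) (hmF' s))))).trans ?_)
    rw [Finset.sum_const, nsmul_eq_mul, Finset.card_univ, ← ENNReal.ofReal_add hb0 hb0,
      ← ENNReal.ofReal_natCast, ← ENNReal.ofReal_mul (by positivity),
      ← ENNReal.ofReal_add (by positivity) (by positivity)]
    refine ENNReal.ofReal_le_ofReal ?_
    have hc : (Fintype.card (ι → ℤˣ) : ℝ) = 2 ^ Fintype.card ι := by simp
    rw [hc]
    have := eight_mul_pow_mul_exp_le hι
    rw [← hb] at this
    linarith
  refine (measure_mono fun q hq ↦ ?_).trans hmU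
  by_contra hcon
  simp only [hE, hE', Set.mem_union, Set.mem_prod, Set.mem_univ, and_true, true_and,
    Set.mem_iUnion, Finset.mem_univ, exists_const, not_or, not_exists, Set.mem_ofPred_eq,
    not_lt] at hcon
  obtain ⟨⟨h1, h1'⟩, h2⟩ := hcon
  have hq1 : ‖scaledGram N q.1 - 1‖ ≤ 1408 * ε := by linarith
  have hq2 : ‖scaledGram N' q.2 - 1‖ ≤ 1408 * ε := by linarith
  have hq1' : ‖scaledGram N q.1 - 1‖ ≤ 1 / 4 := by linarith
  have hq2' : ‖scaledGram N' q.2 - 1‖ ≤ 1 / 4 := by linarith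
  have hcoe := (coerciveMatrix_scaledGram hn hκ hq1' hV).add_scaledGram hn.le fun k ↦ V *ᵥ q.2 k
  refine hq ⟨hcoe, ?_⟩
  have hb' := opNorm_scaledGram_add_sub_one_le hN0 hN0' hcard hq1 hq2 hV
  refine (opNorm_polarFactor_sub_one_le hd hcoe hb' (a := 3896000 * ε) fun s ↦ ?_).trans
    (by linarith)
  obtain ⟨h3, h4⟩ := h2 s
  have h3 : _ ≤ 1948000 * ε := not_lt.1 fun h ↦ h3 ⟨hq1', h⟩
  have h4 : _ ≤ 1948000 * ε := not_lt.1 fun h ↦ h4 ⟨hq2', h⟩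
  rw [← polarFactor_signMatrix, Matrix.mul_add, Matrix.add_mul, ← scaledGram_signMatrix_mul,
    ← scaledGram_signMatrix_mul]
  rw [add_comm (scaledGram n fun k ↦ (signMatrix s * V) *ᵥ q.2 k),
    add_comm (scaledGram n fun k ↦ (signMatrix s * V) *ᵥ q.2 k)] at h4
  have := (norm_sub_le_norm_sub_add_norm_sub _ _ _).trans (add_le_add h3 h4)
  linarith

end Splitting

section Whitening

variable {π' ι κ : Type*} [Fintype π'] [DecidableEq π'] [Fintype ι] [DecidableEq ι]
  [Fintype κ] [DecidableEq κ]

lemma eq_of_forall_mulVec_eq {A B : Matrix π' κ ℝ} (h : ∀ w, A *ᵥ w = B *ᵥ w) : A = B :=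
  ext_iff_mulVec.2 h

/-- Whitening `Y = U diag(c d) Z` by the inverse square root of `Y Yᵀ` leaves `U T Z`, with `T` the
polar factor of `Z Zᵀ`. -/
lemma whitening_eq {U : Matrix π' ι ℝ} (hU : Uᵀ * U = 1) {d : ι → ℝ} (hd : ∀ i, 0 < d i)
    {c : ℝ} (hc : 0 < c) {Z : Matrix ι κ ℝ} (hZ : CoerciveMatrix (Z * Zᵀ)) {Y : Matrix π' κ ℝ}
    (hY : Y = c • (U * diagonal d * Z)) {D : Matrix π' π' ℝ} (hD : D.PosSemidef)
    (hrange : ∀ u, ∃ w, D *ᵥ u = Y *ᵥ w)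
    (hinv : ∀ w, D *ᵥ (D *ᵥ ((Y * Yᵀ) *ᵥ (Y *ᵥ w))) = Y *ᵥ w) :
    D * Y = U * polarFactor d (Z * Zᵀ) * Z := by
  have hDs : Dᵀ = D := by
    have := hD.isHermitian
    rwa [IsHermitian, conjTranspose_eq_transpose_of_trivial] at this
  set K : Matrix ι κ ℝ := c • (diagonal d * Z) with hK
  have hYK : Y = U * K := by rw [hY, hK, Matrix.mul_smul, Matrix.mul_assoc]
  have hUD : U * Uᵀ * D = D := by
    refine eq_of_forall_mulVec_eq fun u ↦ ?_
    obtain ⟨w, hw⟩ := hrange u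
    rw [← mulVec_mulVec, hw, mulVec_mulVec, hYK]
    congr 1
    rw [Matrix.mul_assoc, ← Matrix.mul_assoc Uᵀ, hU, Matrix.one_mul]
  have hDU : D * (U * Uᵀ) = D := by
    have := congrArg transpose hUD
    rwa [transpose_mul, transpose_mul, transpose_transpose, hDs] at this
  set P := Uᵀ * D * U with hP
  have hPs : Pᵀ = P := by
    rw [hP, transpose_mul, transpose_mul, transpose_transpose, hDs, Matrix.mul_assoc]
  have hPpsd : P.PosSemidef := by
    have := hD.conjTranspose_mul_mul_same U
    rwa [conjTranspose_eq_transpose_of_trivial] at this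
  have hDY : D * Y = U * (P * K) := by
    calc D * Y = U * Uᵀ * D * (U * K) := by rw [hUD, hYK]
      _ = U * (P * K) := by rw [hP]; simp only [Matrix.mul_assoc]
  have hcub : P * (P * (K * Kᵀ * K)) = K := by
    have h1 : D * (D * (Y * Yᵀ * Y)) = Y := by
      refine eq_of_forall_mulVec_eq fun w ↦ ?_
      have := hinv w
      simp only [mulVec_mulVec] at this
      simpa only [Matrix.mul_assoc] using this
    have h2 : Uᵀ * (D * (D * (Y * Yᵀ * Y))) = K := by
      rw [h1, hYK, ← Matrix.mul_assoc, hU, Matrix.one_mul]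
    refine Eq.trans ?_ h2
    have h3 : Y * Yᵀ * Y = U * (K * Kᵀ * K) := by
      rw [hYK, transpose_mul]
      calc U * K * (Kᵀ * Uᵀ) * (U * K) = U * (K * (Kᵀ * ((Uᵀ * U) * K))) := by
            simp only [Matrix.mul_assoc]
        _ = _ := by rw [hU, Matrix.one_mul]; simp only [Matrix.mul_assoc]
    rw [h3]
    calc P * (P * (K * Kᵀ * K)) = Uᵀ * (D * (U * Uᵀ)) * (D * (U * (K * Kᵀ * K))) := by
          rw [hP]; simp only [Matrix.mul_assoc]
      _ = _ := by rw [hDU]; simp only [Matrix.mul_assoc]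
  have hKK : K * Kᵀ = (c ^ 2) • (diagonal d * (Z * Zᵀ) * diagonal d) := by
    rw [hK, transpose_smul, Matrix.smul_mul, Matrix.mul_smul, smul_smul, transpose_mul,
      diagonal_transpose, sq]
    simp only [Matrix.mul_assoc]
  have hdu : IsUnit (diagonal d) := by
    rw [isUnit_diagonal, Pi.isUnit_iff]
    exact fun i ↦ (hd i).ne'.isUnit
  have hKu : IsUnit (K * Kᵀ) := by
    rw [hKK]
    exact ((hdu.mul hZ.posDef.isUnit).mul hdu).smul (Units.mk0 (c ^ 2) (by positivity))
  have hPP : P * (P * (K * Kᵀ)) = 1 := by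
    refine hKu.mul_right_cancel ?_
    have := congrArg (· * Kᵀ) hcub
    simp only [Matrix.mul_assoc] at this
    simp only [Matrix.mul_assoc, Matrix.one_mul, this]
  have hPu : IsUnit P := IsUnit.of_mul_eq_one _ hPP
  have hPpd : P.PosDef := hPpsd.posDef_iff_isUnit.2 hPu
  have hPKP : P * (K * Kᵀ) * P = 1 := mul_eq_one_comm.1 hPP
  have hT : IsPolarFactor d (Z * Zᵀ) (c • (P * diagonal d)) := by
    refine ⟨c • P, hPpd.smul hc, by rw [Matrix.smul_mul], ?_⟩
    rw [← hPKP, hKK, transpose_smul, transpose_mul, diagonal_transpose, hPs]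
    simp only [Matrix.smul_mul, Matrix.mul_smul, smul_smul, Matrix.mul_assoc, sq]
  rw [hDY, ← polarFactor_eq_of_isPolarFactor hd hZ.symm hZ.le_quad hT, hK]
  simp only [Matrix.smul_mul, Matrix.mul_smul, Matrix.mul_assoc]

end Whitening

section Transport

variable {ι κ κ' τ : Type*} [Fintype ι] [Fintype κ] [Fintype κ'] [Fintype τ]

lemma measurePreserving_pi_swap (β : Measure ℝ) [IsProbabilityMeasure β] :
    MeasurePreserving (fun (X : κ → ι → ℝ) i k ↦ X k i)
      (Measure.pi fun _ : κ ↦ Measure.pi fun _ : ι ↦ β)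
      (Measure.pi fun _ : ι ↦ Measure.pi fun _ : κ ↦ β) := by
  refine ⟨by fun_prop, ?_⟩
  have h1 := Measure.infinitePi_map_curry (fun (_ : κ) (_ : ι) ↦ β)
  have h2 := Measure.infinitePi_map_curry (fun (_ : ι) (_ : κ) ↦ β)
  simp_rw [Measure.infinitePi_eq_pi] at h1 h2
  have h3 := (measurePreserving_piCongrLeft (fun _ : ι × κ ↦ β) (Equiv.prodComm κ ι)).map_eq
  rw [← h1, ← h2, ← h3, Measure.map_map (by fun_prop) (MeasurableEquiv.measurable _),
    Measure.map_map (MeasurableEquiv.measurable _) (MeasurableEquiv.measurable _)]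
  congr 1

/-- Two blocks of columns, scaled by `c` and stacked into one array indexed by rows first. -/
def stackColumns (e : κ ⊕ κ' ≃ τ) {c : ℝ} (hc : c ≠ 0) :
    (κ → ι → ℝ) × (κ' → ι → ℝ) ≃ᵐ (ι → τ → ℝ) where
  toFun q i t := c * Sum.elim q.1 q.2 (e.symm t) i
  invFun X := (fun k i ↦ c⁻¹ * X i (e (Sum.inl k)), fun k i ↦ c⁻¹ * X i (e (Sum.inr k)))
  left_inv q := by ext <;> simp [hc]
  right_inv X := by
    ext i t
    obtain ⟨j, rfl⟩ := e.surjective t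
    rcases j with k | k <;> simp [hc]
  measurable_toFun := by
    refine measurable_pi_lambda _ fun i ↦ measurable_pi_lambda _ fun t ↦ ?_
    obtain ⟨j, rfl⟩ := e.surjective t
    rcases j with k | k <;> simp <;> fun_prop
  measurable_invFun := by simp; fun_prop

lemma measurePreserving_stackColumns (e : κ ⊕ κ' ≃ τ) {c : ℝ} (hc : c ≠ 0)
    (β : Measure ℝ) [IsProbabilityMeasure β] :
    MeasurePreserving (stackColumns (ι := ι) e hc)
      ((Measure.pi fun _ : κ ↦ Measure.pi fun _ : ι ↦ β).prod
        (Measure.pi fun _ : κ' ↦ Measure.pi fun _ : ι ↦ β))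
      (Measure.pi fun _ : ι ↦ Measure.pi fun _ : τ ↦ β.map fun x ↦ c * x) := by
  have hp : IsProbabilityMeasure (β.map fun x ↦ c * x) :=
    Measure.isProbabilityMeasure_map (by fun_prop)
  have hs : MeasurePreserving (fun x ↦ c * x) β (β.map fun x ↦ c * x) := ⟨by fun_prop, rfl⟩
  have m1 := measurePreserving_sumPiEquivProdPi_symm
    (fun _ : κ ⊕ κ' ↦ Measure.pi fun _ : ι ↦ β)
  have m2 := measurePreserving_piCongrLeft (fun _ : τ ↦ Measure.pi fun _ : ι ↦ β) e
  have m3 := measurePreserving_pi_swap (κ := τ) (ι := ι) β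
  have m4 := measurePreserving_pi _ _ fun _ : ι ↦ measurePreserving_pi _ _ fun _ : τ ↦ hs
  convert m4.comp (m3.comp (m2.comp m1)) using 1
  ext q i t
  obtain ⟨j, rfl⟩ := e.surjective t
  simp only [stackColumns, MeasurableEquiv.coe_mk, Equiv.coe_fn_mk, Function.comp_apply,
    Equiv.symm_apply_apply, MeasurableEquiv.coe_piCongrLeft, Equiv.piCongrLeft_apply_apply]
  rcases j with k | k <;> rfl

end Transport

section Assembly

variable {ι κ κ' τ : Type*} [Fintype ι] [DecidableEq ι] [Fintype κ] [DecidableEq κ] [Fintype κ']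
  [DecidableEq κ'] [Fintype τ]

lemma stackColumns_mul_transpose (e : κ ⊕ κ' ≃ τ) {c : ℝ} (hc : c ≠ 0) {n a : ℝ}
    (ha : (a * c) ^ 2 = n⁻¹) (q : (κ → ι → ℝ) × (κ' → ι → ℝ)) :
    (a • of (stackColumns e hc q)) * (a • of (stackColumns e hc q))ᵀ =
      scaledGram n q.1 + scaledGram n q.2 := by
  ext i j
  rw [Matrix.mul_apply, ← e.sum_comp, Fintype.sum_sum_type, Matrix.add_apply, scaledGram,
    scaledGram, Matrix.sum_apply, Matrix.sum_apply]
  congr 1 <;> refine Finset.sum_congr rfl fun k _ ↦ ?_ <;>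
    · simp only [stackColumns, MeasurableEquiv.coe_mk, Equiv.coe_fn_mk, transpose_apply,
        Matrix.smul_apply, of_apply, Equiv.symm_apply_apply, Sum.elim_inl, Sum.elim_inr,
        vecMulVec_apply, smul_eq_mul, ← ha]
      ring

lemma integrable_pow_four_of_lipschitz {ψ : ℝ → ℝ} {K : ℝ} (hψ : ∀ z w, |ψ z - ψ w| ≤ K * |z - w|)
    (hc : Continuous ψ) (h0 : ψ 0 = 0) : Integrable (fun z ↦ ψ z ^ 4) (gaussianReal 0 1) := by
  have h4 : Integrable (fun z : ℝ ↦ K ^ 4 * z ^ 4) (gaussianReal 0 1) := by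
    have := (memLp_id_gaussianReal (μ := 0) (v := 1) 4).integrable_norm_pow four_ne_zero
    refine (Integrable.congr this (Filter.Eventually.of_forall fun z ↦ ?_)).const_mul _
    simp only [id, Real.norm_eq_abs]
    exact Even.pow_abs ⟨2, rfl⟩ z
  refine h4.mono' (by fun_prop) (Filter.Eventually.of_forall fun z ↦ ?_)
  have := hψ z 0
  rw [h0, sub_zero, sub_zero] at this
  rw [norm_pow, Real.norm_eq_abs, ← Even.pow_abs ⟨2, rfl⟩ z, ← mul_pow]
  exact pow_le_pow_left₀ (abs_nonneg _) this 4

lemma measurePreserving_neg_map_odd {ψ : ℝ → ℝ} (hc : Continuous ψ) (hodd : ∀ z, ψ (-z) = -ψ z) :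
    MeasurePreserving (fun x : ℝ ↦ -x) ((gaussianReal 0 1).map ψ) ((gaussianReal 0 1).map ψ) := by
  refine ⟨measurable_neg, ?_⟩
  rw [Measure.map_map measurable_neg hc.measurable]
  have : (fun x : ℝ ↦ -x) ∘ ψ = ψ ∘ fun z ↦ -z := by ext z; simp [hodd]
  rw [this, ← Measure.map_map hc.measurable measurable_neg]
  congr 1
  simpa using gaussianReal_map_neg (μ := 0) (v := 1)

lemma exists_equiv_sum_fin {n : ℕ} (hn : 2 ≤ n) : ∃ n₁ n₂ : ℕ, Nonempty (Fin n₁ ⊕ Fin n₂ ≃ Fin n) ∧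
    (n₁ : ℝ) + n₂ = n ∧ (n : ℝ) / 3 ≤ n₁ ∧ (n : ℝ) / 3 ≤ n₂ := by
  have h : n / 2 + (n - n / 2) = n := by omega
  refine ⟨n / 2, n - n / 2, ⟨finSumFinEquiv.trans (finCongr h)⟩, by exact_mod_cast h, ?_, ?_⟩
  · have : n ≤ 3 * (n / 2) := by omega
    have : (n : ℝ) ≤ 3 * (n / 2 : ℕ) := by exact_mod_cast this
    linarith
  · have : n ≤ 3 * (n - n / 2) := by omega
    have : (n : ℝ) ≤ 3 * (n - n / 2 : ℕ) := by exact_mod_cast this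
    linarith

lemma opNorm_eq_norm {r : ℕ} (A : Matrix (Fin r) (Fin r) ℝ) : opNorm A = ‖A‖ :=
  (Matrix.l2_opNorm_def A).symm

end Assembly

end SpectralNorm

theorem stmt16 : ∃ C c' c'' : ℝ, 0 < C ∧ 0 < c' ∧ 0 < c'' ∧
    ∀ (p r n : ℕ), 1 ≤ r → r < min n p →
    ∀ (θ σ : ℝ), 0 < θ → θ ≤ 1 → 0 < σ → C * (r:ℝ) / θ^2 ≤ (n:ℝ) →
    ∀ (A UA : Matrix (Fin p) (Fin r) ℝ) (VA : Matrix (Fin r) (Fin r) ℝ) (d : Fin r → ℝ),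
      A.rank = r → opNorm A = 1 →
      A = UA * Matrix.diagonal d * VAᵀ → UAᵀ * UA = 1 → VAᵀ * VA = 1 →
      (∀ i : Fin r, 0 < d i) →
      bgMatrix r n θ (σ^2) {X | ¬ ∀ D : Matrix (Fin p) (Fin p) ℝ,
          D.PosSemidef →
          (∀ u : Fin p → ℝ, ∃ w : Fin n → ℝ, D *ᵥ u = (A * Matrix.of X) *ᵥ w) →
          (∀ w : Fin n → ℝ,
            D *ᵥ (D *ᵥ (((A * Matrix.of X) * (A * Matrix.of X)ᵀ) *ᵥ ((A * Matrix.of X) *ᵥ w)))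
              = (A * Matrix.of X) *ᵥ w) →
          ∃ Δ : Matrix (Fin r) (Fin r) ℝ,
            D * (A * Matrix.of X)
              = (UA * VAᵀ) * ((1/Real.sqrt (θ * (n:ℝ) * σ^2)) • Matrix.of X)
                + (UA * VAᵀ) * Δ * ((1/Real.sqrt (θ * (n:ℝ) * σ^2)) • Matrix.of X) ∧
            opNorm Δ ≤ c'' * (1/θ) * Real.sqrt ((r:ℝ)/(n:ℝ))}
      ≤ ENNReal.ofReal (2 * Real.exp (-c' * (r:ℝ))) := by
  obtain ⟨K, m, hK, hm, hψ⟩ := exists_lipschitz_normalised_bgLaw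
  set L := K + 2 * (1 + m) with hL
  have hL1 : 1 ≤ L := by linarith
  refine ⟨(5632 * L) ^ 2, 1, 35086528 * L, by positivity, one_pos, by positivity, ?_⟩
  intro p r n hr hrn θ σ hθ hθ1 hσ hn A UA VA d _ _ hA hU hV hd
  obtain ⟨ψ, hlip, hodd, h2, h4, hlaw⟩ := hψ θ hθ hθ1
  have hn2 : 2 ≤ n := by have := lt_min_iff.1 hrn; omega
  obtain ⟨n₁, n₂, ⟨e⟩, hcard, hn₁, hn₂⟩ := exists_equiv_sum_fin hn2
  have hn0 : (0 : ℝ) < n := by positivity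
  have hr1 : (1 : ℝ) ≤ r := by exact_mod_cast hr
  set M := L / θ with hM
  have hM0 : 0 < M := by positivity
  have hcont : Continuous ψ := by
    refine (LipschitzWith.of_dist_le_mul (K := (K / θ).toNNReal) fun z w ↦ ?_).continuous
    rw [Real.dist_eq, Real.dist_eq, Real.coe_toNNReal _ (by positivity)]
    exact hlip z w
  have hψ0 : ψ 0 = 0 := by
    have := hodd 0
    rw [neg_zero] at this
    linarith
  set β := (gaussianReal 0 1).map ψ with hβ
  have hβp : IsProbabilityMeasure β := Measure.isProbabilityMeasure_map hcont.aemeasurable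
  have hlipM (z w) : |ψ z - ψ w| ≤ M * |z - w| := by
    refine (hlip z w).trans (mul_le_mul_of_nonneg_right ?_ (abs_nonneg _))
    rw [hM]; gcongr; linarith
  have hcm : ColumnMoments (Measure.pi fun _ : Fin r ↦ β) (2 * (1 + m / θ)) := by
    refine columnMoments_pi (measurePreserving_neg_map_odd hcont hodd) ?_ ?_ ?_
    · rw [integrable_map_measure (by fun_prop) hcont.aemeasurable]
      exact integrable_pow_four_of_lipschitz hlip hcont hψ0
    · rw [integral_map hcont.aemeasurable (by fun_prop), h2]
    · rw [integral_map hcont.aemeasurable (by fun_prop), h4]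
  have hBM : 2 * (1 + m / θ) ≤ M := by
    have h1 : 1 ≤ 1 / θ := by rw [le_div_iff₀ hθ]; linarith
    calc 2 * (1 + m / θ) ≤ 2 * (1 / θ + m / θ) := by gcongr
      _ = 2 * (1 + m) / θ := by ring
      _ ≤ M := by rw [hM]; gcongr; linarith
  have hMn : M ≤ n := by
    refine le_trans ?_ hn
    rw [hM, div_le_div_iff₀ hθ (by positivity)]
    have h1 : θ ^ 2 ≤ θ := by nlinarith
    have h3 : L ≤ (5632 * L) ^ 2 := by nlinarith
    calc L * θ ^ 2 ≤ L * θ := by gcongr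
      _ ≤ (5632 * L) ^ 2 * 1 * θ := by rw [mul_one]; gcongr
      _ ≤ (5632 * L) ^ 2 * r * θ := by gcongr
  have hε : errorScale (Fin r) M n = L * (1 / θ) * √(r / n) := by
    rw [errorScale, Fintype.card_fin, hM]; ring
  have hsmall : 5632 * errorScale (Fin r) M n ≤ 1 := by
    have h1 : (r : ℝ) / n ≤ (θ / (5632 * L)) ^ 2 := by
      rw [div_pow, div_le_div_iff₀ hn0 (by positivity)]
      rw [div_le_iff₀ (by positivity)] at hn
      linarith
    have h3 := Real.sqrt_le_sqrt h1
    rw [Real.sqrt_sq (by positivity)] at h3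
    rw [hε]
    calc 5632 * (L * (1 / θ) * √(r / n)) ≤ 5632 * (L * (1 / θ) * (θ / (5632 * L))) := by gcongr
      _ = 1 := by field_simp
  have hVt : VAᵀᵀ * VAᵀ = 1 := by rw [transpose_transpose]; exact mul_eq_one_comm.1 hV
  have hs0 : σ * √θ ≠ 0 := by positivity
  have hmain := measure_polarFactor_sub_one_le (κ := Fin n₁) (κ' := Fin n₂) (n := n) hcm hM0
    (frobeniusConcentration_of_lipschitz hM0.le hlipM)
    (frobeniusConcentration_of_lipschitz hM0.le hlipM) hd hn0 (by simpa using hcard)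
    (by simpa using hn₁) (by simpa using hn₂) (by rw [Fintype.card_fin]; omega)
    (hBM.trans hMn) hBM hsmall hVt
  have hmp := measurePreserving_stackColumns (ι := Fin r) e hs0 β
  have hbg : (Measure.pi fun _ : Fin r ↦ Measure.pi fun _ : Fin n ↦ β.map fun x ↦ σ * √θ * x) =
      bgMatrix r n θ (σ ^ 2) := by
    rw [bgMatrix, hlaw σ, hβ, Measure.map_map (by fun_prop) hcont.measurable]
    rfl
  rw [hbg] at hmp
  rw [← hmp.measure_preimage_equiv, show -1 * (r : ℝ) = -(Fintype.card (Fin r) : ℝ) by simp]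
  refine (measure_mono ?_).trans hmain
  rintro q hq hgood
  refine hq ?_
  obtain ⟨hcoe, hnear⟩ := hgood
  intro D hD hrange hinv
  set c := √(θ * n * σ ^ 2) with hc
  have hc0 : 0 < c := Real.sqrt_pos.2 (by positivity)
  set X := of (stackColumns e hs0 q) with hX
  have hgram : (VAᵀ * ((1 / c) • X)) * (VAᵀ * ((1 / c) • X))ᵀ =
      (scaledGram n fun k ↦ VAᵀ *ᵥ q.1 k) + (scaledGram n fun k ↦ VAᵀ *ᵥ q.2 k) := by
    have ha : (1 / c * (σ * √θ)) ^ 2 = (n : ℝ)⁻¹ := by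
      rw [mul_pow, div_pow, mul_pow, hc, Real.sq_sqrt (by positivity), Real.sq_sqrt hθ.le]
      field_simp
    rw [scaledGram_mulVec, scaledGram_mulVec, ← Matrix.add_mul, ← Matrix.mul_add,
      ← stackColumns_mul_transpose e hs0 ha, transpose_mul]
    simp only [Matrix.mul_assoc]
    rfl
  have hY : A * X = c • (UA * diagonal d * (VAᵀ * ((1 / c) • X))) := by
    rw [Matrix.mul_smul, Matrix.mul_smul, smul_smul, mul_one_div_cancel hc0.ne', one_smul, hA]
    simp only [Matrix.mul_assoc]
  have hw := whitening_eq hU hd hc0 (by rw [hgram]; exact hcoe) hY hD hrange hinv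
  rw [hgram] at hw
  set T := polarFactor d ((scaledGram (n : ℝ) fun k ↦ VAᵀ *ᵥ q.1 k) +
    (scaledGram (n : ℝ) fun k ↦ VAᵀ *ᵥ q.2 k)) with hT
  refine ⟨VA * (T - 1) * VAᵀ, ?_, ?_⟩
  · have h3 : UA * VAᵀ * (VA * (T - 1) * VAᵀ) = UA * T * VAᵀ - UA * VAᵀ := by
      calc UA * VAᵀ * (VA * (T - 1) * VAᵀ) = UA * ((VAᵀ * VA) * ((T - 1) * VAᵀ)) := by
            simp only [Matrix.mul_assoc]
        _ = _ := by
            rw [hV, Matrix.one_mul, Matrix.sub_mul, Matrix.one_mul, Matrix.mul_sub,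
              Matrix.mul_assoc]
    rw [h3, Matrix.sub_mul, add_sub_cancel, hw]
    simp only [Matrix.mul_assoc]
  · rw [opNorm_eq_norm]
    refine (opNorm_mul_mul_transpose_le hV _).trans (hnear.trans (le_of_eq ?_))
    rw [hε]; ring

end
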